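/- For an interval I ⊆ [0,2π), γ > 0 and U ∈ U(n), let G_{n,γ,I}(U) be the number of unordered pairs {j,k} with j ≠ k, |θⱼ(U) − θₖ(U)| < γ and (θⱼ(U) + θₖ(U))/2 ∈ I. Let μ = |I|·γ³·n⁴/(144π²) and let Mₖ(μ) denote the k-th moment of a Poisson random variable with mean μ. Then for every integer k ≥ 1 there is a constant Cₖ (depending only on k) such that for all n ≥ 1, all γ > 0 and all intervals I ⊆ [0,2π): |∫_{U(n)} G_{n,γ,I}(U)^k dμₙ(U) − Mₖ(μ)| ≤ Cₖ · Mₖ(μ) · ( n⁻¹ + γ²n² + (γ²n²)³ + (n·|I|)^(−2/3) ). -/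

import Mathlib

open MeasureTheory Filter Topology Real

noncomputable instance matrixMeasurableSpace {m n α : Type*} [MeasurableSpace α] :
    MeasurableSpace (Matrix m n α) :=
  inferInstanceAs (MeasurableSpace (m → n → α))


namespace CUE

/-- signed sum over the integer interval between `0` and `b` -/
noncomputable def dsum {A : Type*} [AddCommGroup A] (h : ℤ → A) (b : ℤ) : A :=
  ∑ r ∈ Finset.Ioc 0 b, h r - ∑ r ∈ Finset.Ioc b 0, h r

section dsum
variable {A : Type*} [AddCommGroup A]

lemma dsum_zero (h : ℤ → A) : dsum h 0 = 0 := by simp [dsum]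

lemma dsum_succ (h : ℤ → A) (b : ℤ) : dsum h (b + 1) = dsum h b + h (b + 1) := by
  unfold dsum
  rcases le_or_gt 0 b with hb | hb
  · have h1 : Finset.Ioc (0:ℤ) (b + 1) = insert (b + 1) (Finset.Ioc 0 b) := by
      ext x; simp only [Finset.mem_Ioc, Finset.mem_insert]; omega
    have h2 : Finset.Ioc (b + 1) (0:ℤ) = ∅ := by
      ext x; simp only [Finset.mem_Ioc, Finset.notMem_empty, iff_false]; omega
    have h3 : Finset.Ioc b (0:ℤ) = ∅ := by
      ext x; simp only [Finset.mem_Ioc, Finset.notMem_empty, iff_false]; omega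
    rw [h1, h2, h3, Finset.sum_insert (by simp)]
    simp [add_comm]
  · have h1 : Finset.Ioc b (0:ℤ) = insert (b + 1) (Finset.Ioc (b + 1) 0) := by
      ext x; simp only [Finset.mem_Ioc, Finset.mem_insert]; omega
    have h2 : Finset.Ioc (0:ℤ) (b + 1) = ∅ := by
      ext x; simp only [Finset.mem_Ioc, Finset.notMem_empty, iff_false]; omega
    have h3 : Finset.Ioc (0:ℤ) b = ∅ := by
      ext x; simp only [Finset.mem_Ioc, Finset.notMem_empty, iff_false]; omega
    rw [h1, h2, h3, Finset.sum_insert (by simp)]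
    simp

lemma dsum_pred (h : ℤ → A) (b : ℤ) : dsum h (b - 1) = dsum h b - h b := by
  have := dsum_succ h (b - 1)
  rw [sub_add_cancel] at this
  rw [this]; simp

lemma map_dsum {B F : Type*} [AddCommGroup B] [FunLike F A B] [AddMonoidHomClass F A B] (f : F)
    (h : ℤ → A) (b : ℤ) : f (dsum h b) = dsum (fun r => f (h r)) b := by
  simp [dsum, map_sum]

lemma dsum_telescope (g : ℤ → A) (b : ℤ) : dsum (fun r => g r - g (r - 1)) b = g b - g 0 := by
  induction b using Int.induction_on with
  | zero => simp [dsum_zero]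
  | succ i ih => rw [dsum_succ, ih]; simp
  | pred i ih => rw [dsum_pred, ih]; simp

lemma dsum_const (x : A) (b : ℤ) : dsum (fun _ => x) b = b • x := by
  induction b using Int.induction_on with
  | zero => simp [dsum_zero]
  | succ i ih => rw [dsum_succ, ih, add_smul, one_smul]
  | pred i ih => rw [dsum_pred, ih, sub_smul, one_smul]

lemma dsum_congr {g h : ℤ → A} (H : ∀ r, g r = h r) (b : ℤ) : dsum g b = dsum h b := by
  rw [show g = h from funext H]

lemma dsum_add (g h : ℤ → A) (b : ℤ) :
    dsum (fun r => g r + h r) b = dsum g b + dsum h b := by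
  simp only [dsum, Finset.sum_add_distrib]; abel

lemma dsum_sub (g h : ℤ → A) (b : ℤ) :
    dsum (fun r => g r - h r) b = dsum g b - dsum h b := by
  simp only [dsum, Finset.sum_sub_distrib]; abel

lemma dsum_sum {ι : Type*} (s : Finset ι) (g : ι → ℤ → A) (b : ℤ) :
    dsum (fun r => ∑ i ∈ s, g i r) b = ∑ i ∈ s, dsum (g i) b := by
  simp only [dsum, Finset.sum_sub_distrib]
  rw [Finset.sum_comm, Finset.sum_comm (s := Finset.Ioc b 0)]

lemma dsum_reflect (g : ℤ → A) (b : ℤ) :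
    dsum (fun r => g (b + 1 - r)) b = dsum g b := by
  unfold dsum
  congr 1
  · apply Finset.sum_nbij' (fun r => b + 1 - r) (fun r => b + 1 - r) <;> intro a ha <;>
      simp only [Finset.mem_Ioc] at * <;> (try omega)
  · apply Finset.sum_nbij' (fun r => b + 1 - r) (fun r => b + 1 - r) <;> intro a ha <;>
      simp only [Finset.mem_Ioc] at * <;> (try omega)

end dsum

lemma mul_dsum {A : Type*} [Ring A] (x : A) (h : ℤ → A) (b : ℤ) :
    x * dsum h b = dsum (fun r => x * h r) b := map_dsum (AddMonoidHom.mulLeft x) h b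

lemma dsum_mul {A : Type*} [Ring A] (x : A) (h : ℤ → A) (b : ℤ) :
    dsum h b * x = dsum (fun r => h r * x) b := map_dsum (AddMonoidHom.mulRight x) h b

/-! ### Laurent polynomials -/

/-- Laurent polynomials in `n` variables. -/
abbrev LP (n : ℕ) := AddMonoidAlgebra ℂ (Fin n → ℤ)

variable {n : ℕ}

/-- the monomial `z_i ^ a` -/
noncomputable def zv (i : Fin n) (a : ℤ) : LP n := AddMonoidAlgebra.single (Pi.single i a) 1

lemma zv_add (i : Fin n) (a b : ℤ) : zv i (a + b) = zv i a * zv i b := by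
  simp [zv, AddMonoidAlgebra.single_mul_single, Pi.single_add]

lemma zv_zero (i : Fin n) : zv i 0 = 1 := by
  simp [zv, AddMonoidAlgebra.one_def]

/-- diagonal operator -/
noncomputable def diagOp (q : (Fin n → ℤ) → ℂ) : LP n →ₗ[ℂ] LP n where
  toFun f := AddMonoidAlgebra.ofCoeff (Finsupp.onFinset f.coeff.support
    (fun α => q α * f.coeff α) (fun α h => by
      simp only [Finsupp.mem_support_iff]; exact right_ne_zero_of_mul h))
  map_add' f g := by ext α; simp [mul_add]
  map_smul' c f := by ext α; simp [mul_left_comm]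

@[simp] lemma coeff_diagOp (q : (Fin n → ℤ) → ℂ) (f : LP n) (α : Fin n → ℤ) :
    (diagOp q f).coeff α = q α * f.coeff α := rfl

lemma diagOp_single (q : (Fin n → ℤ) → ℂ) (α : Fin n → ℤ) (c : ℂ) :
    diagOp q (AddMonoidAlgebra.single α c) = AddMonoidAlgebra.single α (q α * c) := by
  classical
  ext β
  by_cases h : α = β
  · subst h; simp
  · simp [h]

lemma leib (q : (Fin n → ℤ) →+ ℂ) (f g : LP n) :
    diagOp q (f * g) = diagOp q f * g + f * diagOp q g := by
  induction f using AddMonoidAlgebra.induction_linear with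
  | zero => simp
  | add f f' h h' => simp only [add_mul, map_add, h, h']; abel
  | single a r =>
    induction g using AddMonoidAlgebra.induction_linear with
    | zero => simp
    | add f f' h h' => simp only [mul_add, map_add, h, h']; abel
    | single b s =>
      simp only [AddMonoidAlgebra.single_mul_single, diagOp_single, ← AddMonoidAlgebra.single_add]
      congr 1
      rw [map_add]; ring

/-- coordinate as additive hom into `ℂ` -/
noncomputable def coordHom (i : Fin n) : (Fin n → ℤ) →+ ℂ :=
  (Int.castAddHom ℂ).comp (Pi.evalAddMonoidHom (fun _ => ℤ) i)

lemma coordHom_apply (i : Fin n) (α : Fin n → ℤ) : coordHom i α = (α i : ℂ) := rfl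

/-- `z_i ∂/∂z_i` as a derivation -/
noncomputable def dz (i : Fin n) : Derivation ℂ (LP n) (LP n) :=
  Derivation.mk' (diagOp (coordHom i)) (fun f g => by
    rw [leib]; simp only [smul_eq_mul]; ring)

lemma dz_apply (i : Fin n) (f : LP n) : dz i f = diagOp (coordHom i) f := rfl

lemma coeff_dz (i : Fin n) (f : LP n) (α : Fin n → ℤ) :
    (dz i f).coeff α = α i * f.coeff α := rfl

lemma dz_zv_self (i : Fin n) (a : ℤ) : dz i (zv i a) = (a : ℂ) • zv i a := by
  rw [dz_apply, zv, diagOp_single]; simp [coordHom_apply]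

lemma dz_zv_ne {i j : Fin n} (h : i ≠ j) (a : ℤ) : dz i (zv j a) = 0 := by
  rw [dz_apply, zv, diagOp_single]; simp [coordHom_apply, h]

/-- power sums -/
noncomputable def ps (n : ℕ) (a : ℤ) : LP n := ∑ i, zv i a

lemma dz_ps (i : Fin n) (a : ℤ) : dz i (ps n a) = (a : ℂ) • zv i a := by
  rw [ps, map_sum, Finset.sum_eq_single i]
  · exact dz_zv_self i a
  · intro j _ h; exact dz_zv_ne (Ne.symm h) a
  · simp

lemma ps_zero : ps n 0 = (n : LP n) := by simp [ps, zv_zero]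

/-- The algebra of power sums -/
noncomputable def W (n : ℕ) : Subalgebra ℂ (LP n) := Algebra.adjoin ℂ (Set.range (ps n))

lemma ps_mem_W (a : ℤ) : ps n a ∈ W n := Algebra.subset_adjoin ⟨a, rfl⟩

/-- the Vandermonde determinant -/
noncomputable def VV (n : ℕ) : LP n := (Matrix.vandermonde (fun i : Fin n => zv i 1)).det

lemma zv_pow (i : Fin n) (k : ℕ) : zv i 1 ^ k = zv i k := by
  induction k with
  | zero => simp [zv_zero]
  | succ k ih => rw [pow_succ, ih, ← zv_add]; push_cast; rfl

lemma prod_single {ι : Type*} (s : Finset ι) (f : ι → (Fin n → ℤ)) :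
    ∏ i ∈ s, (AddMonoidAlgebra.single (f i) 1 : LP n) = AddMonoidAlgebra.single (∑ i ∈ s, f i) 1 := by
  classical
  induction s using Finset.induction_on with
  | empty => simp [AddMonoidAlgebra.one_def]
  | insert a s ha ih => rw [Finset.prod_insert ha, Finset.sum_insert ha, ih,
      AddMonoidAlgebra.single_mul_single, one_mul]

/-- the exponent `ρ` -/
def rho (n : ℕ) : Fin n → ℤ := fun i => (i : ℕ)

lemma VV_eq_sum : VV n = ∑ τ : Equiv.Perm (Fin n),
    AddMonoidAlgebra.single (rho n ∘ τ) ((Equiv.Perm.sign τ : ℤ) : ℂ) := by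
  classical
  unfold VV
  rw [Matrix.det_apply', ← Equiv.sum_comp (Equiv.inv _)]
  refine Finset.sum_congr rfl fun τ _ => ?_
  simp only [Matrix.vandermonde_apply, zv_pow, Equiv.inv_apply, Equiv.Perm.sign_inv]
  rw [← Equiv.prod_comp τ]
  have hinv : ∀ i, τ⁻¹ (τ i) = i := fun i => τ.symm_apply_apply i
  simp only [hinv, zv]
  rw [prod_single]
  have : (∑ i, (Pi.single i ((τ i : ℕ) : ℤ) : Fin n → ℤ)) = rho n ∘ τ := by
    ext j
    simp [rho, Finset.sum_apply, Pi.single_apply]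
  rw [this]
  ext β
  simp [AddMonoidAlgebra.intCast_def, AddMonoidAlgebra.single_mul_single]

lemma dz_prod {ι : Type*} [DecidableEq ι] (D : Derivation ℂ (LP n) (LP n)) (s : Finset ι)
    (f : ι → LP n) :
    D (∏ i ∈ s, f i) = ∑ i ∈ s, D (f i) * ∏ j ∈ s.erase i, f j := by
  induction s using Finset.induction_on with
  | empty => simp
  | insert a s ha ih =>
    rw [Finset.prod_insert ha, Finset.sum_insert ha, D.leibniz, ih, Finset.erase_insert ha]
    simp only [smul_eq_mul]
    rw [add_comm, Finset.mul_sum]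
    congr 1
    · ring
    · refine Finset.sum_congr rfl fun i hi => ?_
      have hia : a ≠ i := by rintro rfl; exact ha hi
      rw [Finset.erase_insert_of_ne hia, Finset.prod_insert (by simp [ha])]
      ring

/-- `e_a(u,w)`: `∑_{r ∈ (0,a]} w^r u^{a-r}` -/
noncomputable def ee (a : ℤ) (u w : Fin n) : LP n := dsum (fun r => zv w r * zv u (a - r)) a

lemma ee_mul (a : ℤ) (u w : Fin n) :
    (zv w 1 - zv u 1) * ee a u w = zv w (a + 1) - zv w 1 * zv u a := by
  unfold ee
  rw [mul_dsum]
  have : ∀ r, (zv w 1 - zv u 1) * (zv w r * zv u (a - r)) =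
      (fun r => zv w (r + 1) * zv u (a - r)) r - (fun r => zv w (r + 1) * zv u (a - r)) (r - 1) := by
    intro r
    simp only [sub_mul]
    congr 1
    · rw [← mul_assoc, ← zv_add, add_comm]
    · rw [sub_add_cancel, mul_left_comm, ← zv_add]; congr 2; ring
  rw [dsum_congr this, dsum_telescope]
  simp [zv_zero]

/-- S_a -/
noncomputable def SS (n : ℕ) (a : ℤ) : LP n := dsum (fun r => ps n r * ps n (a - r)) a

lemma sum_ee (a : ℤ) : ∑ u : Fin n, ∑ w : Fin n, ee a u w = SS n a := by
  unfold SS ee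
  simp only [← dsum_sum]
  apply dsum_congr
  intro r
  rw [ps, ps, Finset.sum_mul_sum, Finset.sum_comm]

lemma ee_self (a : ℤ) (u : Fin n) : ee a u u = (a : ℂ) • zv u a := by
  unfold ee
  rw [dsum_congr (h := fun _ => zv u a), dsum_const]
  · rw [← Int.cast_smul_eq_zsmul ℂ]
  · intro r; rw [← zv_add]; congr 1; ring

/-- ordered pairs -/
def prs (n : ℕ) : Finset (Fin n × Fin n) := Finset.univ.filter fun p => p.1 < p.2

lemma VV_eq_prod : VV n = ∏ p ∈ prs n, (zv p.2 1 - zv p.1 1) := by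
  unfold VV prs
  rw [Matrix.det_vandermonde, Finset.prod_filter, ← Finset.univ_product_univ, Finset.prod_product]
  refine Finset.prod_congr rfl fun i _ => ?_
  rw [← Finset.prod_filter]
  congr 1
  ext j; simp

lemma sum_prs {A : Type*} [AddCommGroup A] (g : Fin n → Fin n → A) :
    ∑ p ∈ prs n, (g p.1 p.2 + g p.2 p.1) = ∑ u, ∑ w, g u w - ∑ u, g u u := by
  have h : ∀ u w : Fin n, g u w = (if u < w then g u w else 0) + (if w < u then g u w else 0) +
      (if u = w then g u w else 0) := by
    intro u w
    rcases lt_trichotomy u w with h | h | h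
    · simp [h, h.ne, h.not_gt]
    · simp [h]
    · simp [h, h.ne', h.not_gt]
  have h2 : ∑ u, ∑ w, g u w = ∑ u, ∑ w, (if u < w then g u w else 0) +
     ∑ u, ∑ w, (if w < u then g u w else 0) + ∑ u, g u u := by
    rw [← Finset.sum_add_distrib, ← Finset.sum_add_distrib]
    refine Finset.sum_congr rfl fun u _ => ?_
    conv_lhs => rw [Finset.sum_congr rfl fun w _ => h u w]
    rw [Finset.sum_add_distrib, Finset.sum_add_distrib]; simp
  rw [h2, prs, Finset.sum_filter, ← Finset.univ_product_univ, Finset.sum_product,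
    Finset.sum_comm (f := fun u w => if w < u then g u w else 0), ← Finset.sum_add_distrib]
  rw [add_sub_cancel_right]
  refine Finset.sum_congr rfl fun u _ => ?_
  rw [← Finset.sum_add_distrib]
  refine Finset.sum_congr rfl fun w _ => ?_
  split_ifs <;> simp

lemma sum_zv_dz_VV (a : ℤ) :
    2 * ∑ i, zv i a * dz i (VV n) = VV n * (SS n a - (a : ℂ) • ps n a)
      + ((n : ℂ) - 1) • (ps n a * VV n) := by
  classical
  have h1 : ∀ i, dz i (VV n) = ∑ p ∈ prs n, dz i (zv p.2 1 - zv p.1 1) *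
      ∏ q ∈ (prs n).erase p, (zv q.2 1 - zv q.1 1) := by
    intro i
    rw [VV_eq_prod, dz_prod]
  have h2 : ∀ p ∈ prs n, ∑ i, zv i a * dz i (zv p.2 1 - zv p.1 1) =
      zv p.2 (a + 1) - zv p.1 (a + 1) := by
    intro p hp
    simp only [map_sub, mul_sub, Finset.sum_sub_distrib]
    have : ∀ j : Fin n, ∑ i, zv i a * dz i (zv j 1) = zv j (a + 1) := by
      intro j
      rw [Finset.sum_eq_single j]
      · rw [dz_zv_self]; simp [zv_add]
      · intro i _ h; rw [dz_zv_ne h]; simp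
      · simp
    rw [this, this]
  have h3 : ∑ i, zv i a * dz i (VV n) = ∑ p ∈ prs n, (zv p.2 (a + 1) - zv p.1 (a + 1)) *
      ∏ q ∈ (prs n).erase p, (zv q.2 1 - zv q.1 1) := by
    simp only [h1, Finset.mul_sum]
    rw [Finset.sum_comm]
    refine Finset.sum_congr rfl fun p hp => ?_
    rw [← h2 p hp, Finset.sum_mul]
    refine Finset.sum_congr rfl fun i _ => ?_
    ring
  have h4 : ((n : ℂ) - 1) • (ps n a) = ∑ p ∈ prs n, (zv p.1 a + zv p.2 a) := by
    have := sum_prs (n := n) (fun u w => zv u a)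
    rw [this]
    simp only [Finset.sum_const, Finset.card_univ, Fintype.card_fin, sub_smul, one_smul]
    rw [← Finset.smul_sum, ← Nat.cast_smul_eq_nsmul ℂ]; rfl
  have h5 : SS n a - (a : ℂ) • ps n a = ∑ p ∈ prs n, (ee a p.1 p.2 + ee a p.2 p.1) := by
    rw [sum_prs, sum_ee]; simp only [ee_self, ps, Finset.smul_sum]
  rw [h5, ← smul_mul_assoc, h4, h3] 
  rw [Finset.mul_sum, Finset.mul_sum, Finset.sum_mul, ← Finset.sum_add_distrib]
  refine Finset.sum_congr rfl fun p hp => ?_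
  have hV : VV n = (zv p.2 1 - zv p.1 1) * ∏ q ∈ (prs n).erase p, (zv q.2 1 - zv q.1 1) := by
    rw [VV_eq_prod, Finset.mul_prod_erase _ (fun q => zv q.2 1 - zv q.1 1) hp]
  rw [hV]
  have e1 := ee_mul a p.1 p.2
  have e2 := ee_mul a p.2 p.1
  rw [zv_add] at e1 e2 ⊢
  rw [zv_add]
  linear_combination (-∏ q ∈ (prs n).erase p, (zv q.2 1 - zv q.1 1)) * (e1 - e2)

end CUE

namespace CUE
variable {n : ℕ}

lemma grad_ind (P : LP n → List (ℤ × LP n) → Prop)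
    (hconst : ∀ c : ℂ, P (algebraMap ℂ (LP n) c) [])
    (hps : ∀ a : ℤ, P (ps n a) [(a, algebraMap ℂ (LP n) a)])
    (hadd : ∀ f g l m, f ∈ W n → g ∈ W n → P f l → P g m → P (f + g) (l ++ m))
    (hmul : ∀ f g l m, f ∈ W n → g ∈ W n → P f l → P g m →
      P (f * g) (l.map (fun t => (t.1, g * t.2)) ++ m.map (fun t => (t.1, f * t.2))))
    (f : LP n) (hf : f ∈ W n) :
    ∃ l : List (ℤ × LP n), (∀ t ∈ l, t.2 ∈ W n) ∧
      (∀ i, dz i f = (l.map fun t => zv i t.1 * t.2).sum) ∧ P f l := by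
  induction hf using Algebra.adjoin_induction with
  | mem x hx =>
    obtain ⟨a, rfl⟩ := hx
    refine ⟨[(a, algebraMap ℂ (LP n) a)], ?_, ?_, hps a⟩
    · intro t ht
      simp only [List.mem_singleton] at ht
      subst ht
      exact (W n).algebraMap_mem _
    · intro i
      rw [dz_ps]
      simp only [List.map_cons, List.map_nil, List.sum_cons, List.sum_nil, add_zero]
      rw [Algebra.smul_def, mul_comm]
  | algebraMap r =>
    exact ⟨[], by simp, fun i => by rw [(dz i).map_algebraMap]; simp, hconst r⟩
  | add x y hx hy ihx ihy =>
    obtain ⟨l, h1, h2, h3⟩ := ihx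
    obtain ⟨m, h1', h2', h3'⟩ := ihy
    refine ⟨l ++ m, ?_, ?_, hadd _ _ _ _ hx hy h3 h3'⟩
    · intro t ht
      rcases List.mem_append.1 ht with h | h
      exacts [h1 t h, h1' t h]
    · intro i
      simp [h2, h2']
  | mul x y hx hy ihx ihy =>
    obtain ⟨l, h1, h2, h3⟩ := ihx
    obtain ⟨m, h1', h2', h3'⟩ := ihy
    refine ⟨_, ?_, ?_, hmul _ _ _ _ hx hy h3 h3'⟩
    · intro t ht
      rcases List.mem_append.1 ht with h | h
      · obtain ⟨s, hs, rfl⟩ := List.mem_map.1 h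
        exact (W n).mul_mem hy (h1 s hs)
      · obtain ⟨s, hs, rfl⟩ := List.mem_map.1 h
        exact (W n).mul_mem hx (h1' s hs)
    · intro i
      rw [(dz i).leibniz, h2, h2']
      simp only [List.map_append, List.map_map, List.sum_append, smul_eq_mul]
      rw [← List.sum_map_mul_left, ← List.sum_map_mul_left, add_comm]
      congr 2
      · apply List.map_congr_left; intro t _; simp only [Function.comp]; ring
      · apply List.map_congr_left; intro t _; simp only [Function.comp]; ring

/-- `Γ_a` -/
noncomputable def Gam (a : ℤ) (h : LP n) : LP n := ∑ i, zv i a * dz i h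

lemma dsum_mem {A : Type*} [Ring A] [Algebra ℂ A] (S : Subalgebra ℂ A) (g : ℤ → A)
    (hg : ∀ r, g r ∈ S) (b : ℤ) : dsum g b ∈ S :=
  S.sub_mem (S.sum_mem fun r _ => hg r) (S.sum_mem fun r _ => hg r)

lemma SS_mem (a : ℤ) : SS n a ∈ W n :=
  dsum_mem _ _ (fun _ => (W n).mul_mem (ps_mem_W _) (ps_mem_W _)) _

lemma Gam_eq_of_grad (a : ℤ) (h : LP n) (l : List (ℤ × LP n))
    (hl : ∀ i, dz i h = (l.map fun t => zv i t.1 * t.2).sum) :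
    Gam a h = (l.map fun t => ps n (a + t.1) * t.2).sum := by
  unfold Gam
  simp only [hl]
  clear hl
  induction l with
  | nil => simp
  | cons t l ih =>
    simp only [List.map_cons, List.sum_cons, mul_add, Finset.sum_add_distrib, ih]
    congr 1
    rw [ps, Finset.sum_mul]
    refine Finset.sum_congr rfl fun i _ => ?_
    rw [zv_add, mul_assoc]

lemma Gam_mem (a : ℤ) (h : LP n) (hh : h ∈ W n) : Gam a h ∈ W n := by
  obtain ⟨l, h1, h2, -⟩ := grad_ind (fun _ _ => True) (by simp) (by simp) (by simp) (by simp) h hh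
  rw [Gam_eq_of_grad a h l h2]
  apply Subalgebra.list_sum_mem
  intro x hx
  obtain ⟨t, ht, rfl⟩ := List.mem_map.1 hx
  exact (W n).mul_mem (ps_mem_W _) (h1 t ht)

/-- center -/
noncomputable def cen (n : ℕ) : ℝ := ((n : ℝ) - 1) / 2

/-- energy -/
noncomputable def qq (α : Fin n → ℤ) : ℝ := ∑ i, ((α i : ℝ) - cen n) ^ 2

noncomputable def en (α : Fin n → ℤ) : ℝ := qq α - qq (rho n)

lemma diagOp_en (F : LP n) : diagOp (fun α => (en α : ℂ)) F =
    ∑ i, (dz i (dz i F) - ((n : ℂ) - 1) • dz i F + ((cen n : ℂ) ^ 2) • F) - (qq (rho n) : ℂ) • F := by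
  ext α
  simp only [coeff_diagOp, AddMonoidAlgebra.coeff_sub, AddMonoidAlgebra.coeff_sum,
    AddMonoidAlgebra.coeff_add, AddMonoidAlgebra.coeff_smul, Finsupp.coe_sub, Finsupp.coe_add,
    Finsupp.coe_smul, Pi.sub_apply, Pi.add_apply, Pi.smul_apply, smul_eq_mul,
    Finsupp.finsetSum_apply, coeff_dz]
  simp only [en, qq]
  push_cast
  rw [sub_mul, Finset.sum_mul]
  congr 1
  refine Finset.sum_congr rfl fun i _ => ?_
  simp only [cen]
  push_cast
  ring

lemma qq_comp (α : Fin n → ℤ) (τ : Equiv.Perm (Fin n)) : qq (α ∘ τ) = qq α :=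
  Equiv.sum_comp τ (fun i => ((α i : ℝ) - cen n) ^ 2)

lemma diagOp_en_VV : diagOp (fun α => (en α : ℂ)) (VV n) = 0 := by
  rw [VV_eq_sum, map_sum]
  apply Finset.sum_eq_zero
  intro τ _
  rw [diagOp_single, en, qq_comp]
  simp

lemma lap_key (f : LP n) (l : List (ℤ × LP n))
    (hl : ∀ i, dz i f = (l.map fun t => zv i t.1 * t.2).sum) :
    diagOp (fun α => (en α : ℂ)) (f * VV n) =
      (l.map fun t => SS n t.1 * t.2 + Gam t.1 t.2).sum * VV n := by
  have h1 : diagOp (fun α => (en α : ℂ)) (f * VV n) =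
      ∑ i, (dz i (dz i f) * VV n + 2 * dz i f * dz i (VV n) - ((n : ℂ) - 1) • (dz i f * VV n)) := by
    have hV := diagOp_en_VV (n := n)
    rw [diagOp_en] at hV ⊢
    have : ∀ i, dz i (dz i (f * VV n)) - ((n : ℂ) - 1) • dz i (f * VV n) +
        ((cen n : ℂ) ^ 2) • (f * VV n) =
        (dz i (dz i f) * VV n + 2 * dz i f * dz i (VV n) - ((n : ℂ) - 1) • (dz i f * VV n)) +
        f * (dz i (dz i (VV n)) - ((n : ℂ) - 1) • dz i (VV n) + ((cen n : ℂ) ^ 2) • VV n) := by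
      intro i
      simp only [(dz i).leibniz, map_add, smul_eq_mul, Algebra.smul_def]
      ring
    simp only [this]
    rw [Finset.sum_add_distrib, ← Finset.mul_sum, sub_eq_zero.1 hV]
    simp only [Algebra.smul_def]
    ring
  rw [h1]
  simp only [hl]
  clear hl h1
  induction l with
  | nil => simp
  | cons t l ih =>
    simp only [List.map_cons, List.sum_cons, map_add, add_mul, mul_add, smul_add] at ih ⊢
    rw [← ih]
    have e1 : ∀ i, dz i (zv i t.1 * t.2) = (t.1 : ℂ) • zv i t.1 * t.2 + zv i t.1 * dz i t.2 := by
      intro i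
      rw [(dz i).leibniz, dz_zv_self]
      simp only [smul_eq_mul]
      ring
    have e2 := sum_zv_dz_VV (n := n) t.1
    have e3 : ∑ i, (dz i (zv i t.1 * t.2) * VV n + 2 * (zv i t.1 * t.2) * dz i (VV n) -
        ((n : ℂ) - 1) • (zv i t.1 * t.2 * VV n)) = SS n t.1 * t.2 * VV n + Gam t.1 t.2 * VV n := by
      have : ∑ i, (dz i (zv i t.1 * t.2) * VV n + 2 * (zv i t.1 * t.2) * dz i (VV n) -
        ((n : ℂ) - 1) • (zv i t.1 * t.2 * VV n)) =
        (t.1 : ℂ) • ps n t.1 * t.2 * VV n + Gam t.1 t.2 * VV n +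
          (2 * ∑ i, zv i t.1 * dz i (VV n)) * t.2 - ((n : ℂ) - 1) • (ps n t.1 * t.2 * VV n) := by
        simp only [e1, Gam, ps, Finset.mul_sum, Finset.sum_mul, Finset.smul_sum]
        rw [← Finset.sum_add_distrib, ← Finset.sum_add_distrib, ← Finset.sum_sub_distrib]
        refine Finset.sum_congr rfl fun i _ => ?_
        ring
      rw [this, e2]
      simp only [Algebra.smul_def]
      ring
    rw [← e3, ← Finset.sum_add_distrib]
    refine Finset.sum_congr rfl fun i _ => ?_
    ring

/-- antisymmetric coefficients -/
def AS (g : LP n) : Prop := ∀ (α : Fin n → ℤ) (τ : Equiv.Perm (Fin n)),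
  g.coeff (α ∘ τ) = ((Equiv.Perm.sign τ : ℤ) : ℂ) * g.coeff α

lemma AS_VV : AS (VV n) := by
  classical
  intro α τ
  simp only [VV_eq_sum, AddMonoidAlgebra.coeff_sum, AddMonoidAlgebra.coeff_single,
    Finsupp.finsetSum_apply, Finsupp.single_apply, Finset.mul_sum]
  rw [← Equiv.sum_comp (Equiv.mulRight τ)]
  refine Finset.sum_congr rfl fun σ _ => ?_
  have : (rho n ∘ ⇑(σ * τ) = α ∘ ⇑τ) ↔ rho n ∘ σ = α := by
    constructor
    · intro h
      ext i
      have := congrFun h (τ.symm i)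
      simpa using this
    · rintro rfl; rfl
  simp only [Equiv.coe_mulRight, this]
  split_ifs
  · simp [mul_comm]
  · simp

lemma AS_mul (f : LP n) (hf : f ∈ W n) : ∀ g, AS g → AS (f * g) := by
  induction hf using Algebra.adjoin_induction with
  | mem x hx =>
    obtain ⟨a, rfl⟩ := hx
    intro g hg α τ
    have key : ∀ β : Fin n → ℤ, (ps n a * g).coeff β = ∑ i, g.coeff (β - Pi.single i a) := by
      intro β
      rw [ps, Finset.sum_mul, AddMonoidAlgebra.coeff_sum, Finsupp.finsetSum_apply]
      refine Finset.sum_congr rfl fun i _ => ?_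
      have := AddMonoidAlgebra.coeff_single_mul_apply (g) (1:ℂ) (Pi.single i a) β
      rw [zv, this]
      simp [neg_add_eq_sub]
    rw [key, key, Finset.mul_sum]
    refine Eq.trans ?_ (Equiv.sum_comp τ
      (fun i : Fin n => ((Equiv.Perm.sign τ : ℤ):ℂ) * g.coeff (α - (Pi.single i a : Fin n → ℤ))))
    refine Finset.sum_congr rfl fun i _ => ?_
    rw [← hg]
    congr 1
    ext j
    simp [Pi.single_apply]
  | algebraMap r =>
    intro g hg α τ
    rw [← Algebra.smul_def]
    simp only [AddMonoidAlgebra.coeff_smul, Finsupp.coe_smul, Pi.smul_apply, smul_eq_mul, hg α τ]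
    ring
  | add x y hx hy ihx ihy =>
    intro g hg α τ
    rw [add_mul]
    simp only [AddMonoidAlgebra.coeff_add, Finsupp.coe_add, Pi.add_apply, ihx g hg α τ,
      ihy g hg α τ]
    ring
  | mul x y hx hy ihx ihy =>
    intro g hg
    rw [mul_assoc]
    exact ihx _ (ihy _ hg)

lemma AS_zero {g : LP n} (hg : AS g) {α : Fin n → ℤ} (h : ¬ Function.Injective α) :
    g.coeff α = 0 := by
  simp only [Function.Injective] at h
  push Not at h
  obtain ⟨i, j, hij, hne⟩ := h
  have := hg α (Equiv.swap i j)
  rw [Equiv.Perm.sign_swap hne] at this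
  have h2 : α ∘ (Equiv.swap i j) = α := by
    ext k
    simp only [Function.comp]
    rcases eq_or_ne k i with rfl | hk
    · simp [hij]
    rcases eq_or_ne k j with rfl | hk'
    · simp [hij]
    rw [Equiv.swap_apply_of_ne_of_ne hk hk']
  rw [h2] at this
  push_cast at this
  linear_combination this / 2

lemma en_min (α : Fin n → ℤ) (hα : Function.Injective α) (h : en α = 0) :
    ∃ τ : Equiv.Perm (Fin n), α = rho n ∘ τ := by
  set σ := Tuple.sort α with hσ
  have hm : Monotone (α ∘ σ) := Tuple.monotone_sort α
  have hs : StrictMono (α ∘ σ) := hm.strictMono_of_injective (hα.comp σ.injective)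
  set β := α ∘ σ with hβ
  have hq : qq β = qq (rho n) := by
    rw [hβ, qq_comp]; unfold en at h; linarith
  set d : Fin n → ℝ := fun i => (β i : ℝ) - (i : ℕ) with hd
  have hdm : Monotone d := by
    intro i j hij
    have : ∀ (k : ℕ) (i j : Fin n), (j : ℕ) = i + k → β i + k ≤ β j := by
      intro k
      induction k with
      | zero => intro i j h; have : i = j := Fin.ext (by omega); subst this; simp
      | succ k ih =>
        intro i j h
        have hk : (i : ℕ) + k < n := by have := j.2; omega
        have h1 := ih i ⟨i + k, hk⟩ rfl
        have h2 : β ⟨i + k, hk⟩ < β j := hs (Fin.lt_def.2 (by simp [h]))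
        push_cast; omega
    have h1 := this (j - i) i j (by have := Fin.le_def.1 hij; omega)
    have h2 : ((i : ℕ) : ℤ) ≤ (j : ℕ) := by exact_mod_cast hij
    have h3 : β i + ((j:ℕ) - (i:ℕ) : ℤ) ≤ β j := by
      have : (((j:ℕ) - (i:ℕ) : ℕ) : ℤ) = (j:ℕ) - (i:ℕ) := by
        have := Fin.le_def.1 hij; omega
      rw [this] at h1; exact h1
    have h4 : (β i : ℝ) + ((j:ℕ) - (i:ℕ)) ≤ β j := by exact_mod_cast h3
    simp only [hd]; linarith
  have hc : (∑ i : Fin n, (((i : ℕ) : ℝ) - cen n)) = 0 := by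
    rw [Finset.sum_sub_distrib, Fin.sum_univ_eq_sum_range (fun i => (i : ℝ)) n]
    have : (∑ i ∈ Finset.range n, (i : ℝ)) * 2 = n * (n - 1) := by
      clear * -
      induction n with
      | zero => simp
      | succ n ih => rw [Finset.sum_range_succ, add_mul, ih]; push_cast; ring
    simp only [Finset.sum_const, Finset.card_univ, Fintype.card_fin, nsmul_eq_mul, cen]
    linarith
  have hmono : Monovary (fun i : Fin n => ((i : ℕ) : ℝ) - cen n) d := by
    intro i j hij
    have : i ≤ j := by
      by_contra hcon
      exact absurd (hdm (not_le.1 hcon).le) (not_le.2 hij)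
    have : ((i : ℕ) : ℝ) ≤ (j : ℕ) := by exact_mod_cast this
    simp only; linarith
  have hch := hmono.sum_mul_sum_le_card_mul_sum
  rw [hc, zero_mul, Fintype.card_fin] at hch
  have hexp : qq β = qq (rho n) + 2 * ∑ i : Fin n, (((i : ℕ) : ℝ) - cen n) * d i + ∑ i, d i ^ 2 := by
    simp only [qq, rho, Finset.mul_sum]
    rw [← Finset.sum_add_distrib, ← Finset.sum_add_distrib]
    refine Finset.sum_congr rfl fun i _ => ?_
    simp only [hd]
    push_cast
    ring
  have hsum : ∑ i, d i ^ 2 ≤ 0 := by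
    rcases Nat.eq_zero_or_pos n with h0 | h0
    · subst h0; simp
    · have : 0 ≤ ∑ i : Fin n, (((i : ℕ) : ℝ) - cen n) * d i := by
        by_contra hcon
        push Not at hcon
        have : (n : ℝ) * ∑ i : Fin n, (((i : ℕ) : ℝ) - cen n) * d i < 0 :=
          mul_neg_of_pos_of_neg (by exact_mod_cast h0) hcon
        linarith
      linarith
  have hz : ∀ i, d i = 0 := by
    intro i
    have h0 : ∑ i, d i ^ 2 = 0 := le_antisymm hsum (Finset.sum_nonneg fun i _ => sq_nonneg _)
    have := (Finset.sum_eq_zero_iff_of_nonneg (fun i _ => sq_nonneg (d i))).1 h0 i (Finset.mem_univ _)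
    exact pow_eq_zero_iff (two_ne_zero) |>.1 this
  refine ⟨σ.symm, ?_⟩
  ext i
  have := hz (σ.symm i)
  simp only [hd, hβ, Function.comp, Equiv.apply_symm_apply, sub_eq_zero] at this
  simp only [Function.comp, rho]
  exact_mod_cast this

instance : NoZeroDivisors (LP n) := inferInstance

lemma coeff_VV_rho : (VV n).coeff (rho n) = 1 := by
  classical
  simp only [VV_eq_sum, AddMonoidAlgebra.coeff_sum, AddMonoidAlgebra.coeff_single,
    Finsupp.finsetSum_apply, Finsupp.single_apply]
  rw [Finset.sum_eq_single 1]
  · simp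
  · intro τ _ hτ
    rw [if_neg]
    intro h
    apply hτ
    ext i
    have := congrFun h i
    simp only [rho, Function.comp] at this
    exact_mod_cast this
  · simp

lemma VV_ne_zero : VV n ≠ 0 := by
  intro h
  have := coeff_VV_rho (n := n)
  rw [h] at this
  simp at this

/-- Uniqueness for the loop equations. -/
theorem loop_unique (L : LP n → ℂ)
    (hadd : ∀ f ∈ W n, ∀ g ∈ W n, L (f + g) = L f + L g)
    (hsmul : ∀ f ∈ W n, ∀ c : ℂ, L (c • f) = c * L f)
    (h1 : L 1 = 1)
    (hloop : ∀ a : ℤ, ∀ h ∈ W n, L (SS n a * h + Gam a h) = 0)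
    (f : LP n) (hf : f ∈ W n) : L f = (f * VV n).coeff (rho n) := by
  have hlist : ∀ l : List (LP n), (∀ t ∈ l, t ∈ W n) → (∀ t ∈ l, L t = 0) → L l.sum = 0 := by
    intro l
    induction l with
    | nil =>
      intro _ _
      have := hsmul 1 (W n).one_mem 0
      simpa using this
    | cons t l ih =>
      intro hm h0
      rw [List.sum_cons, hadd _ (hm _ (by simp)) _ (Subalgebra.list_sum_mem _ fun x hx => hm x (by simp [hx])),
        h0 _ (by simp), ih (fun x hx => hm x (by simp [hx])) (fun x hx => h0 x (by simp [hx]))]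
      simp
  generalize hN : (f * VV n).coeff.support.card = N
  induction N using Nat.strong_induction_on generalizing f with
  | _ N IH =>
  by_cases hex : ∃ α ∈ (f * VV n).coeff.support, en α ≠ 0
  · obtain ⟨α, hα, hne⟩ := hex
    obtain ⟨l, hl1, hl2, -⟩ := grad_ind (fun _ _ => True) (by simp) (by simp) (by simp) (by simp) f hf
    set g := (l.map fun t => SS n t.1 * t.2 + Gam t.1 t.2).sum with hg
    have hkey := lap_key f l hl2
    rw [← hg] at hkey
    have hgm : ∀ t ∈ (l.map fun t => SS n t.1 * t.2 + Gam t.1 t.2), t ∈ W n := by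
      intro x hx
      obtain ⟨t, ht, rfl⟩ := List.mem_map.1 hx
      exact (W n).add_mem ((W n).mul_mem (SS_mem _) (hl1 t ht)) (Gam_mem _ _ (hl1 t ht))
    have hgW : g ∈ W n := Subalgebra.list_sum_mem _ hgm
    have hg0 : L g = 0 := by
      apply hlist _ hgm
      intro x hx
      obtain ⟨t, ht, rfl⟩ := List.mem_map.1 hx
      exact hloop _ _ (hl1 t ht)
    have hc : ∀ β, ((f + (-(en α : ℂ)⁻¹) • g) * VV n).coeff β =
        (1 - (en β / en α : ℝ)) * (f * VV n).coeff β := by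
      intro β
      rw [add_mul, smul_mul_assoc, ← hkey]
      simp only [AddMonoidAlgebra.coeff_add, AddMonoidAlgebra.coeff_smul, Finsupp.coe_add,
        Finsupp.coe_smul, Pi.add_apply, Pi.smul_apply, coeff_diagOp, smul_eq_mul]
      push_cast
      ring
    have hW' : f + (-(en α : ℂ)⁻¹) • g ∈ W n := (W n).add_mem hf ((W n).smul_mem hgW _)
    have hlt : ((f + (-(en α : ℂ)⁻¹) • g) * VV n).coeff.support.card < N := by
      rw [← hN]
      apply Finset.card_lt_card
      refine ⟨?_, ?_⟩
      · intro β hβ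
        rw [Finsupp.mem_support_iff, hc] at hβ
        rw [Finsupp.mem_support_iff]
        exact right_ne_zero_of_mul hβ
      · intro hsub
        have := hsub hα
        rw [Finsupp.mem_support_iff, hc, div_self hne] at this
        simp at this
    have := IH _ hlt _ hW' rfl
    rw [hadd _ hf _ ((W n).smul_mem hgW _), hsmul _ hgW, hg0, hc] at this
    simpa [en] using this
  · push Not at hex
    have hAS := AS_mul f hf _ AS_VV
    have hfV : f * VV n = ((f * VV n).coeff (rho n)) • VV n := by
      ext β
      simp only [AddMonoidAlgebra.coeff_smul, Finsupp.coe_smul, Pi.smul_apply, smul_eq_mul]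
      by_cases hβ : Function.Injective β
      · by_cases he : en β = 0
        · obtain ⟨τ, rfl⟩ := en_min β hβ he
          rw [hAS, AS_VV, coeff_VV_rho]; ring
        · have h0 : (f * VV n).coeff β = 0 := by
            by_contra hcon
            exact he (hex β (Finsupp.mem_support_iff.2 hcon))
          have h0' : (VV n).coeff β = 0 := by
            have := congrArg (fun F : LP n => F.coeff β) (diagOp_en_VV (n := n))
            simp only [coeff_diagOp, AddMonoidAlgebra.coeff_zero, Finsupp.coe_zero, Pi.zero_apply,
              mul_eq_zero] at this
            rcases this with h | h
            · exact absurd (by exact_mod_cast h) he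
            · exact h
          rw [h0, h0', mul_zero]
      · rw [AS_zero hAS hβ, AS_zero AS_VV hβ, mul_zero]
    have hf1 : f = ((f * VV n).coeff (rho n)) • (1 : LP n) := by
      apply mul_right_cancel₀ (VV_ne_zero (n := n))
      rw [smul_mul_assoc, one_mul]
      exact hfV
    conv_lhs => rw [hf1]
    rw [hsmul _ (W n).one_mem, h1, mul_one]

end CUE

namespace CUE
variable {n : ℕ}

/-- evaluation of Laurent polynomials at angles -/
noncomputable def ev (t : Fin n → ℝ) : LP n →ₐ[ℂ] ℂ :=
  AddMonoidAlgebra.lift ℂ ℂ (Fin n → ℤ)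
    { toFun := fun α => Complex.exp ((∑ i, (α.toAdd i : ℂ) * t i) * Complex.I)
      map_one' := by simp
      map_mul' := by
        intro α β
        rw [← Complex.exp_add]
        congr 1
        simp [add_mul, Finset.sum_add_distrib] }

lemma ev_single (t : Fin n → ℝ) (α : Fin n → ℤ) (c : ℂ) :
    ev t (AddMonoidAlgebra.single α c) =
      c * Complex.exp ((∑ i, (α i : ℂ) * t i) * Complex.I) := by
  simp [ev, AddMonoidAlgebra.lift_single]

lemma ev_zv (t : Fin n → ℝ) (i : Fin n) (a : ℤ) :
    ev t (zv i a) = Complex.exp ((a : ℂ) * t i * Complex.I) := by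
  rw [zv, ev_single, one_mul, Finset.sum_eq_single i]
  · simp
  · intro j _ h; simp [h]
  · simp

lemma ev_ps (t : Fin n → ℝ) (a : ℤ) :
    ev t (ps n a) = ∑ i, Complex.exp ((a : ℂ) * t i * Complex.I) := by
  simp [ps, map_sum, ev_zv]

open Polynomial in
lemma det_aeval (A : Matrix (Fin n) (Fin n) ℂ) (z : Fin n → ℂ)
    (hz : A.charpoly = ∏ i, (X - C (z i))) (p : ℂ[X]) :
    (aeval A p).det = ∏ i, p.eval (z i) := by
  have h1 : ∀ c : ℂ, (A - algebraMap ℂ _ c).det = ∏ i, (z i - c) := by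
    intro c
    have h := Matrix.eval_charpoly A c
    rw [hz, Polynomial.eval_prod] at h
    have h2 : A - algebraMap ℂ _ c = -(Matrix.scalar (Fin n) c - A) := by
      rw [neg_sub]; rfl
    rw [h2, Matrix.det_neg, ← h]
    simp only [eval_sub, eval_X, eval_C]
    rw [show (-1 : ℂ) ^ Fintype.card (Fin n) = ∏ _i : Fin n, (-1 : ℂ) by simp,
      ← Finset.prod_mul_distrib]
    exact Finset.prod_congr rfl fun i _ => by ring
  have hsp : p = C p.leadingCoeff * (p.roots.map fun a => X - C a).prod :=
    (IsAlgClosed.splits p).eq_prod_roots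
  have h3 : ∀ s : Multiset ℂ, (aeval A (s.map fun a => X - C a).prod).det =
      ∏ i, ((s.map fun a => X - C a).prod).eval (z i) := by
    intro s
    induction s using Multiset.induction_on with
    | empty => simp
    | cons a s ih =>
      simp only [Multiset.map_cons, Multiset.prod_cons, map_mul, Matrix.det_mul, ih, eval_mul,
        Finset.prod_mul_distrib]
      congr 1
      simpa using h1 a
  rw [hsp, map_mul, Matrix.det_mul, h3]
  simp only [eval_mul, Finset.prod_mul_distrib, eval_C]
  congr 1
  rw [aeval_C, Matrix.algebraMap_eq_diagonal]
  simp

open Polynomial in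
lemma trace_pow_of_charpoly (A : Matrix (Fin n) (Fin n) ℂ) (z : Fin n → ℂ)
    (hz : A.charpoly = ∏ i, (X - C (z i))) (k : ℕ) :
    (A ^ k).trace = ∑ i, z i ^ k := by
  have h : (A ^ k).charpoly = ∏ i, (X - C (z i ^ k)) := by
    apply Polynomial.funext
    intro w
    rw [Matrix.eval_charpoly, Polynomial.eval_prod]
    have := det_aeval A z hz (C w - X ^ k)
    simp only [map_sub, aeval_C, map_pow, aeval_X, eval_sub, eval_C, eval_pow, eval_X] at this
    simp only [eval_sub, eval_C, eval_X]
    rw [← this]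
    rfl
  rw [Matrix.trace_eq_sum_roots_charpoly, h]
  have h2 : ∏ i, (X - C (z i ^ k)) =
      ((Finset.univ.val.map fun i => z i ^ k).map fun a => X - C a).prod := by
    rw [Multiset.map_map]; rfl
  rw [h2, Polynomial.roots_multiset_prod_X_sub_C]
  rfl

open Polynomial in
lemma trace_zpow (U : Matrix.unitaryGroup (Fin n) ℂ) (t : Fin n → ℝ)
    (ht : (Matrix.charpoly (U : Matrix (Fin n) (Fin n) ℂ)).roots
        = Multiset.map (fun j => Complex.exp ((t j : ℂ) * Complex.I))
            (Finset.univ : Finset (Fin n)).val) (b : ℤ) :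
    ((U ^ b : Matrix.unitaryGroup (Fin n) ℂ) : Matrix (Fin n) (Fin n) ℂ).trace
      = ev t (ps n b) := by
  have hz : (U : Matrix (Fin n) (Fin n) ℂ).charpoly =
      ∏ i, (X - C (Complex.exp ((t i : ℂ) * Complex.I))) := by
    have := (IsAlgClosed.splits (U : Matrix (Fin n) (Fin n) ℂ).charpoly).eq_prod_roots
    rw [(Matrix.charpoly_monic _).leadingCoeff, ht, C_1, one_mul, Multiset.map_map] at this
    exact this
  have hk := trace_pow_of_charpoly _ _ hz
  rw [ev_ps]
  obtain ⟨k, rfl | rfl⟩ := b.eq_nat_or_neg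
  · rw [zpow_natCast]
    push_cast
    rw [hk]
    refine Finset.sum_congr rfl fun i _ => ?_
    rw [← Complex.exp_nat_mul]
    ring_nf
  · rw [zpow_neg, zpow_natCast]
    have h : (((U ^ k)⁻¹ : Matrix.unitaryGroup (Fin n) ℂ) : Matrix (Fin n) (Fin n) ℂ) =
      ((U : Matrix (Fin n) (Fin n) ℂ) ^ k).conjTranspose := rfl
    rw [h, Matrix.trace_conjTranspose, hk, star_sum]
    refine Finset.sum_congr rfl fun i _ => ?_
    rw [← Complex.exp_nat_mul, Complex.star_def, ← Complex.exp_conj]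
    congr 1
    simp
    ring

end CUE

namespace CUE
variable {n : ℕ}

/-- the unitary group -/
abbrev UG (n : ℕ) := Matrix.unitaryGroup (Fin n) ℂ

/-- matrices -/
abbrev MA (n : ℕ) := Matrix (Fin n) (Fin n) ℂ

instance borelMat : BorelSpace (MA n) := inferInstanceAs (BorelSpace (Fin n → Fin n → ℂ))

instance scMat : SecondCountableTopology (MA n) :=
  inferInstanceAs (SecondCountableTopology (Fin n → Fin n → ℂ))

instance borelUG : BorelSpace (UG n) := Subtype.borelSpace _

instance compactUG : CompactSpace (UG n) := by
  refine isCompact_iff_compactSpace.1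
    (?_ : IsCompact ((Matrix.unitaryGroup (Fin n) ℂ : Submonoid (MA n)) : Set (MA n)))
  have hcl : IsClosed ((Matrix.unitaryGroup (Fin n) ℂ : Submonoid (MA n)) : Set (MA n)) := by
    have : ((Matrix.unitaryGroup (Fin n) ℂ : Submonoid (MA n)) : Set (MA n)) =
        {A : MA n | A * star A = 1} := by
      ext A; exact Matrix.mem_unitaryGroup_iff
    rw [this]
    exact isClosed_eq (continuous_id.mul continuous_star) continuous_const
  have hK : IsCompact (Set.pi Set.univ fun _ : Fin n => Set.pi Set.univ fun _ : Fin n =>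
      Metric.closedBall (0 : ℂ) 1) :=
    isCompact_univ_pi fun _ => isCompact_univ_pi fun _ => isCompact_closedBall _ _
  refine hK.of_isClosed_subset hcl ?_
  intro A hA i _ j _
  simpa using entry_norm_bound_of_unitary hA i j

instance topGroupUG : IsTopologicalGroup (UG n) := inferInstance

/-- one parameter subgroup -/
noncomputable def gexp (X : MA n) (hX : star X = -X) (t : ℝ) : UG n :=
  ⟨NormedSpace.exp (t • X), by
    rw [Matrix.mem_unitaryGroup_iff]
    have h : star (NormedSpace.exp (t • X)) = NormedSpace.exp (-(t • X)) := by
      rw [Matrix.star_eq_conjTranspose, ← Matrix.exp_conjTranspose]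
      congr 1
      rw [Matrix.conjTranspose_smul, ← Matrix.star_eq_conjTranspose, hX]
      simp
    rw [h, ← Matrix.exp_add_of_commute (t • X) (-(t • X))
      ((Commute.refl (t • X)).neg_right)]
    simp⟩

lemma gexp_zero (X : MA n) (hX : star X = -X) : gexp X hX 0 = 1 := by
  ext; simp [gexp]

lemma gexp_add (X : MA n) (hX : star X = -X) (s t : ℝ) :
    gexp X hX (s + t) = gexp X hX s * gexp X hX t := by
  apply Subtype.ext
  show NormedSpace.exp ((s + t) • X) = NormedSpace.exp (s • X) * NormedSpace.exp (t • X)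
  rw [add_smul, Matrix.exp_add_of_commute]
  exact ((Commute.refl X).smul_left s).smul_right t

/-- entrywise derivative at zero -/
def MD (A : ℝ → MA n) (A' : MA n) : Prop := ∀ i j, HasDerivAt (fun t => A t i j) (A' i j) 0

lemma MD.mul {A B : ℝ → MA n} {A' B' : MA n} (hA : MD A A') (hB : MD B B') :
    MD (fun t => A t * B t) (A' * B 0 + A 0 * B') := by
  intro i j
  have : HasDerivAt (fun t => ∑ k, A t i k * B t k j)
      (∑ k, (A' i k * B 0 k j + A 0 i k * B' k j)) 0 :=
    HasDerivAt.fun_sum fun k _ => (hA i k).mul (hB k j)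
  convert this using 1
  all_goals simp only [Matrix.add_apply, Matrix.mul_apply, Finset.sum_add_distrib]

lemma MD.const (A : MA n) : MD (fun _ => A) 0 := fun _ _ => hasDerivAt_const _ _

lemma MD.star {A : ℝ → MA n} {A' : MA n} (hA : MD A A') : MD (fun t => star (A t)) (star A') := by
  intro i j
  exact (hA j i).star

lemma MD.trace {A : ℝ → MA n} {A' : MA n} (hA : MD A A') :
    HasDerivAt (fun t => (A t).trace) A'.trace 0 :=
  HasDerivAt.fun_sum fun k _ => hA k k

section expd
attribute [local instance] Matrix.linftyOpNormedRing Matrix.linftyOpNormedAlgebra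

lemma gexp_deriv (X : MA n) (hX : star X = -X) :
    MD (fun t => (gexp X hX t : MA n)) X := by
  intro i j
  have h := hasDerivAt_exp_smul_const' (𝕂 := ℝ) X (0 : ℝ)
  have h2 := ((Matrix.entryLinearMap ℝ ℂ i j).toContinuousLinearMap.hasFDerivAt).comp_hasDerivAt
    (0 : ℝ) h
  simp only [zero_smul, NormedSpace.exp_zero, mul_one] at h2
  exact h2

end expd

lemma zpow_deriv (X : MA n) (hX : star X = -X) (U : UG n) (b : ℤ) :
    MD (fun t => (((gexp X hX t * U) ^ b : UG n) : MA n))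
      (dsum (fun r => ((U ^ (r - 1) : UG n) : MA n) * X * ((U ^ (b - r + 1) : UG n) : MA n)) b)
      := by
  have h1 : MD (fun t => ((gexp X hX t * U : UG n) : MA n)) (X * (U : MA n)) := by
    have := (gexp_deriv X hX).mul (MD.const (U : MA n))
    simpa using this
  have h2 : MD (fun t => (((gexp X hX t * U)⁻¹ : UG n) : MA n))
      (-(((U⁻¹ : UG n) : MA n) * X)) := by
    have := h1.star
    rw [star_mul, hX, mul_neg] at this
    exact this
  induction b using Int.induction_on with
  | zero => simpa [dsum_zero] using MD.const (1 : MA n)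
  | succ i ih =>
    have h := ih.mul h1
    have e : (fun t => (((gexp X hX t * U) ^ ((i : ℤ) + 1) : UG n) : MA n)) =
        (fun t => (((gexp X hX t * U) ^ (i : ℤ) : UG n) : MA n) *
          ((gexp X hX t * U : UG n) : MA n)) := by
      funext t
      rw [zpow_add_one]; rfl
    rw [e]
    convert h using 1
    rw [dsum_succ, dsum_mul]
    refine congrArg₂ (· + ·) ?_ ?_
    · apply dsum_congr
      intro r
      have e1 : ((U ^ ((i : ℤ) + 1 - r + 1) : UG n) : MA n) =
          ((U ^ ((i : ℤ) - r + 1) : UG n) : MA n) * (U : MA n) := by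
        rw [show (i : ℤ) + 1 - r + 1 = (i - r + 1) + 1 by ring, zpow_add_one U]; rfl
      rw [e1, gexp_zero, one_mul, mul_assoc _ _ (U : MA n)]
    · rw [gexp_zero, one_mul, show (i : ℤ) + 1 - 1 = i by ring,
        show (i : ℤ) + 1 - (i + 1) + 1 = 1 by ring, zpow_one, mul_assoc]
  | pred i ih =>
    have h := ih.mul h2
    have e : (fun t => (((gexp X hX t * U) ^ (-(i : ℤ) - 1) : UG n) : MA n)) =
        (fun t => (((gexp X hX t * U) ^ (-(i : ℤ)) : UG n) : MA n) *
          (((gexp X hX t * U)⁻¹ : UG n) : MA n)) := by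
      funext t
      rw [zpow_sub_one]; rfl
    rw [e]
    convert h using 1
    rw [dsum_pred, dsum_mul, sub_eq_add_neg]
    refine congrArg₂ (· + ·) ?_ ?_
    · apply dsum_congr
      intro r
      have e1 : ((U ^ (-(i : ℤ) - 1 - r + 1) : UG n) : MA n) =
          ((U ^ (-(i : ℤ) - r + 1) : UG n) : MA n) * ((U⁻¹ : UG n) : MA n) := by
        rw [show -(i : ℤ) - 1 - r + 1 = (-i - r + 1) - 1 by ring, zpow_sub_one U]; rfl
      rw [e1, gexp_zero, one_mul, mul_assoc _ _ ((U⁻¹ : UG n) : MA n)]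
    · have e1 : ((U ^ (-(i : ℤ) - 1) : UG n) : MA n) =
          ((U ^ (-(i : ℤ)) : UG n) : MA n) * ((U⁻¹ : UG n) : MA n) := by
        rw [zpow_sub_one U]; rfl
      rw [e1, gexp_zero, one_mul, mul_neg, show -(i : ℤ) - 1 - -(i : ℤ) + 1 = 0 by ring,
        zpow_zero, OneMemClass.coe_one, mul_one, mul_assoc]

end CUE

namespace CUE
variable {n : ℕ}

lemma int_zero (μ : Measure (UG n)) [IsProbabilityMeasure μ] [μ.IsMulLeftInvariant]
    (X : MA n) (hX : star X = -X) (Φ Ψ : UG n → ℂ) (hΦ : Continuous Φ) (hΨ : Continuous Ψ)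
    (h : ∀ U, HasDerivAt (fun t => Φ (gexp X hX t * U)) (Ψ U) 0) : ∫ U, Ψ U ∂μ = 0 := by
  have hd : ∀ U t, HasDerivAt (fun s => Φ (gexp X hX s * U)) (Ψ (gexp X hX t * U)) t := by
    intro U t
    have h1 := h (gexp X hX t * U)
    rw [← sub_self t] at h1
    have h2 := HasDerivAt.comp_sub_const t t h1
    refine h2.congr_of_eventuallyEq (Eventually.of_forall fun s => ?_)
    show Φ _ = Φ _
    rw [← mul_assoc, ← gexp_add, sub_add_cancel]
  obtain ⟨C, hC⟩ := isCompact_univ.exists_bound_of_continuousOn hΨ.continuousOn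
  have hintg : ∀ {f : UG n → ℂ}, Continuous f → Integrable f μ := fun hf =>
    hf.integrable_of_hasCompactSupport (HasCompactSupport.of_compactSpace _)
  have key := (hasDerivAt_integral_of_dominated_loc_of_deriv_le (μ := μ)
    (F := fun t U => Φ (gexp X hX t * U)) (F' := fun t U => Ψ (gexp X hX t * U)) (x₀ := (0:ℝ))
    (s := Set.univ) (bound := fun _ => C) univ_mem
    (Eventually.of_forall fun t => (hΦ.comp (continuous_const_mul _)).aestronglyMeasurable)
    (hintg (hΦ.comp (continuous_const_mul _)))
    ((hΨ.comp (continuous_const_mul _)).aestronglyMeasurable)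
    (Eventually.of_forall fun U t _ => hC _ trivial) (integrable_const C)
    (Eventually.of_forall fun U t _ => hd U t)).2
  have h0 : (fun t => ∫ U, Φ (gexp X hX t * U) ∂μ) = fun _ => ∫ U, Φ U ∂μ := by
    funext t
    exact integral_mul_left_eq_self Φ _
  rw [h0] at key
  have := key.unique (hasDerivAt_const _ _)
  simpa [gexp_zero] using this

lemma cont_integrable (μ : Measure (UG n)) [IsProbabilityMeasure μ] {f : UG n → ℂ}
    (hf : Continuous f) : Integrable f μ :=
  hf.integrable_of_hasCompactSupport (HasCompactSupport.of_compactSpace _)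

/-- the hypothesis on eigenangles -/
def IsAng (θ : UG n → Fin n → ℝ) : Prop := ∀ U : UG n, (Matrix.charpoly (U : MA n)).roots
        = Multiset.map (fun j => Complex.exp ((θ U j : ℂ) * Complex.I))
            (Finset.univ : Finset (Fin n)).val

lemma F_ps {θ : UG n → Fin n → ℝ} (hθ : IsAng θ) (U : UG n) (b : ℤ) :
    ev (θ U) (ps n b) = ((U ^ b : UG n) : MA n).trace := (trace_zpow U _ (hθ U) b).symm

lemma continuous_tr (Y Z : MA n) (a b : ℤ) : Continuous fun U : UG n =>
    (Y * ((U ^ a : UG n) : MA n) * Z * ((U ^ b : UG n) : MA n)).trace := by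
  apply Continuous.matrix_trace
  have : ∀ b : ℤ, Continuous fun U : UG n => ((U ^ b : UG n) : MA n) := fun b =>
    continuous_subtype_val.comp (continuous_zpow b)
  exact ((continuous_const.matrix_mul (this a)).matrix_mul continuous_const).matrix_mul (this b)

lemma continuous_tr1 (Y : MA n) (a : ℤ) : Continuous fun U : UG n =>
    (Y * ((U ^ a : UG n) : MA n)).trace := by
  have := continuous_tr Y 1 a 0
  simpa using this

lemma F_cont {θ : UG n → Fin n → ℝ} (hθ : IsAng θ) {f : LP n} (hf : f ∈ W n) :
    Continuous fun U => ev (θ U) f := by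
  induction hf using Algebra.adjoin_induction with
  | mem x hx =>
    obtain ⟨b, rfl⟩ := hx
    simp only [F_ps hθ]
    simpa using continuous_tr1 (1 : MA n) b
  | algebraMap r => simp only [AlgHom.commutes]; exact continuous_const
  | add x y _ _ hx hy => simp only [map_add]; exact hx.add hy
  | mul x y _ _ hx hy => simp only [map_mul]; exact hx.mul hy

lemma trace_dsum (g : ℤ → MA n) (b : ℤ) : (dsum g b).trace = dsum (fun r => (g r).trace) b :=
  map_dsum (Matrix.traceAddMonoidHom (Fin n) ℂ) g b

/-- derivative property -/
def DP (θ : UG n → Fin n → ℝ) (f : LP n) (l : List (ℤ × LP n)) : Prop :=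
  ∀ (X : MA n) (hX : star X = -X) (U : UG n),
        HasDerivAt (fun s => ev (θ (gexp X hX s * U)) f)
          ((l.map fun t => (X * ((U ^ t.1 : UG n) : MA n)).trace * ev (θ U) t.2).sum) 0

lemma F_deriv {θ : UG n → Fin n → ℝ} (hθ : IsAng θ) {f : LP n} (hf : f ∈ W n) :
    ∃ l : List (ℤ × LP n), (∀ t ∈ l, t.2 ∈ W n) ∧
      (∀ i, dz i f = (l.map fun t => zv i t.1 * t.2).sum) ∧ DP θ f l := by
  refine grad_ind (DP θ) ?_ ?_ ?_ ?_ f hf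
  · intro c X hX U
    simp only [AlgHom.commutes, List.map_nil, List.sum_nil]
    exact hasDerivAt_const _ _
  · intro a X hX U
    simp only [F_ps hθ]
    convert (zpow_deriv X hX U a).trace using 1
    rw [trace_dsum, dsum_congr (h := fun _ => (X * ((U ^ a : UG n) : MA n)).trace), dsum_const]
    · simp [mul_comm]
    · intro r
      rw [mul_assoc, Matrix.trace_mul_comm, mul_assoc, ← Submonoid.coe_mul]
      rw [← zpow_add]
      congr 4
      ring
  · intro f g l m _ _ hf hg X hX U
    simp only [map_add, List.map_append, List.sum_append]
    exact (hf X hX U).add (hg X hX U)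
  · intro f g l m _ _ hf hg X hX U
    simp only [map_mul, List.map_append, List.sum_append, List.map_map]
    refine HasDerivAt.congr_deriv ((hf X hX U).fun_mul (hg X hX U)) ?_
    simp only [gexp_zero, one_mul]
    rw [← List.sum_map_mul_right, ← List.sum_map_mul_left]
    refine congrArg₂ (· + ·) (congrArg List.sum (congrArg (fun F => List.map F l) ?_))
      (congrArg List.sum (congrArg (fun F => List.map F m) ?_))
    · funext t; simp only [Function.comp, map_mul]; ring
    · funext t; simp only [Function.comp, map_mul]; ring

/-- integrand of the loop equation -/
noncomputable def Psi (θ : UG n → Fin n → ℝ) (Y : MA n) (a : ℤ) (h : LP n)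
    (l : List (ℤ × LP n)) (U : UG n) (X : MA n) : ℂ :=
  dsum (fun r => (Y * ((U ^ (r - 1) : UG n) : MA n) * X * ((U ^ (a - r + 1) : UG n) : MA n)).trace) a
    * ev (θ U) h
  + (Y * ((U ^ a : UG n) : MA n)).trace *
    (l.map fun t => (X * ((U ^ t.1 : UG n) : MA n)).trace * ev (θ U) t.2).sum

lemma continuous_list_sum {α : Type*} [TopologicalSpace α] {β : Type*} (l : List β) (g : β → α → ℂ)
    (hg : ∀ b ∈ l, Continuous (g b)) : Continuous fun x => (l.map fun b => g b x).sum := by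
  induction l with
  | nil => simpa using continuous_const
  | cons b l ih =>
    simp only [List.map_cons, List.sum_cons]
    exact (hg b (by simp)).add (ih fun c hc => hg c (by simp [hc]))

lemma continuous_dsum {α : Type*} [TopologicalSpace α] (g : ℤ → α → ℂ)
    (hg : ∀ b, Continuous (g b)) (a : ℤ) : Continuous fun x => dsum (fun r => g r x) a :=
  (continuous_finsetSum _ fun b _ => hg b).sub (continuous_finsetSum _ fun b _ => hg b)

lemma Psi_cont {θ : UG n → Fin n → ℝ} (hθ : IsAng θ) (Y : MA n) (a : ℤ) (h : LP n) (hh : h ∈ W n)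
    (l : List (ℤ × LP n)) (hl : ∀ t ∈ l, t.2 ∈ W n) (X : MA n) :
    Continuous fun U => Psi θ Y a h l U X := by
  unfold Psi
  refine ((continuous_dsum _ (fun r => continuous_tr Y X (r - 1) (a - r + 1)) a).mul
    (F_cont hθ hh)).add ((continuous_tr1 Y a).mul (continuous_list_sum l _ fun t ht => ?_))
  exact (continuous_tr1 X t.1).mul (F_cont hθ (hl t ht))

lemma Psi_add (θ : UG n → Fin n → ℝ) (Y : MA n) (a : ℤ) (h : LP n)
    (l : List (ℤ × LP n)) (U : UG n) (X X' : MA n) :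
    Psi θ Y a h l U (X + X') = Psi θ Y a h l U X + Psi θ Y a h l U X' := by
  unfold Psi
  simp only [mul_add, add_mul, Matrix.trace_add, dsum_add, List.sum_map_add]
  ring

lemma Psi_smul (θ : UG n → Fin n → ℝ) (Y : MA n) (a : ℤ) (h : LP n)
    (l : List (ℤ × LP n)) (U : UG n) (c : ℂ) (X : MA n) :
    Psi θ Y a h l U (c • X) = c * Psi θ Y a h l U X := by
  unfold Psi
  simp only [mul_smul_comm, smul_mul_assoc, Matrix.trace_smul, smul_eq_mul, ← mul_dsum,
    mul_assoc, List.sum_map_mul_left]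
  ring

lemma Psi_int_skew {θ : UG n → Fin n → ℝ} (hθ : IsAng θ) (μ : Measure (UG n))
    [IsProbabilityMeasure μ] [μ.IsMulLeftInvariant] (Y : MA n) (a : ℤ) (h : LP n) (hh : h ∈ W n)
    (l : List (ℤ × LP n)) (hl : ∀ t ∈ l, t.2 ∈ W n) (hD : DP θ h l) (X : MA n)
    (hX : star X = -X) : ∫ U, Psi θ Y a h l U X ∂μ = 0 := by
  refine int_zero μ X hX (fun U => (Y * ((U ^ a : UG n) : MA n)).trace * ev (θ U) h) _
    ((continuous_tr1 Y a).mul (F_cont hθ hh)) (Psi_cont hθ Y a h hh l hl X) fun U => ?_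
  have h1 := ((MD.const Y).mul (zpow_deriv X hX U a)).trace
  refine HasDerivAt.congr_deriv (h1.fun_mul (hD X hX U)) ?_
  simp only [gexp_zero, one_mul, zero_mul, zero_add]
  unfold Psi
  rw [mul_dsum, trace_dsum]
  simp only [mul_assoc]

lemma Psi_int {θ : UG n → Fin n → ℝ} (hθ : IsAng θ) (μ : Measure (UG n))
    [IsProbabilityMeasure μ] [μ.IsMulLeftInvariant] (Y : MA n) (a : ℤ) (h : LP n) (hh : h ∈ W n)
    (l : List (ℤ × LP n)) (hl : ∀ t ∈ l, t.2 ∈ W n) (hD : DP θ h l) (X : MA n) :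
    ∫ U, Psi θ Y a h l U X ∂μ = 0 := by
  have e : X = (1/2 : ℂ) • (X - star X) + (Complex.I/2) • ((-Complex.I) • (X + star X)) := by
    rw [smul_smul, show Complex.I / 2 * -Complex.I = 1/2 by
      linear_combination (-1/2 : ℂ) * Complex.I_mul_I, ← smul_add]
    rw [show X - star X + (X + star X) = (2 : ℂ) • X by rw [two_smul]; abel, smul_smul]
    norm_num
  have h1 : star (X - star X) = -(X - star X) := by rw [star_sub, star_star]; abel
  have h2 : star ((-Complex.I) • (X + star X)) = -((-Complex.I) • (X + star X)) := by
    rw [star_smul, star_add, star_star]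
    simp [add_comm]
  generalize X - star X = A at e h1
  generalize (-Complex.I) • (X + star X) = B at e h2
  rw [e]
  simp only [Psi_add, Psi_smul]
  have hi : ∀ Z, Integrable (fun U => Psi θ Y a h l U Z) μ := fun Z =>
    cont_integrable μ (Psi_cont hθ Y a h hh l hl Z)
  rw [integral_add ((hi A).const_mul _) ((hi B).const_mul _), integral_const_mul,
    integral_const_mul, Psi_int_skew hθ μ Y a h hh l hl hD A h1,
    Psi_int_skew hθ μ Y a h hh l hl hD B h2]
  simp

lemma tr_units (A B : MA n) : ∑ i, ∑ j, (Matrix.single j i (1:ℂ) * A * Matrix.single i j (1:ℂ) * B).trace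
    = A.trace * B.trace := by
  have h : ∀ i j : Fin n, (Matrix.single j i (1:ℂ) * A * Matrix.single i j (1:ℂ) * B).trace =
      A i i * B j j := by
    intro i j
    rw [Matrix.single_mul_mul_single, Matrix.trace_single_mul]
    simp
  simp only [h]
  simp only [Matrix.trace, Matrix.diag, Finset.sum_mul_sum]

lemma tr_units2 (A B : MA n) :
    ∑ i, ∑ j, (Matrix.single j i (1:ℂ) * A).trace * (Matrix.single i j (1:ℂ) * B).trace
    = (A * B).trace := by
  simp only [Matrix.trace_single_mul]
  simp [Matrix.trace, Matrix.mul_apply]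

lemma Psi_sum {θ : UG n → Fin n → ℝ} (hθ : IsAng θ) (a : ℤ) (h : LP n)
    (l : List (ℤ × LP n)) (hl : ∀ i, dz i h = (l.map fun t => zv i t.1 * t.2).sum) (U : UG n) :
    ∑ i, ∑ j, Psi θ (Matrix.single j i (1:ℂ)) a h l U (Matrix.single i j (1:ℂ)) =
      ev (θ U) (SS n a * h + Gam a h) := by
  unfold Psi
  simp only [Finset.sum_add_distrib, ← Finset.sum_mul, ← dsum_sum, tr_units, map_add, map_mul]
  congr 1
  · congr 1
    unfold SS
    rw [map_dsum, ← dsum_reflect]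
    apply dsum_congr
    intro r
    rw [map_mul, F_ps hθ, F_ps hθ]
    rw [mul_comm]
    congr 4 <;> ring
  · rw [Gam_eq_of_grad a h l hl]
    clear hl
    induction l with
    | nil => simp
    | cons t l ih =>
      simp only [List.map_cons, List.sum_cons, mul_add, Finset.sum_add_distrib, map_add, ih]
      congr 1
      simp only [← mul_assoc, ← Finset.sum_mul, tr_units2]
      rw [map_mul, F_ps hθ, ← Submonoid.coe_mul, ← zpow_add]

/-- expectation of symmetric Laurent polynomials of eigenvalues -/
theorem expect_eq {θ : UG n → Fin n → ℝ} (hθ : IsAng θ) (μ : Measure (UG n))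
    [IsProbabilityMeasure μ] [μ.IsMulLeftInvariant] (f : LP n) (hf : f ∈ W n) :
    ∫ U, ev (θ U) f ∂μ = (f * VV n).coeff (rho n) := by
  refine loop_unique (fun f => ∫ U, ev (θ U) f ∂μ) ?_ ?_ ?_ ?_ f hf
  · intro f hf g hg
    simp only [map_add]
    exact integral_add (cont_integrable μ (F_cont hθ hf)) (cont_integrable μ (F_cont hθ hg))
  · intro f _ c
    simp only [map_smul, smul_eq_mul]
    exact integral_const_mul _ _
  · simp
  · intro a h hh
    obtain ⟨l, hl1, hl2, hl3⟩ := F_deriv hθ hh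
    simp only [← Psi_sum hθ a h l hl2]
    rw [integral_finsetSum]
    · refine Finset.sum_eq_zero fun i _ => ?_
      rw [integral_finsetSum]
      · exact Finset.sum_eq_zero fun j _ => Psi_int hθ μ _ a h hh l hl1 hl3 _
      · intro j _
        exact cont_integrable μ (Psi_cont hθ _ a h hh l hl1 _)
    · intro i _
      exact integrable_finsetSum _ fun j _ => cont_integrable μ (Psi_cont hθ _ a h hh l hl1 _)

end CUE

namespace CUE
variable {n : ℕ}

/-- monomial symmetric sums over embeddings -/
noncomputable def MM (n : ℕ) {κ : Type} [Fintype κ] (b : κ → ℤ) : LP n := by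
  classical
  exact ∑ ι : κ ↪ Fin n, ∏ l, zv (ι l) (b l)

lemma MM_def {κ : Type} [Fintype κ] [DecidableEq κ] (b : κ → ℤ) :
    MM n b = ∑ ι : κ ↪ Fin n, ∏ l, zv (ι l) (b l) := by
  unfold MM
  refine Finset.sum_congr (by ext; simp) fun _ _ => rfl

lemma MM_option {κ : Type} [Fintype κ] [DecidableEq κ] (b : Option κ → ℤ) :
    MM n b = MM n (fun l : κ => b (some l)) * ps n (b none) -
      ∑ l : κ, MM n (Function.update (fun l : κ => b (some l)) l (b (some l) + b none)) := by
  simp only [MM_def]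
  rw [← (Function.Embedding.optionEmbeddingEquiv κ (Fin n)).symm.sum_comp]
  rw [Fintype.sum_sigma, Finset.sum_comm, Finset.sum_mul, ← Finset.sum_sub_distrib]
  refine Finset.sum_congr rfl fun ι _ => ?_
  have h1 : ∀ l : κ, ∏ l', zv (ι l') (Function.update (fun l : κ => b (some l)) l
      (b (some l) + b none) l') = (∏ l', zv (ι l') (b (some l'))) * zv (ι l) (b none) := by
    intro l
    rw [← Finset.mul_prod_erase _ _ (Finset.mem_univ l),
      ← Finset.mul_prod_erase _ (fun l' => zv (ι l') (b (some l'))) (Finset.mem_univ l)]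
    rw [Function.update_self, zv_add]
    have : ∏ x ∈ Finset.univ.erase l, zv (ι x) (Function.update (fun l : κ => b (some l)) l
      (b (some l) + b none) x) = ∏ x ∈ Finset.univ.erase l, zv (ι x) (b (some x)) := by
      refine Finset.prod_congr rfl fun x hx => ?_
      rw [Function.update_of_ne (Finset.ne_of_mem_erase hx)]
    rw [this]; ring
  simp only [h1, ← Finset.mul_sum, Fintype.prod_option,
    Function.Embedding.optionEmbeddingEquiv_symm_apply, Function.Embedding.optionElim_apply,
    Option.elim'_none, Option.elim'_some]
  rw [← Finset.sum_mul, mul_comm, ← mul_sub]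
  congr 1
  rw [eq_sub_iff_add_eq', ps]
  rw [← Fintype.sum_subtype_add_sum_subtype (fun i => i ∈ Set.range ι) (fun i => zv i (b none))]
  congr 1
  refine ((Equiv.ofInjective ι ι.injective).sum_comp (fun i => zv (i : Fin n) (b none))).trans ?_
  exact Finset.sum_congr (by ext; simp) fun _ _ => rfl

lemma MM_mem (κ : Type) [Fintype κ] : ∀ b : κ → ℤ, MM n b ∈ W n := by
  classical
  refine Fintype.induction_empty_option (P := fun κ _ => ∀ b : κ → ℤ, MM n b ∈ W n) ?_ ?_ ?_ κ
  · intro α β _ e h b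
    let _ : Fintype α := Fintype.ofEquiv _ e.symm
    have : MM n b = MM n (b ∘ e) := by
      rw [MM_def, MM_def, ← (Equiv.embeddingCongr e.symm (Equiv.refl (Fin n))).sum_comp]
      refine Finset.sum_congr rfl fun ι _ => ?_
      rw [← e.prod_comp]
      simp [Equiv.embeddingCongr]
    rw [this]
    convert h (b ∘ e)
  · intro b
    rw [MM_def]
    simp
  · intro α _ h b
    rw [MM_option]
    exact (W n).sub_mem ((W n).mul_mem (h _) (ps_mem_W _)) ((W n).sum_mem fun l _ => h _)

/-- indicator matrix -/
def indM {κ : Type} (n : ℕ) (b : κ → ℤ) (k : κ → Fin n) : Matrix κ κ ℂ :=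
  Matrix.of fun l l' => if b l + (k l' : ℕ) = ((k l : ℕ) : ℤ) then 1 else 0

lemma coeff_MM {κ : Type} [Fintype κ] [DecidableEq κ] (b : κ → ℤ) :
    (MM n b * VV n).coeff (rho n) = ∑ k : κ → Fin n, (indM n b k).det := by
  classical
  have h0 : ∀ k : κ → Fin n, ¬ Function.Injective k → (indM n b k).det = 0 := by
    intro k hk
    rw [Function.Injective] at hk
    push Not at hk
    obtain ⟨i, j, hij, hne⟩ := hk
    exact Matrix.det_zero_of_column_eq hne (fun l => by simp [indM, hij])
  have h1 : ∑ k : κ → Fin n, (indM n b k).det = ∑ ι : κ ↪ Fin n, (indM n b ι).det := by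
    symm
    refine Finset.sum_of_injOn (fun ι : κ ↪ Fin n => (ι : κ → Fin n)) ?_ ?_ ?_ ?_
    · exact fun _ _ _ _ h => DFunLike.coe_injective h
    · simp
    · intro k _ hk
      apply h0
      intro hinj
      exact hk ⟨⟨k, hinj⟩, by simp⟩
    · simp
  rw [h1, MM_def, Finset.sum_mul, AddMonoidAlgebra.coeff_sum, Finsupp.finsetSum_apply]
  refine Finset.sum_congr rfl fun ι _ => ?_
  have h2 : ∏ l, zv (ι l) (b l) = AddMonoidAlgebra.single (∑ l, Pi.single (ι l) (b l)) 1 := by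
    unfold zv
    exact prod_single _ _
  rw [h2, VV_eq_sum, Finset.mul_sum, AddMonoidAlgebra.coeff_sum, Finsupp.finsetSum_apply,
    Matrix.det_apply']
  simp only [AddMonoidAlgebra.single_mul_single, one_mul, AddMonoidAlgebra.coeff_single,
    Finsupp.single_apply]
  have hs1 : ∀ l : κ, (∑ l', (Pi.single (ι l') (b l') : Fin n → ℤ)) (ι l) = b l := by
    intro l
    rw [Finset.sum_apply, Finset.sum_eq_single l]
    · simp
    · intro l' _ hne
      rw [Pi.single_eq_of_ne]
      exact fun h => hne (ι.injective h).symm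
    · simp
  have hs2 : ∀ i, i ∉ Set.range ι → (∑ l', (Pi.single (ι l') (b l') : Fin n → ℤ)) i = 0 := by
    intro i hi
    rw [Finset.sum_apply, Finset.sum_eq_zero]
    intro l' _
    rw [Pi.single_eq_of_ne]
    exact fun h => hi ⟨l', h.symm⟩
  symm
  refine Finset.sum_of_injOn (fun σ : Equiv.Perm κ => σ⁻¹.viaFintypeEmbedding ι) ?_ ?_ ?_ ?_
  · intro σ _ σ' _ h
    have := fun l => DFunLike.congr_fun h (ι l)
    simp only [Equiv.Perm.viaFintypeEmbedding_apply_image] at this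
    exact inv_injective (Equiv.ext fun l => ι.injective (this l))
  · simp
  · intro τ _ hτ
    rw [if_neg]
    intro h
    apply hτ
    have hfix : ∀ i, i ∉ Set.range ι → τ i = i := by
      intro i hi
      have := congrFun h i
      rw [Pi.add_apply, hs2 i hi, zero_add] at this
      simp only [rho, Function.comp] at this
      exact Fin.ext (by exact_mod_cast this)
    have hr : ∀ i, i ∈ Set.range ι ↔ τ i ∈ Set.range ι := by
      intro i
      constructor
      · intro hi
        by_contra hn
        have := hfix _ hn
        rw [τ.injective this] at hn
        exact hn hi
      · intro hi
        by_contra hn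
        rw [hfix i hn] at hi
        exact hn hi
    let σ : Equiv.Perm κ :=
      (ι.toEquivRange.trans (τ.subtypePerm (p := fun i => i ∈ Set.range ι)
        (fun i => (hr i).symm))).trans ι.toEquivRange.symm
    have hσ : ∀ l, ι (σ l) = τ (ι l) := by
      intro l
      have : ι.toEquivRange (σ l) = (τ.subtypePerm (p := fun i => i ∈ Set.range ι)
        (fun i => (hr i).symm)) (ι.toEquivRange l) := by simp [σ]
      have := congrArg Subtype.val this
      simpa using this
    refine ⟨σ⁻¹, by simp, ?_⟩
    ext i
    congr 1
    by_cases hi : i ∈ Set.range ι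
    · obtain ⟨l, rfl⟩ := hi
      simp only [inv_inv]
      rw [Equiv.Perm.viaFintypeEmbedding_apply_image, hσ]
    · simp only [inv_inv]
      rw [Equiv.Perm.viaFintypeEmbedding_apply_notMem_range _ _ hi, hfix i hi]
  · intro σ _
    have hcond : (∑ l', (Pi.single (ι l') (b l') : Fin n → ℤ)) +
        rho n ∘ (σ⁻¹.viaFintypeEmbedding ι) = rho n ↔
        ∀ l, b l + ((ι (σ⁻¹ l) : ℕ) : ℤ) = ((ι l : ℕ) : ℤ) := by
      constructor
      · intro h l
        have := congrFun h (ι l)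
        rw [Pi.add_apply, hs1] at this
        simpa [rho] using this
      · intro h
        ext i
        by_cases hi : i ∈ Set.range ι
        · obtain ⟨l, rfl⟩ := hi
          rw [Pi.add_apply, hs1]
          simpa [rho] using h l
        · rw [Pi.add_apply, hs2 i hi]
          simp only [Function.comp]
          rw [Equiv.Perm.viaFintypeEmbedding_apply_notMem_range _ _ hi, zero_add]
    simp only [hcond]
    simp only [Equiv.Perm.viaFintypeEmbedding_sign, Equiv.Perm.sign_inv]
    have hp : ∏ i, indM n b ι (σ i) i = if ∀ l, b l + ((ι (σ⁻¹ l) : ℕ) : ℤ) = ((ι l : ℕ) : ℤ)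
        then 1 else 0 := by
      have hx : ∀ l, σ (σ⁻¹ l) = l := fun l => by
        rw [← Equiv.Perm.mul_apply, mul_inv_cancel, Equiv.Perm.one_apply]
      refine (Equiv.prod_comp σ⁻¹ (fun i => indM n b ι (σ i) i)).symm.trans ?_
      simp only [indM, Matrix.of_apply, hx]
      rw [Finset.prod_ite_zero]
      simp
    rw [hp]
    split_ifs <;> simp

end CUE

namespace CUE
variable {n : ℕ}

/-- normalized Lebesgue measure on `[0, 2π)` -/
noncomputable def lam0 : Measure ℝ :=
  (ENNReal.ofReal (2 * π)⁻¹) • (volume.restrict (Set.Ico 0 (2 * π)))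

instance : IsProbabilityMeasure lam0 := by
  constructor
  rw [lam0, Measure.smul_apply, Measure.restrict_apply_univ, Real.volume_Ico, smul_eq_mul,
    ← ENNReal.ofReal_mul (by positivity)]
  rw [sub_zero, inv_mul_cancel₀ (by positivity), ENNReal.ofReal_one]

lemma integral_exp_lam0 (m : ℤ) :
    ∫ x, Complex.exp ((m : ℂ) * x * Complex.I) ∂lam0 = if m = 0 then 1 else 0 := by
  split_ifs with h
  · simp [h]
  · rw [lam0, integral_smul_measure, integral_Ico_eq_integral_Ioc,
      ← intervalIntegral.integral_of_le (by positivity)]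
    have hc : (m : ℂ) * Complex.I ≠ 0 := mul_ne_zero (by exact_mod_cast h) Complex.I_ne_zero
    have : ∀ x : ℝ, (m : ℂ) * x * Complex.I = (m * Complex.I) * x := fun x => by ring
    simp only [this]
    rw [integral_exp_mul_complex hc]
    have : (m : ℂ) * Complex.I * ((2 * π : ℝ) : ℂ) = m * (2 * π * Complex.I) := by
      push_cast; ring
    rw [this, Complex.exp_int_mul_two_pi_mul_I]
    simp

variable {κ : Type} [Fintype κ] [DecidableEq κ]

/-- feature matrix -/
noncomputable def PhiM (n : ℕ) {κ : Type} (x : κ → ℝ) : Matrix κ (Fin n) ℂ :=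
  Matrix.of fun l k => Complex.exp (((k : ℕ) : ℂ) * x l * Complex.I)

/-- kernel matrix -/
noncomputable def Rm (n : ℕ) {κ : Type} (x : κ → ℝ) : Matrix κ κ ℂ :=
  PhiM n x * (PhiM n x).conjTranspose

/-- correlation function -/
noncomputable def corr (n : ℕ) {κ : Type} [Fintype κ] [DecidableEq κ] (x : κ → ℝ) : ℝ :=
  (Rm n x).det.re

lemma Rm_apply {κ : Type} (x : κ → ℝ) (i j : κ) :
    Rm n x i j = ∑ k : Fin n, Complex.exp (((k : ℕ) : ℂ) * ((x i : ℂ) - x j) * Complex.I) := by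
  simp only [Rm, Matrix.mul_apply, PhiM, Matrix.of_apply, Matrix.conjTranspose_apply]
  refine Finset.sum_congr rfl fun k _ => ?_
  rw [Complex.star_def, ← Complex.exp_conj, ← Complex.exp_add]
  congr 1
  simp
  ring

open scoped ComplexOrder in
lemma det_Rm_nonneg (x : κ → ℝ) : 0 ≤ (Rm n x).det :=
  (Matrix.posSemidef_self_mul_conjTranspose (PhiM n x)).det_nonneg

open scoped ComplexOrder in
lemma corr_nonneg (x : κ → ℝ) : 0 ≤ corr n x := (Complex.le_def.1 (det_Rm_nonneg x)).1

open scoped ComplexOrder in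
lemma det_Rm (x : κ → ℝ) : (Rm n x).det = (corr n x : ℂ) := by
  apply Complex.ext
  · simp [corr]
  · simpa using (Complex.le_def.1 (det_Rm_nonneg (n := n) x)).2.symm

lemma continuous_det_Rm : Continuous fun x : κ → ℝ => (Rm n x).det := by
  apply Continuous.matrix_det
  apply continuous_matrix
  intro i j
  simp only [Rm_apply]
  fun_prop

lemma continuous_corr : Continuous (corr n : (κ → ℝ) → ℝ) :=
  Complex.continuous_re.comp continuous_det_Rm

lemma prod_indM (b : κ → ℤ) (k : κ → Fin n) (σ : Equiv.Perm κ) :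
    ∏ i, indM n b k (σ i) i =
      ∏ l, if b l + ((k (σ⁻¹ l) : ℕ) : ℤ) - ((k l : ℕ) : ℤ) = 0 then (1:ℂ) else 0 := by
  have hx : ∀ l, σ (σ⁻¹ l) = l := fun l => by
    rw [← Equiv.Perm.mul_apply, mul_inv_cancel, Equiv.Perm.one_apply]
  refine (Equiv.prod_comp σ⁻¹ (fun i => indM n b k (σ i) i)).symm.trans ?_
  simp only [indM, Matrix.of_apply, hx, sub_eq_zero]

lemma integral_corr (b : κ → ℤ) :
    ∫ x, Complex.exp ((∑ l, (b l : ℂ) * x l) * Complex.I) * (Rm n x).det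
      ∂(Measure.pi fun _ : κ => lam0) = ∑ k : κ → Fin n, (indM n b k).det := by
  have h1 : ∀ x : κ → ℝ, Complex.exp ((∑ l, (b l : ℂ) * x l) * Complex.I) * (Rm n x).det =
      ∑ k : κ → Fin n, ∑ σ : Equiv.Perm κ, ((Equiv.Perm.sign σ : ℤ) : ℂ) *
        ∏ l, Complex.exp (((b l + ((k (σ⁻¹ l) : ℕ) : ℤ) - ((k l : ℕ) : ℤ) : ℤ) : ℂ)
          * x l * Complex.I) := by
    intro x
    rw [Finset.sum_comm, Matrix.det_apply', Finset.mul_sum]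
    refine Finset.sum_congr rfl fun σ _ => ?_
    simp only [Rm_apply]
    rw [Finset.prod_univ_sum, Fintype.piFinset_univ, Finset.mul_sum, Finset.mul_sum]
    refine Finset.sum_congr rfl fun k _ => ?_
    rw [mul_left_comm]
    congr 1
    rw [← Complex.exp_sum, ← Complex.exp_sum, ← Complex.exp_add, ← Finset.sum_mul,
      ← Finset.sum_mul, ← add_mul]
    congr 2
    push_cast
    simp only [mul_sub, sub_mul, add_mul, Finset.sum_add_distrib, Finset.sum_sub_distrib]
    rw [add_sub_assoc]
    congr 2
    have := Equiv.sum_comp σ (fun l => ((k (σ⁻¹ l) : ℕ) : ℂ) * x l)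
    simpa using this
  have hintg : ∀ (k : κ → Fin n) (σ : Equiv.Perm κ), Integrable (fun x : κ → ℝ =>
      ∏ l, Complex.exp (((b l + ((k (σ⁻¹ l) : ℕ) : ℤ) - ((k l : ℕ) : ℤ) : ℤ) : ℂ)
          * x l * Complex.I)) (Measure.pi fun _ : κ => lam0) := by
    intro k σ
    refine Integrable.of_bound (C := 1) (Continuous.aestronglyMeasurable (by fun_prop))
      (Eventually.of_forall fun x => ?_)
    rw [norm_prod]
    refine (Finset.prod_eq_one fun l _ => ?_).le
    have := Complex.norm_exp_ofReal_mul_I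
      (((b l + ((k (σ⁻¹ l) : ℕ) : ℤ) - ((k l : ℕ) : ℤ) : ℤ) : ℝ) * x l)
    rw [← this]; push_cast; rfl
  simp only [h1]
  rw [integral_finsetSum _ fun k _ => integrable_finsetSum _ fun σ _ => (hintg k σ).const_mul _]
  refine Finset.sum_congr rfl fun k _ => ?_
  rw [integral_finsetSum _ fun σ _ => (hintg k σ).const_mul _, Matrix.det_apply']
  refine Finset.sum_congr rfl fun σ _ => ?_
  rw [integral_const_mul, prod_indM]
  congr 1
  rw [integral_fintype_prod_eq_prod (fun l (y : ℝ) => Complex.exp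
    (((b l + ((k (σ⁻¹ l) : ℕ) : ℤ) - ((k l : ℕ) : ℤ) : ℤ) : ℂ) * y * Complex.I))]
  refine Finset.prod_congr rfl fun l _ => ?_
  rw [integral_exp_lam0]

end CUE

namespace CUE
variable {n : ℕ}
variable {κ : Type} [Fintype κ] [DecidableEq κ]

/-- projection to the torus -/
noncomputable def pr {κ : Type} (x : κ → ℝ) : UnitAddTorus κ :=
  fun l => ((x l / (2 * π) : ℝ) : UnitAddCircle)

lemma continuous_pr {κ : Type} : Continuous (pr : (κ → ℝ) → UnitAddTorus κ) :=
  continuous_pi fun l => (AddCircle.continuous_mk' (1:ℝ)).comp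
    ((continuous_apply l).div_const _)

lemma mFourier_pr {κ : Type} [Fintype κ] (b : κ → ℤ) (x : κ → ℝ) : UnitAddTorus.mFourier b (pr x) =
    Complex.exp ((∑ l, (b l : ℂ) * x l) * Complex.I) := by
  rw [UnitAddTorus.mFourier]
  simp only [ContinuousMap.coe_mk]
  rw [Finset.sum_mul, Complex.exp_sum]
  refine Finset.prod_congr rfl fun l _ => ?_
  rw [pr, fourier_coe_apply]
  congr 1
  have : (π : ℂ) ≠ 0 := by exact_mod_cast Real.pi_ne_zero
  push_cast
  field_simp

/-- the section -/
noncomputable def sect {κ : Type} (t : UnitAddTorus κ) : κ → ℝ :=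
  fun l => 2 * π * (AddCircle.equivIco (1:ℝ) 0 (t l) : ℝ)

lemma measurable_sect {κ : Type} [Fintype κ] :
    Measurable (sect : UnitAddTorus κ → κ → ℝ) := by
  refine measurable_pi_lambda _ fun l => ?_
  have : Measurable fun t : UnitAddCircle => ((AddCircle.equivIco (1:ℝ) 0 t) : ℝ) :=
    measurable_subtype_coe.comp (AddCircle.measurableEquivIco (1:ℝ) 0).measurable
  exact (this.comp (measurable_pi_apply l)).const_mul _

lemma sect_pr {κ : Type} (x : κ → ℝ) (hx : ∀ l, x l ∈ Set.Ico (0:ℝ) (2 * π)) :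
    sect (pr x) = x := by
  ext l
  have h : x l / (2 * π) ∈ Set.Ico (0:ℝ) (0 + 1) := by
    have := hx l
    have hp := Real.pi_pos
    constructor
    · exact div_nonneg this.1 (by positivity)
    · rw [zero_add, div_lt_one (by positivity)]; exact this.2
  rw [sect, pr, AddCircle.equivIco_coe_of_mem h]
  have : π ≠ 0 := Real.pi_ne_zero
  field_simp

/-- empirical measure -/
noncomputable def NN (κ : Type) [Fintype κ] [DecidableEq κ] (t : Fin n → ℝ) :
    Measure (UnitAddTorus κ) :=
  ∑ ι : κ ↪ Fin n, Measure.dirac (pr (t ∘ ι))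

instance (t : Fin n → ℝ) : IsFiniteMeasure (NN κ t) := by
  unfold NN; infer_instance

lemma integral_NN (t : Fin n → ℝ) (f : C(UnitAddTorus κ, ℂ)) :
    ∫ x, f x ∂(NN κ t) = ∑ ι : κ ↪ Fin n, f (pr (t ∘ ι)) := by
  rw [NN, integral_finsetSum_measure]
  · simp
  · intro ι _
    exact f.continuous.integrable_of_hasCompactSupport (HasCompactSupport.of_compactSpace _)

lemma norm_det_Rm_le (x : κ → ℝ) :
    ‖(Rm n x).det‖ ≤ (Fintype.card κ).factorial * (n : ℝ) ^ Fintype.card κ := by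
  have h : ∀ i j, ‖Rm n x i j‖ ≤ n := by
    intro i j
    rw [Rm_apply]
    refine (norm_sum_le _ _).trans ?_
    have : ∀ k : Fin n, ‖Complex.exp (((k : ℕ) : ℂ) * ((x i : ℂ) - x j) * Complex.I)‖ = 1 := by
      intro k
      rw [← Complex.norm_exp_ofReal_mul_I (((k : ℕ) : ℝ) * (x i - x j))]
      push_cast; rfl
    simp [this]
  have := Matrix.det_le (A := Rm n x) (abv := NormedField.toAbsoluteValue ℂ) (x := (n : ℝ)) h
  simpa [NormedField.toAbsoluteValue] using this

/-- limiting measure -/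
noncomputable def nu2 (n : ℕ) (κ : Type) [Fintype κ] [DecidableEq κ] : Measure (UnitAddTorus κ) :=
  Measure.map pr ((Measure.pi fun _ : κ => lam0).withDensity
    fun x => ENNReal.ofReal (corr n x))

lemma measurable_corr : Measurable (corr n : (κ → ℝ) → ℝ) := continuous_corr.measurable

lemma corr_le (x : κ → ℝ) :
    corr n x ≤ (Fintype.card κ).factorial * (n : ℝ) ^ Fintype.card κ :=
  ((Complex.re_le_norm _).trans (norm_det_Rm_le x))

instance finNu2 : IsFiniteMeasure (nu2 n κ) := by
  have : IsFiniteMeasure ((Measure.pi fun _ : κ => lam0).withDensity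
    fun x => ENNReal.ofReal (corr n x)) := by
    refine isFiniteMeasure_withDensity (ne_of_lt ?_)
    refine lt_of_le_of_lt (lintegral_mono fun x => ENNReal.ofReal_le_ofReal (corr_le x)) ?_
    rw [lintegral_const]; exact ENNReal.mul_lt_top ENNReal.ofReal_lt_top (measure_lt_top _ _)
  unfold nu2
  infer_instance

lemma integral_nu2_mFourier (b : κ → ℤ) :
    ∫ t, UnitAddTorus.mFourier b t ∂(nu2 n κ) = ∑ k : κ → Fin n, (indM n b k).det := by
  rw [nu2, integral_map continuous_pr.measurable.aemeasurable
    (UnitAddTorus.mFourier b).continuous.aestronglyMeasurable,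
    integral_withDensity_eq_integral_toReal_smul measurable_corr.ennreal_ofReal
      (Eventually.of_forall fun x => ENNReal.ofReal_lt_top), ← integral_corr]
  refine integral_congr_ae (Eventually.of_forall fun x => ?_)
  simp only [mFourier_pr, ENNReal.toReal_ofReal (corr_nonneg _), det_Rm]
  rw [Complex.real_smul, mul_comm]

lemma NN_mFourier {θ : UG n → Fin n → ℝ} (b : κ → ℤ) (U : UG n) :
    ∑ ι : κ ↪ Fin n, UnitAddTorus.mFourier b (pr (θ U ∘ ι)) = ev (θ U) (MM n b) := by
  rw [MM_def, map_sum]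
  refine Finset.sum_congr rfl fun ι _ => ?_
  rw [mFourier_pr, map_prod, Finset.sum_mul, Complex.exp_sum]
  simp only [ev_zv]
  rfl

lemma span_case {θ : UG n → Fin n → ℝ} (hθ : IsAng θ) (μ : Measure (UG n))
    [IsProbabilityMeasure μ] [μ.IsMulLeftInvariant] (f : C(UnitAddTorus κ, ℂ))
    (hf : f ∈ Submodule.span ℂ (Set.range (UnitAddTorus.mFourier (d := κ)))) :
    Continuous (fun U => ∑ ι : κ ↪ Fin n, f (pr (θ U ∘ ι))) ∧
      ∫ U, ∑ ι : κ ↪ Fin n, f (pr (θ U ∘ ι)) ∂μ = ∫ t, f t ∂(nu2 n κ) := by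
  induction hf using Submodule.span_induction with
  | mem f hf =>
    obtain ⟨b, rfl⟩ := hf
    simp only [NN_mFourier]
    refine ⟨F_cont hθ (MM_mem κ b), ?_⟩
    rw [expect_eq hθ μ _ (MM_mem κ b), coeff_MM, integral_nu2_mFourier]
  | zero => simp [continuous_const]
  | add f g _ _ hf hg =>
    simp only [ContinuousMap.add_apply, Finset.sum_add_distrib]
    refine ⟨hf.1.add hg.1, ?_⟩
    rw [integral_add (cont_integrable μ hf.1) (cont_integrable μ hg.1), integral_add, hf.2, hg.2]
    · exact f.continuous.integrable_of_hasCompactSupport (HasCompactSupport.of_compactSpace _)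
    · exact g.continuous.integrable_of_hasCompactSupport (HasCompactSupport.of_compactSpace _)
  | smul c f _ hf =>
    simp only [ContinuousMap.smul_apply, smul_eq_mul, ← Finset.mul_sum]
    refine ⟨continuous_const.mul hf.1, ?_⟩
    rw [integral_const_mul, integral_const_mul, hf.2]

lemma cont_case {θ : UG n → Fin n → ℝ} (hθ : IsAng θ) (μ : Measure (UG n))
    [IsProbabilityMeasure μ] [μ.IsMulLeftInvariant] (f : C(UnitAddTorus κ, ℂ)) :
    Continuous (fun U => ∑ ι : κ ↪ Fin n, f (pr (θ U ∘ ι))) ∧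
      ∫ U, ∑ ι : κ ↪ Fin n, f (pr (θ U ∘ ι)) ∂μ = ∫ t, f t ∂(nu2 n κ) := by
  have happ : ∀ ε > 0, ∃ g ∈ Submodule.span ℂ (Set.range (UnitAddTorus.mFourier (d := κ))),
      dist f g < ε := by
    intro ε hε
    have : f ∈ closure (Submodule.span ℂ (Set.range (UnitAddTorus.mFourier (d := κ))) :
        Set C(UnitAddTorus κ, ℂ)) := by
      rw [← Submodule.topologicalClosure_coe, UnitAddTorus.span_mFourier_closure_eq_top]
      trivial
    obtain ⟨g, hg, h⟩ := Metric.mem_closure_iff.1 this ε hε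
    exact ⟨g, hg, h⟩
  set m : ℝ := ((Fintype.card (κ ↪ Fin n) : ℕ) : ℝ) with hm
  have hm0 : 0 ≤ m := by positivity
  have hsum : ∀ (g : C(UnitAddTorus κ, ℂ)) (U : UG n), ‖∑ ι : κ ↪ Fin n, f (pr (θ U ∘ ι)) -
      ∑ ι : κ ↪ Fin n, g (pr (θ U ∘ ι))‖ ≤ m * dist f g := by
    intro g U
    rw [← Finset.sum_sub_distrib]
    refine (norm_sum_le _ _).trans ((Finset.sum_le_card_nsmul _ _ (dist f g) fun ι _ => ?_).trans ?_)
    · rw [← dist_eq_norm]; exact ContinuousMap.dist_apply_le_dist _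
    · simp [hm, Finset.card_univ]
  have hc : Continuous (fun U => ∑ ι : κ ↪ Fin n, f (pr (θ U ∘ ι))) := by
    refine continuous_of_uniform_approx_of_continuous fun u hu => ?_
    obtain ⟨ε, hε, hu⟩ := Metric.mem_uniformity_dist.1 hu
    obtain ⟨g, hg, hd⟩ := happ (ε / (m + 1)) (by positivity)
    refine ⟨_, (span_case hθ μ g hg).1, fun U => hu ?_⟩
    rw [dist_eq_norm]
    refine (hsum g U).trans_lt ?_
    rw [lt_div_iff₀ (by positivity)] at hd
    nlinarith [dist_nonneg (x := f) (y := g)]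
  refine ⟨hc, ?_⟩
  refine eq_of_forall_dist_le fun ε hε => ?_
  set V : ℝ := (nu2 n κ).real Set.univ
  have hV : 0 ≤ V := measureReal_nonneg
  obtain ⟨g, hg, hd⟩ := happ (ε / (m + V + 1)) (by positivity)
  obtain ⟨hgc, hge⟩ := span_case hθ μ g hg
  have hfi : Integrable f (nu2 n κ) :=
    f.continuous.integrable_of_hasCompactSupport (HasCompactSupport.of_compactSpace _)
  have hgi : Integrable g (nu2 n κ) :=
    g.continuous.integrable_of_hasCompactSupport (HasCompactSupport.of_compactSpace _)
  have e1 : dist (∫ U, ∑ ι : κ ↪ Fin n, f (pr (θ U ∘ ι)) ∂μ)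
      (∫ U, ∑ ι : κ ↪ Fin n, g (pr (θ U ∘ ι)) ∂μ) ≤ m * dist f g := by
    rw [dist_eq_norm, ← integral_sub (cont_integrable μ hc) (cont_integrable μ hgc)]
    refine (norm_integral_le_of_norm_le_const (Eventually.of_forall fun U => hsum g U)).trans ?_
    simp
  have e2 : dist (∫ t, g t ∂(nu2 n κ)) (∫ t, f t ∂(nu2 n κ)) ≤ dist f g * V := by
    rw [dist_comm, dist_eq_norm, ← integral_sub hfi hgi]
    refine norm_integral_le_of_norm_le_const (Eventually.of_forall fun t => ?_)
    rw [← dist_eq_norm]; exact ContinuousMap.dist_apply_le_dist _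
  rw [lt_div_iff₀ (by positivity)] at hd
  have := dist_triangle (∫ U, ∑ ι : κ ↪ Fin n, f (pr (θ U ∘ ι)) ∂μ)
    (∫ U, ∑ ι : κ ↪ Fin n, g (pr (θ U ∘ ι)) ∂μ) (∫ t, f t ∂(nu2 n κ))
  rw [hge] at this e1
  nlinarith [dist_nonneg (x := f) (y := g)]

end CUE

namespace CUE
variable {n : ℕ}
variable {κ : Type} [Fintype κ] [DecidableEq κ]

/-- complexification of a nonnegative function -/
noncomputable def cplx (f : BoundedContinuousFunction (UnitAddTorus κ) NNReal) :
    C(UnitAddTorus κ, ℂ) :=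
  ⟨fun x => (((f x : NNReal) : ℝ) : ℂ), by fun_prop⟩

lemma cplx_case {θ : UG n → Fin n → ℝ} (hθ : IsAng θ) (μ : Measure (UG n))
    [IsProbabilityMeasure μ] [μ.IsMulLeftInvariant]
    (f : BoundedContinuousFunction (UnitAddTorus κ) NNReal) :
    Measurable (fun U => ∑ ι : κ ↪ Fin n, (f (pr (θ U ∘ ι)) : ENNReal)) ∧
      ∫⁻ U, ∑ ι : κ ↪ Fin n, (f (pr (θ U ∘ ι)) : ENNReal) ∂μ = ∫⁻ t, f t ∂(nu2 n κ) := by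
  obtain ⟨h1, h2⟩ := cont_case hθ μ (cplx f)
  have e : ∀ U, ∑ ι : κ ↪ Fin n, cplx f (pr (θ U ∘ ι)) =
      ((∑ ι : κ ↪ Fin n, (f (pr (θ U ∘ ι)) : ℝ) : ℝ) : ℂ) := by
    intro U; simp [cplx]
  simp only [e] at h1 h2
  have h3 : Continuous (fun U => ∑ ι : κ ↪ Fin n, (f (pr (θ U ∘ ι)) : ℝ)) := by
    exact Complex.continuous_re.comp h1
  have e2 : ∀ U, ∑ ι : κ ↪ Fin n, (f (pr (θ U ∘ ι)) : ENNReal) =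
      ENNReal.ofReal (∑ ι : κ ↪ Fin n, (f (pr (θ U ∘ ι)) : ℝ)) := by
    intro U
    rw [ENNReal.ofReal_sum_of_nonneg (fun _ _ => NNReal.coe_nonneg _)]
    simp
  simp only [e2]
  refine ⟨h3.measurable.ennreal_ofReal, ?_⟩
  rw [← ofReal_integral_eq_lintegral_ofReal]
  · have h4 : ∫ t, cplx f t ∂(nu2 n κ) = ((∫ t, (f t : ℝ) ∂(nu2 n κ) : ℝ) : ℂ) := by
      rw [← integral_complex_ofReal]; rfl
    rw [h4, integral_complex_ofReal] at h2
    have h5 := Complex.ofReal_injective h2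
    rw [h5, lintegral_coe_eq_integral]
    have := (BoundedContinuousFunction.integrable_of_nnreal (nu2 n κ) f)
    exact this
  · have := cont_integrable μ h1
    simpa using this.re
  · exact Eventually.of_forall fun U => Finset.sum_nonneg fun _ _ => NNReal.coe_nonneg _

lemma lintegral_NN (t : Fin n → ℝ) (f : BoundedContinuousFunction (UnitAddTorus κ) NNReal) :
    ∫⁻ x, f x ∂(NN κ t) = ∑ ι : κ ↪ Fin n, (f (pr (t ∘ ι)) : ENNReal) := by
  rw [NN, lintegral_finsetSum_measure]
  refine Finset.sum_congr rfl fun ι _ => ?_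
  rw [lintegral_dirac' _ (by fun_prop)]

lemma measurable_NN {θ : UG n → Fin n → ℝ} (hθ : IsAng θ) (μ : Measure (UG n))
    [IsProbabilityMeasure μ] [μ.IsMulLeftInvariant] : Measurable fun U => NN κ (θ U) := by
  have hcl : ∀ F : Set (UnitAddTorus κ), IsClosed F → Measurable fun U => NN κ (θ U) F := by
    intro F hF
    refine measurable_of_tendsto_metrizable
      (f := fun m U => ∫⁻ x, hF.apprSeq m x ∂(NN κ (θ U))) (fun m => ?_) ?_
    · simp only [lintegral_NN]
      exact (cplx_case hθ μ _).1
    · rw [tendsto_pi_nhds]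
      intro U
      exact HasOuterApproxClosed.tendsto_lintegral_apprSeq hF _
  refine Measurable.measure_of_isPiSystem ?_ isPiSystem_isClosed hcl (hcl _ isClosed_univ)
  rw [BorelSpace.measurable_eq (α := UnitAddTorus κ), borel_eq_generateFrom_isClosed]

lemma bind_NN {θ : UG n → Fin n → ℝ} (hθ : IsAng θ) (μ : Measure (UG n))
    [IsProbabilityMeasure μ] [μ.IsMulLeftInvariant] :
    nu2 n κ = Measure.bind μ (fun U => NN κ (θ U)) := by
  refine ext_of_forall_lintegral_eq_of_IsFiniteMeasure fun f => ?_
  rw [Measure.lintegral_bind (measurable_NN hθ μ).aemeasurable (by fun_prop)]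
  simp only [lintegral_NN]
  exact (cplx_case hθ μ f).2.symm

lemma NN_sect (t : Fin n → ℝ) (ht : ∀ j, t j ∈ Set.Ico (0:ℝ) (2 * π)) {B : Set (κ → ℝ)}
    (hB : MeasurableSet B) : NN κ t (sect ⁻¹' B) = Nat.card {ι : κ ↪ Fin n // t ∘ ι ∈ B} := by
  classical
  rw [NN, Measure.finsetSum_apply]
  have : ∀ ι : κ ↪ Fin n, Measure.dirac (pr (t ∘ ι)) (sect ⁻¹' B) =
      if t ∘ ι ∈ B then 1 else 0 := by
    intro ι
    rw [Measure.dirac_apply' _ (measurable_sect hB), Set.indicator_apply]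
    simp only [Set.mem_preimage]
    rw [sect_pr (t ∘ ι) fun l => ht _]
    rfl
  simp only [this]
  rw [Finset.sum_boole, Nat.card_eq_fintype_card, Fintype.card_subtype]

/-- main correlation identity -/
theorem corr_identity {θ : UG n → Fin n → ℝ} (hθ : IsAng θ)
    (hθm : ∀ U j, θ U j ∈ Set.Ico (0:ℝ) (2 * π)) (μ : Measure (UG n))
    [IsProbabilityMeasure μ] [μ.IsMulLeftInvariant] {B : Set (κ → ℝ)} (hB : MeasurableSet B) :
    Measurable (fun U => (Nat.card {ι : κ ↪ Fin n // θ U ∘ ι ∈ B} : ENNReal)) ∧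
    ∫⁻ U, (Nat.card {ι : κ ↪ Fin n // θ U ∘ ι ∈ B} : ENNReal) ∂μ =
      ∫⁻ x in B, ENNReal.ofReal (corr n x) ∂(Measure.pi fun _ : κ => lam0) := by
  have hm := measurable_sect (κ := κ) hB
  simp only [← fun U => NN_sect (κ := κ) (θ U) (hθm U) hB]
  refine ⟨(Measure.measurable_coe hm).comp (measurable_NN hθ μ), ?_⟩
  rw [← Measure.bind_apply hm (measurable_NN hθ μ).aemeasurable, ← bind_NN hθ μ, nu2,
    Measure.map_apply continuous_pr.measurable hm, withDensity_apply _ (continuous_pr.measurable hm)]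
  refine setLIntegral_congr ?_
  have : ∀ᵐ x ∂(Measure.pi fun _ : κ => lam0), ∀ l, x l ∈ Set.Ico (0:ℝ) (2 * π) := by
    rw [ae_all_iff]
    intro l
    have h0 : ∀ᵐ y ∂lam0, y ∈ Set.Ico (0:ℝ) (2 * π) := by
      rw [lam0]
      exact Measure.ae_smul_measure (ae_restrict_mem measurableSet_Ico) _
    exact (Measure.tendsto_eval_ae_ae (μ := fun _ : κ => lam0) (i := l)).eventually h0
  filter_upwards [this] with x hx
  change (sect (pr x) ∈ B) = (x ∈ B)
  rw [sect_pr x hx]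

end CUE

namespace CUE
set_option linter.unusedSectionVars false
open Matrix
variable {n : ℕ}
variable {κ : Type} [Fintype κ] [DecidableEq κ]
variable {τ : Type} [Fintype τ] [DecidableEq τ]

open scoped ComplexOrder in
lemma exists_proj (F : Matrix κ (Fin n) ℂ) : ∃ (Q : Matrix (Fin n) (Fin n) ℂ)
    (S : Matrix (Fin n) κ ℂ), Qᴴ = Q ∧ Q * Q = Q ∧ Q = S * F ∧ F * Q = F ∧
      Q.trace.re ≤ Fintype.card κ := by
  have hA : (Fᴴ * F).IsHermitian := Matrix.isHermitian_conjTranspose_mul_self F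
  set c := Unitary.conjStarAlgAut ℂ (Matrix (Fin n) (Fin n) ℂ) hA.eigenvectorUnitary with hc
  set e : Fin n → ℂ := fun i => if hA.eigenvalues i = 0 then 0 else 1 with he
  set d : Fin n → ℂ := fun i => ((hA.eigenvalues i)⁻¹ : ℝ) with hd
  have hsp : Fᴴ * F = c (diagonal (RCLike.ofReal ∘ hA.eigenvalues)) := hA.spectral_theorem
  have h1 : (c (diagonal e))ᴴ = c (diagonal e) := by
    rw [← star_eq_conjTranspose, ← map_star, star_eq_conjTranspose, diagonal_conjTranspose]
    congr 2
    ext i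
    simp only [he, Pi.star_apply]
    split_ifs <;> simp
  have h2 : c (diagonal e) * c (diagonal e) = c (diagonal e) := by
    rw [← map_mul, diagonal_mul_diagonal]
    congr 2
    ext i
    simp only [he]
    split_ifs <;> simp
  have h3 : c (diagonal e) = (c (diagonal d) * Fᴴ) * F := by
    rw [Matrix.mul_assoc, hsp, ← map_mul, diagonal_mul_diagonal]
    congr 2
    ext i
    simp only [he, hd, Function.comp]
    split_ifs with h
    · simp [h]
    · rw [← Complex.ofReal_one, ← inv_mul_cancel₀ h]; push_cast; rfl
  have h4 : Fᴴ * F * c (diagonal e) = Fᴴ * F := by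
    rw [hsp, ← map_mul, diagonal_mul_diagonal]
    congr 2
    ext i
    simp only [he, Function.comp]
    split_ifs with h
    · simp [h]
    · simp
  refine ⟨c (diagonal e), c (diagonal d) * Fᴴ, h1, h2, h3, ?_, ?_⟩
  · have : (F - F * c (diagonal e)) = 0 := by
      rw [← conjTranspose_mul_self_eq_zero]
      rw [conjTranspose_sub, conjTranspose_mul, h1]
      have : Fᴴ * (F - F * c (diagonal e)) = 0 := by
        rw [Matrix.mul_sub, ← Matrix.mul_assoc, h4, sub_self]
      rw [Matrix.sub_mul, Matrix.mul_assoc, this]; simp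
    exact (sub_eq_zero.1 this).symm
  · have ht : (c (diagonal e)).trace = ∑ i, e i := by
      rw [hc, Unitary.conjStarAlgAut_apply, trace_mul_comm, ← Matrix.mul_assoc]
      simp
    have hr := hA.rank_eq_card_non_zero_eigs
    rw [rank_conjTranspose_mul_self] at hr
    have := rank_le_card_height F
    rw [hr, Fintype.card_subtype] at this
    rw [ht]
    have h5 : ∑ i, e i = (((Finset.univ.filter fun i => hA.eigenvalues i ≠ 0).card : ℝ) : ℂ) := by
      simp only [he]
      rw [Finset.card_filter]
      push_cast
      refine Finset.sum_congr rfl fun i _ => ?_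
      by_cases h : hA.eigenvalues i = 0 <;> simp [h]
    rw [h5, Complex.ofReal_re]
    exact_mod_cast this

lemma schur (F : Matrix κ (Fin n) ℂ) (Gm : Matrix τ (Fin n) ℂ) (Q : Matrix (Fin n) (Fin n) ℂ)
    (S : Matrix (Fin n) κ ℂ) (h1 : Qᴴ = Q) (h2 : Q * Q = Q) (h3 : Q = S * F) (h4 : F * Q = F) :
    ((fromRows F Gm) * (fromRows F Gm)ᴴ).det = (F * Fᴴ).det * (Gm * (1 - Q) * Gmᴴ).det := by
  set Lm : Matrix (κ ⊕ τ) (κ ⊕ τ) ℂ := fromBlocks 1 0 (-(Gm * S)) 1 with hL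
  have hdet : Lm.det = 1 := by rw [hL, det_fromBlocks_zero₁₂]; simp
  have hLm : Lm * fromRows F Gm = fromRows F (Gm * (1 - Q)) := by
    rw [hL, fromBlocks_mul_fromRows]
    congr 1
    · simp
    · rw [Matrix.mul_sub, Matrix.neg_mul, Matrix.mul_assoc, ← h3]; simp; abel
  have hF : F * (1 - Q) = 0 := by rw [Matrix.mul_sub, h4]; simp
  have hQ1 : (1 - Q)ᴴ = 1 - Q := by rw [conjTranspose_sub, h1]; simp
  have hQ2 : (1 - Q) * (1 - Q) = 1 - Q := by
    simp [Matrix.mul_sub, Matrix.sub_mul, h2]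
  have hF2 : (1 - Q) * Fᴴ = 0 := by
    rw [← hQ1, ← conjTranspose_mul, hF]; simp
  have := congrArg Matrix.det (show (Lm * fromRows F Gm) * (Lm * fromRows F Gm)ᴴ =
    Lm * ((fromRows F Gm) * (fromRows F Gm)ᴴ) * Lmᴴ by
      rw [conjTranspose_mul]; simp only [Matrix.mul_assoc])
  rw [det_mul, det_mul, det_conjTranspose, hdet] at this
  simp only [one_mul, star_one, mul_one] at this
  rw [← this, hLm, conjTranspose_fromRows_eq_fromCols_conjTranspose, fromRows_mul_fromCols,
    conjTranspose_mul, hQ1, ← Matrix.mul_assoc F, hF, Matrix.mul_assoc Gm _ Fᴴ, hF2]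
  simp only [Matrix.zero_mul, Matrix.mul_zero]
  rw [det_fromBlocks_zero₁₂, Matrix.mul_assoc Gm, ← Matrix.mul_assoc (1 - Q) (1 - Q), hQ2,
    Matrix.mul_assoc]

lemma PhiM_sum (x : κ → ℝ) (w : τ → ℝ) :
    PhiM n (Sum.elim x w) = fromRows (PhiM n x) (PhiM n w) := by
  ext i k
  cases i <;> simp [PhiM]

/-- hermitian squared length after applying a matrix -/
noncomputable def hq (Q : Matrix (Fin n) (Fin n) ℂ) (u : Fin n → ℂ) : ℝ :=
  ∑ k, ‖(u ᵥ* Q) k‖ ^ 2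

/-- squared length -/
noncomputable def nsq (u : Fin n → ℂ) : ℝ := ∑ k, ‖u k‖ ^ 2

/-- feature vector -/
noncomputable def ph (n : ℕ) (s : ℝ) : Fin n → ℂ :=
  fun k => Complex.exp (((k : ℕ) : ℂ) * s * Complex.I)

lemma hq_nonneg (Q : Matrix (Fin n) (Fin n) ℂ) (u : Fin n → ℂ) : 0 ≤ hq Q u :=
  Finset.sum_nonneg fun _ _ => by positivity

lemma nsq_nonneg (u : Fin n → ℂ) : 0 ≤ nsq u :=
  Finset.sum_nonneg fun _ _ => by positivity

lemma sum_norm_sq (v : Fin n → ℂ) : ((∑ k, ‖v k‖ ^ 2 : ℝ) : ℂ) = v ⬝ᵥ star v := by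
  simp only [dotProduct, Pi.star_apply, Complex.star_def, Complex.mul_conj, Complex.normSq_eq_norm_sq]
  push_cast; rfl

lemma hq_eq {Q : Matrix (Fin n) (Fin n) ℂ} (h1 : Qᴴ = Q) (h2 : Q * Q = Q) (u : Fin n → ℂ) :
    ((hq Q u : ℝ) : ℂ) = u ⬝ᵥ (Q *ᵥ star u) := by
  rw [hq, sum_norm_sq, star_vecMul, h1, ← dotProduct_mulVec, mulVec_mulVec, h2]

lemma nsq_eq (u : Fin n → ℂ) : ((nsq u : ℝ) : ℂ) = u ⬝ᵥ star u := sum_norm_sq u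

lemma hq_compl {Q : Matrix (Fin n) (Fin n) ℂ} (h1 : Qᴴ = Q) (h2 : Q * Q = Q) (u : Fin n → ℂ) :
    hq (1 - Q) u = nsq u - hq Q u := by
  have h1' : (1 - Q)ᴴ = 1 - Q := by rw [conjTranspose_sub, h1]; simp
  have h2' : (1 - Q) * (1 - Q) = 1 - Q := by
    simp [Matrix.mul_sub, Matrix.sub_mul, h2]
  apply Complex.ofReal_injective
  push_cast
  rw [hq_eq h1' h2', hq_eq h1 h2, nsq_eq, sub_mulVec, one_mulVec, dotProduct_sub]

end CUE

namespace CUE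
set_option linter.unusedSectionVars false
open Matrix
variable {n : ℕ}
variable {κ : Type} [Fintype κ] [DecidableEq κ]
variable {τ : Type} [Fintype τ] [DecidableEq τ]

/-- hermitian product -/
noncomputable def inn (u v : Fin n → ℂ) : ℂ := u ⬝ᵥ star v

lemma inn_self (u : Fin n → ℂ) : inn u u = ((nsq u : ℝ) : ℂ) := (nsq_eq u).symm

lemma inn_add_left (u v w : Fin n → ℂ) : inn (u + v) w = inn u w + inn v w := add_dotProduct _ _ _
lemma inn_add_right (u v w : Fin n → ℂ) : inn w (u + v) = inn w u + inn w v := by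
  simp [inn, dotProduct_add]

lemma inn_conj (u v : Fin n → ℂ) : inn v u = star (inn u v) := by
  simp only [inn, dotProduct, star_sum, star_mul', Pi.star_apply, star_star]
  exact Finset.sum_congr rfl fun k _ => mul_comm _ _

lemma inn_mul_conj (u v : Fin n → ℂ) : inn u v * inn v u = ((‖inn u v‖ ^ 2 : ℝ) : ℂ) := by
  rw [inn_conj u v, Complex.star_def, Complex.mul_conj, Complex.normSq_eq_norm_sq]

/-- two by two gram determinant -/
noncomputable def dd (u v : Fin n → ℂ) : ℝ := nsq u * nsq v - ‖inn u v‖ ^ 2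

lemma dd_eq (u v : Fin n → ℂ) : ((dd u v : ℝ) : ℂ) = inn u u * inn v v - inn u v * inn v u := by
  rw [inn_mul_conj, inn_self, inn_self, dd]; push_cast; rfl

lemma dd_shift (u v : Fin n → ℂ) : dd u (v + u) = dd u v := by
  apply Complex.ofReal_injective
  rw [dd_eq, dd_eq]
  simp only [inn_add_left, inn_add_right]
  ring

lemma det_gram (Y : Matrix (Fin 2) (Fin n) ℂ) : (Y * Yᴴ).det = ((dd (Y 0) (Y 1) : ℝ) : ℂ) := by
  rw [dd_eq, det_fin_two]
  rfl

open scoped ComplexOrder in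
lemma dd_nonneg (u v : Fin n → ℂ) : 0 ≤ dd u v := by
  have h := (Matrix.posSemidef_self_mul_conjTranspose (Matrix.of ![u, v])).det_nonneg
  rw [det_gram] at h
  exact_mod_cast h

lemma twobytwo {A0 A1 H0 H1 : ℝ} (a h : ℂ) (hA0 : 0 ≤ A0) (hA1 : 0 ≤ A1) (hH0 : 0 ≤ H0)
    (hH1 : 0 ≤ H1) (ha : 0 ≤ A0 * A1 - ‖a‖ ^ 2) (hh : 0 ≤ H0 * H1 - ‖h‖ ^ 2) :
    |(A0 * A1 - ‖a‖ ^ 2) - ((A0 + H0) * (A1 + H1) - ‖a + h‖ ^ 2)| ≤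
      2 * ((A0 + H0) * H1 + (A1 + H1) * H0) := by
  have e : ‖a + h‖ ^ 2 = ‖a‖ ^ 2 + 2 * (a.re * h.re + a.im * h.im) + ‖h‖ ^ 2 := by
    simp only [← Complex.normSq_eq_norm_sq, Complex.normSq_apply, Complex.add_re, Complex.add_im]
    ring
  have na : ‖a‖ ^ 2 = a.re ^ 2 + a.im ^ 2 := by
    rw [← Complex.normSq_eq_norm_sq, Complex.normSq_apply]; ring
  have nh : ‖h‖ ^ 2 = h.re ^ 2 + h.im ^ 2 := by
    rw [← Complex.normSq_eq_norm_sq, Complex.normSq_apply]; ring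
  have key : |2 * (a.re * h.re + a.im * h.im)| ≤ A0 * H1 + A1 * H0 := by
    apply abs_le_of_sq_le_sq _ (by positivity)
    have c1 : (a.re * h.re + a.im * h.im) ^ 2 ≤ ‖a‖ ^ 2 * ‖h‖ ^ 2 := by
      rw [na, nh]; nlinarith [sq_nonneg (a.re * h.im - a.im * h.re)]
    have c2 : ‖a‖ ^ 2 * ‖h‖ ^ 2 ≤ (A0 * A1) * (H0 * H1) :=
      mul_le_mul (by linarith) (by linarith) (by positivity) (by positivity)
    nlinarith [sq_nonneg (A0 * H1 - A1 * H0)]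
  have k1 := abs_le.1 key
  have p1 := mul_nonneg hA0 hH1
  have p2 := mul_nonneg hA1 hH0
  have p3 := mul_nonneg hH0 hH1
  have p4 := sq_nonneg ‖h‖
  rw [e, abs_le]
  constructor <;> nlinarith

lemma corr_two (w : Fin 2 → ℝ) : corr n w = dd (ph n (w 0)) (ph n (w 1) - ph n (w 0)) := by
  rw [corr, Rm, det_gram, Complex.ofReal_re, ← dd_shift (ph n (w 0)) (ph n (w 1) - _)]
  rw [sub_add_cancel]; rfl

lemma ph_norm (s : ℝ) (k : Fin n) : ‖ph n s k‖ = 1 := by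
  rw [ph, ← Complex.norm_exp_ofReal_mul_I (((k : ℕ) : ℝ) * s)]
  push_cast; rfl

lemma nsq_ph (s : ℝ) : nsq (ph n s) = n := by
  simp [nsq, ph_norm]

lemma compl_props {Q : Matrix (Fin n) (Fin n) ℂ} (h1 : Qᴴ = Q) (h2 : Q * Q = Q) :
    (1 - Q)ᴴ = 1 - Q ∧ (1 - Q) * (1 - Q) = 1 - Q := by
  constructor
  · rw [conjTranspose_sub, h1]; simp
  · simp [Matrix.mul_sub, Matrix.sub_mul, h2]

lemma corr_sum (x : κ → ℝ) : ∃ Q : Matrix (Fin n) (Fin n) ℂ, Qᴴ = Q ∧ Q * Q = Q ∧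
    Q.trace.re ≤ Fintype.card κ ∧ (∀ u, ph n (x u) ᵥ* Q = ph n (x u)) ∧
    ∀ (τ : Type) [Fintype τ] [DecidableEq τ] (w : τ → ℝ),
      (Rm n (Sum.elim x w)).det = (corr n x : ℂ) *
        ((PhiM n w * (1 - Q)) * (PhiM n w * (1 - Q))ᴴ).det := by
  obtain ⟨Q, S, h1, h2, h3, h4, h5⟩ := exists_proj (PhiM n x)
  refine ⟨Q, h1, h2, h5, fun u => ?_, fun τ _ _ w => ?_⟩
  · ext k
    exact congrFun (congrFun h4 u) k
  · obtain ⟨c1, c2⟩ := compl_props h1 h2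
    rw [Rm, PhiM_sum, schur _ _ Q S h1 h2 h3 h4, ← det_Rm, conjTranspose_mul, c1,
      Matrix.mul_assoc (PhiM n w) (1 - Q) ((1 - Q) * _), ← Matrix.mul_assoc (1 - Q) (1 - Q), c2,
      ← Matrix.mul_assoc]
    rfl

lemma inn_split {Q : Matrix (Fin n) (Fin n) ℂ} (h1 : Qᴴ = Q) (h2 : Q * Q = Q) (u v : Fin n → ℂ) :
    inn u v = inn (u ᵥ* (1 - Q)) (v ᵥ* (1 - Q)) + inn (u ᵥ* Q) (v ᵥ* Q) := by
  obtain ⟨c1, c2⟩ := compl_props h1 h2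
  simp only [inn, star_vecMul, c1, h1]
  rw [← dotProduct_mulVec, ← dotProduct_mulVec, mulVec_mulVec, mulVec_mulVec, c2, h2,
    ← dotProduct_add, ← add_mulVec]
  simp

lemma pair_step (x : κ → ℝ) : ∃ Q : Matrix (Fin n) (Fin n) ℂ, Qᴴ = Q ∧ Q * Q = Q ∧
    Q.trace.re ≤ Fintype.card κ ∧
    ∀ w : Fin 2 → ℝ, |corr n (Sum.elim x w) - corr n x * corr n w| ≤ corr n x *
      (2 * (n * hq Q (ph n (w 1) - ph n (w 0)) +
        nsq (ph n (w 1) - ph n (w 0)) * hq Q (ph n (w 0)))) ∧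
      corr n (Sum.elim x w) ≤ corr n x * (n * nsq (ph n (w 1) - ph n (w 0))) := by
  obtain ⟨Q, h1, h2, h3, -, h4⟩ := corr_sum (n := n) x
  refine ⟨Q, h1, h2, h3, fun w => ?_⟩
  set u := ph n (w 0) with hu
  set v := ph n (w 1) - u with hv
  have e1 : corr n (Sum.elim x w) = corr n x * dd (u ᵥ* (1 - Q)) (v ᵥ* (1 - Q)) := by
    rw [corr, h4 (Fin 2) w, det_gram, ← Complex.ofReal_mul, Complex.ofReal_re]
    congr 1
    rw [← dd_shift (u ᵥ* (1 - Q)) (v ᵥ* (1 - Q)), ← add_vecMul, hv, sub_add_cancel]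
    rfl
  have hn : nsq u = n := nsq_ph _
  have nu : nsq u = nsq (u ᵥ* (1 - Q)) + nsq (u ᵥ* Q) := by
    have := hq_compl h1 h2 u
    change nsq (u ᵥ* (1 - Q)) = _ - nsq (u ᵥ* Q) at this
    linarith
  have nv : nsq v = nsq (v ᵥ* (1 - Q)) + nsq (v ᵥ* Q) := by
    have := hq_compl h1 h2 v
    change nsq (v ᵥ* (1 - Q)) = _ - nsq (v ᵥ* Q) at this
    linarith
  have c0 := corr_nonneg (n := n) x
  rw [corr_two, e1, ← hu, ← hv]
  constructor
  · rw [← mul_sub, abs_mul, abs_of_nonneg c0]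
    refine mul_le_mul_of_nonneg_left ?_ c0
    have := twobytwo (inn (u ᵥ* (1 - Q)) (v ᵥ* (1 - Q))) (inn (u ᵥ* Q) (v ᵥ* Q))
      (nsq_nonneg (u ᵥ* (1 - Q))) (nsq_nonneg (v ᵥ* (1 - Q))) (nsq_nonneg (u ᵥ* Q))
      (nsq_nonneg (v ᵥ* Q)) (dd_nonneg _ _) (dd_nonneg _ _)
    rw [← nu, ← nv, ← inn_split h1 h2, hn] at this
    rw [dd, dd, hn]
    exact this
  · refine mul_le_mul_of_nonneg_left ?_ c0
    have a1 : nsq (u ᵥ* (1 - Q)) ≤ n := by rw [← hn, nu]; linarith [nsq_nonneg (u ᵥ* Q)]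
    have a2 : nsq (v ᵥ* (1 - Q)) ≤ nsq v := by rw [nv]; linarith [nsq_nonneg (v ᵥ* Q)]
    have := mul_le_mul a1 a2 (nsq_nonneg _) (by positivity)
    rw [dd]
    nlinarith [sq_nonneg ‖inn (u ᵥ* (1 - Q)) (v ᵥ* (1 - Q))‖]

lemma pend_step (x : κ → ℝ) (u : κ) (w : Unit → ℝ) :
    corr n (Sum.elim x w) ≤ corr n x * nsq (ph n (w ()) - ph n (x u)) := by
  obtain ⟨Q, h1, h2, h3, hu, h4⟩ := corr_sum (n := n) x
  have e1 : corr n (Sum.elim x w) = corr n x * nsq (ph n (w ()) ᵥ* (1 - Q)) := by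
    rw [corr, h4 Unit w, det_unique]
    have : ((PhiM n w * (1 - Q) * (PhiM n w * (1 - Q))ᴴ : Matrix Unit Unit ℂ)) default default =
        inn (ph n (w ()) ᵥ* (1 - Q)) (ph n (w ()) ᵥ* (1 - Q)) := rfl
    rw [this, inn_self, ← Complex.ofReal_mul, Complex.ofReal_re]
  rw [e1]
  refine mul_le_mul_of_nonneg_left ?_ (corr_nonneg _)
  set v := ph n (w ()) - ph n (x u) with hv
  have : ph n (w ()) ᵥ* (1 - Q) = v ᵥ* (1 - Q) := by
    rw [hv, sub_vecMul]
    have : ph n (x u) ᵥ* (1 - Q) = 0 := by rw [vecMul_sub, hu]; simp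
    rw [this, sub_zero]
  rw [this]
  have := hq_compl h1 h2 v
  change nsq (v ᵥ* (1 - Q)) = _ at this
  linarith [hq_nonneg Q v]

lemma norm_exp_sub_one_le (y : ℝ) : ‖Complex.exp (y * Complex.I) - 1‖ ^ 2 ≤ y ^ 2 := by
  have := Real.norm_exp_I_mul_ofReal_sub_one_le (x := y)
  rw [mul_comm] at this
  have h := pow_le_pow_left₀ (norm_nonneg _) this 2
  simpa using h

lemma ph_sub (s t : ℝ) (k : Fin n) : (ph n t - ph n s) k =
    ph n s k * (Complex.exp ((((k : ℕ) : ℝ) * (t - s) : ℝ) * Complex.I) - 1) := by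
  simp only [ph, Pi.sub_apply, mul_sub, mul_one, ← Complex.exp_add]
  congr 2
  push_cast; ring

lemma nsq_le (s t : ℝ) : nsq (ph n t - ph n s) ≤ n * min 4 ((n * (t - s)) ^ 2) := by
  rw [nsq]
  refine (Finset.sum_le_card_nsmul _ _ (min 4 ((n * (t - s)) ^ 2)) fun k _ => ?_).trans ?_
  · rw [ph_sub, norm_mul, ph_norm, one_mul]
    refine le_min ?_ ((norm_exp_sub_one_le _).trans ?_)
    · have : ‖Complex.exp ((((k : ℕ) : ℝ) * (t - s) : ℝ) * Complex.I) - 1‖ ≤ 2 := by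
        refine (norm_sub_le _ _).trans ?_
        rw [Complex.norm_exp_ofReal_mul_I]; norm_num
      nlinarith [norm_nonneg (Complex.exp ((((k : ℕ) : ℝ) * (t - s) : ℝ) * Complex.I) - 1)]
    · rw [mul_pow, mul_pow]
      have hk : ((k : ℕ) : ℝ) ≤ n := by exact_mod_cast k.2.le
      gcongr
  · simp

end CUE

namespace CUE
set_option linter.unusedSectionVars false
variable {n : ℕ}
variable {κ : Type} [Fintype κ] [DecidableEq κ]
variable {τ : Type} [Fintype τ] [DecidableEq τ]

/-- product measure -/
noncomputable def pim (κ : Type) [Fintype κ] : Measure (κ → ℝ) := Measure.pi fun _ : κ => lam0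

instance : IsProbabilityMeasure (pim κ) := by unfold pim; infer_instance

lemma bdd_integrable {α : Type*} [MeasurableSpace α] {m : Measure α} [IsFiniteMeasure m]
    {f : α → ℝ} (hf : Measurable f) (M : ℝ) (hM : ∀ x, |f x| ≤ M) : Integrable f m :=
  Integrable.of_bound (C := M) hf.aestronglyMeasurable (Eventually.of_forall hM)

lemma measurable_elim : Measurable fun p : (κ → ℝ) × (τ → ℝ) => Sum.elim p.1 p.2 := by
  refine measurable_pi_lambda _ fun i => ?_
  cases i with
  | inl i => exact (measurable_pi_apply i).comp measurable_fst
  | inr i => exact (measurable_pi_apply i).comp measurable_snd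

lemma fub {F : (κ ⊕ τ → ℝ) → ℝ} (hF : Measurable F) (M : ℝ) (hM : ∀ x, |F x| ≤ M) :
    ∫ z, F z ∂(pim (κ ⊕ τ)) = ∫ x, ∫ w, F (Sum.elim x w) ∂(pim τ) ∂(pim κ) := by
  have h := measurePreserving_sumPiEquivProdPi_symm (ι := κ) (ι' := τ) (X := fun _ => ℝ)
    (fun _ => lam0)
  have := h.integral_comp (MeasurableEquiv.measurableEmbedding _) F
  rw [pim, ← this]
  have e : ∀ p : (κ → ℝ) × (τ → ℝ), (MeasurableEquiv.sumPiEquivProdPi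
      (fun _ : κ ⊕ τ => ℝ)).symm p = Sum.elim p.1 p.2 := by
    intro p
    ext i
    cases i <;> rfl
  simp only [e]
  rw [← pim, ← pim, integral_prod]
  exact bdd_integrable (hF.comp measurable_elim) M fun _ => hM _

lemma fub_le {F : (κ ⊕ τ → ℝ) → ℝ} (hF : Measurable F) (M : ℝ) (hM : ∀ x, |F x| ≤ M)
    {g : (κ → ℝ) → ℝ} (hg : Integrable g (pim κ))
    (h : ∀ x, |∫ w, F (Sum.elim x w) ∂(pim τ)| ≤ g x) :
    |∫ z, F z ∂(pim (κ ⊕ τ))| ≤ ∫ x, g x ∂(pim κ) := by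
  rw [fub hF M hM]
  rw [← Real.norm_eq_abs]
  refine norm_integral_le_of_norm_le (f := fun x => ∫ w, F (Sum.elim x w) ∂(pim τ)) hg
    (Eventually.of_forall fun x => ?_)
  rw [Real.norm_eq_abs]
  exact h x

lemma int_two {f : ℝ → ℝ → ℝ} (hf : Measurable (Function.uncurry f)) (M : ℝ)
    (hM : ∀ s t, |f s t| ≤ M) :
    ∫ w, f (w 0) (w 1) ∂(pim (Fin 2)) = ∫ s, ∫ t, f s t ∂lam0 ∂lam0 := by
  have h := (measurePreserving_finTwoArrow lam0).integral_comp
    (MeasurableEquiv.measurableEmbedding _) (Function.uncurry f)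
  rw [pim]
  refine Eq.trans ?_ (h.trans ?_)
  · rfl
  · rw [integral_prod]
    · rfl
    · exact bdd_integrable hf M fun _ => hM _ _

lemma int_lam0 (f : ℝ → ℝ) :
    ∫ t, f t ∂lam0 = (2 * π)⁻¹ * ∫ t, (Set.Ico 0 (2 * π)).indicator f t := by
  rw [lam0, integral_smul_measure, integral_indicator measurableSet_Ico, smul_eq_mul,
    ENNReal.toReal_ofReal (by positivity)]

/-- shear -/
noncomputable def shf (f : ℝ → ℝ → ℝ) (h s : ℝ) : ℝ :=
  (Set.Ico 0 (2 * π)).indicator (f s) (s + h)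

lemma meas_shf {f : ℝ → ℝ → ℝ} (hf : Measurable (Function.uncurry f)) :
    Measurable (Function.uncurry (shf f)) := by
  have : Function.uncurry (shf f) = {p : ℝ × ℝ | p.2 + p.1 ∈ Set.Ico 0 (2 * π)}.indicator
      (fun p => Function.uncurry f (p.2, p.2 + p.1)) := by
    ext ⟨h, s⟩
    simp only [Function.uncurry, shf, Set.indicator, Set.mem_ofPred_eq]
    congr 1
  rw [this]
  refine (hf.comp (by fun_prop)).indicator ?_
  exact measurableSet_Ico.preimage (by fun_prop)

lemma shf_bdd {f : ℝ → ℝ → ℝ} (M : ℝ) (hM : ∀ s t, |f s t| ≤ M) (h s : ℝ) : |shf f h s| ≤ M := by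
  rw [shf, Set.indicator_apply]
  split_ifs
  · exact hM _ _
  · simpa using (abs_nonneg _).trans (hM 0 0)

lemma shear {f : ℝ → ℝ → ℝ} (hf : Measurable (Function.uncurry f)) (M : ℝ)
    (hM : ∀ s t, |f s t| ≤ M) {γ : ℝ} (hγ : ∀ s t, γ ≤ |s - t| → f s t = 0) :
    ∫ s, ∫ t, f s t ∂lam0 ∂lam0 =
      (2 * π)⁻¹ * ∫ h in Set.Ioo (-γ) γ, ∫ s, shf f h s ∂lam0 := by
  have h1 : ∀ s, ∫ t, f s t ∂lam0 = (2 * π)⁻¹ * ∫ h in Set.Ioo (-γ) γ, shf f h s := by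
    intro s
    rw [int_lam0, ← integral_add_left_eq_self _ s, ← integral_indicator measurableSet_Ioo]
    congr 2
    ext h
    rw [Set.indicator_apply (s := Set.Ioo (-γ) γ)]
    split_ifs with hh
    · rfl
    · rw [Set.indicator_apply]
      split_ifs with h3
      · apply hγ
        rw [Set.mem_Ioo, ← abs_lt, not_lt] at hh
        rw [sub_add_cancel_left, abs_neg]; exact hh
      · rfl
  simp only [h1]
  rw [integral_const_mul]
  congr 1
  rw [integral_integral_swap]
  have := (meas_shf hf).comp measurable_swap
  exact bdd_integrable this M fun p => shf_bdd M hM _ _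

lemma inner_integrable {f : ℝ → ℝ → ℝ} (hf : Measurable (Function.uncurry f)) (M : ℝ)
    (hM : ∀ s t, |f s t| ≤ M) (γ : ℝ) :
    Integrable (fun h => ∫ s, shf f h s ∂lam0) (volume.restrict (Set.Ioo (-γ) γ)) := by
  have : Integrable (Function.uncurry (shf f)) ((volume.restrict (Set.Ioo (-γ) γ)).prod lam0) :=
    bdd_integrable (meas_shf hf) M fun p => shf_bdd M hM _ _
  exact this.integral_prod_left

lemma shear_le {f : ℝ → ℝ → ℝ} (hf : Measurable (Function.uncurry f)) (M : ℝ)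
    (hM : ∀ s t, |f s t| ≤ M) {γ : ℝ} (hγ0 : 0 ≤ γ) (hγ : ∀ s t, γ ≤ |s - t| → f s t = 0) {K : ℝ}
    (hK : ∀ h, |h| < γ → ∫ s, shf f h s ∂lam0 ≤ K) :
    ∫ s, ∫ t, f s t ∂lam0 ∂lam0 ≤ K * γ / π := by
  rw [shear hf M hM hγ]
  have : ∫ h in Set.Ioo (-γ) γ, ∫ s, shf f h s ∂lam0 ≤ ∫ h in Set.Ioo (-γ) γ, K := by
    refine setIntegral_mono_on (inner_integrable hf M hM γ) (integrable_const _)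
      measurableSet_Ioo fun h hh => hK h (abs_lt.2 hh)
  rw [setIntegral_const, Real.volume_real_Ioo_of_le (by linarith), smul_eq_mul] at this
  have hp := Real.pi_pos
  calc _ ≤ (2 * π)⁻¹ * ((γ - -γ) * K) := mul_le_mul_of_nonneg_left this (by positivity)
    _ = _ := by field_simp; ring

end CUE

namespace CUE
set_option linter.unusedSectionVars false
open Matrix
variable {n : ℕ}
variable {κ : Type} [Fintype κ] [DecidableEq κ]

lemma parseval (c : Fin n → ℂ) :
    ∫ s, ‖∑ k, ph n s k * c k‖ ^ 2 ∂lam0 = ∑ k, ‖c k‖ ^ 2 := by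
  apply Complex.ofReal_injective
  rw [← integral_complex_ofReal]
  have e : ∀ s : ℝ, ((‖∑ k, ph n s k * c k‖ ^ 2 : ℝ) : ℂ) =
      ∑ k, ∑ l, c k * star (c l) *
        Complex.exp (((((k : ℕ) : ℤ) - ((l : ℕ) : ℤ) : ℤ) : ℂ) * s * Complex.I) := by
    intro s
    rw [← Complex.normSq_eq_norm_sq, ← Complex.mul_conj, map_sum, Finset.sum_mul_sum]
    refine Finset.sum_congr rfl fun k _ => Finset.sum_congr rfl fun l _ => ?_
    rw [map_mul]
    have : Complex.exp (((((k : ℕ) : ℤ) - ((l : ℕ) : ℤ) : ℤ) : ℂ) * s * Complex.I) =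
      ph n s k * (starRingEnd ℂ) (ph n s l) := by
      rw [ph, ph, ← Complex.exp_conj, ← Complex.exp_add]
      congr 1
      simp
      ring
    rw [this, Complex.star_def]
    ring
  simp only [e]
  have hintg : ∀ k l : Fin n, Integrable (fun s : ℝ => c k * star (c l) *
        Complex.exp (((((k : ℕ) : ℤ) - ((l : ℕ) : ℤ) : ℤ) : ℂ) * s * Complex.I)) lam0 := by
    intro k l
    refine Integrable.of_bound (C := ‖c k * star (c l)‖)
      (by apply Continuous.aestronglyMeasurable; fun_prop) (Eventually.of_forall fun s => ?_)
    rw [norm_mul]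
    have : (((((k : ℕ) : ℤ) - ((l : ℕ) : ℤ) : ℤ) : ℂ) * s * Complex.I) =
      (((((k : ℕ) : ℤ) - ((l : ℕ) : ℤ) : ℤ) * s : ℝ) : ℂ) * Complex.I := by push_cast; ring
    rw [this, Complex.norm_exp_ofReal_mul_I, mul_one]
  rw [integral_finsetSum _ fun k _ => integrable_finsetSum _ fun l _ => hintg k l]
  rw [Complex.ofReal_sum]
  refine Finset.sum_congr rfl fun k _ => ?_
  rw [integral_finsetSum _ fun l _ => hintg k l]
  simp only [integral_const_mul, integral_exp_lam0]
  rw [Finset.sum_eq_single k]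
  · simp [Complex.mul_conj, Complex.normSq_eq_norm_sq]
  · intro l _ hl
    rw [if_neg, mul_zero]
    intro h
    apply hl
    apply Fin.ext
    omega
  · simp

lemma continuous_ph (k : Fin n) : Continuous fun s => ph n s k := by
  unfold ph
  fun_prop

lemma hq_parseval {Q : Matrix (Fin n) (Fin n) ℂ} (h1 : Qᴴ = Q) (h2 : Q * Q = Q)
    {K : ℝ} (h3 : Q.trace.re ≤ K) (c : Fin n → ℂ) {M : ℝ} (hM0 : 0 ≤ M) (hM : ∀ k, ‖c k‖ ^ 2 ≤ M) :
    ∫ s, hq Q (fun k => ph n s k * c k) ∂lam0 ≤ M * K := by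
  have e : ∀ s, hq Q (fun k => ph n s k * c k) = ∑ k, ‖∑ j, ph n s j * (c j * Q j k)‖ ^ 2 := by
    intro s
    simp only [hq, vecMul, dotProduct, mul_assoc]
  simp only [e]
  rw [integral_finsetSum]
  · simp only [parseval]
    have tr : Q.trace.re = ∑ k, ∑ j, ‖Q j k‖ ^ 2 := by
      have : Q.trace = ((∑ k, ∑ j, ‖Q j k‖ ^ 2 : ℝ) : ℂ) := by
        conv_lhs => rw [← h2]
        nth_rw 1 [← h1]
        simp only [trace, diag, mul_apply, conjTranspose_apply]
        push_cast
        refine Finset.sum_congr rfl fun k _ => Finset.sum_congr rfl fun j _ => ?_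
        rw [mul_comm, Complex.star_def, Complex.mul_conj, Complex.normSq_eq_norm_sq]
        push_cast; rfl
      rw [this, Complex.ofReal_re]
    refine le_trans ?_ (mul_le_mul_of_nonneg_left h3 hM0)
    rw [tr, Finset.mul_sum]
    refine Finset.sum_le_sum fun k _ => ?_
    rw [Finset.mul_sum]
    refine Finset.sum_le_sum fun j _ => ?_
    rw [norm_mul, mul_pow]
    exact mul_le_mul_of_nonneg_right (hM j) (by positivity)
  · intro k _
    refine bdd_integrable (M := (∑ j, ‖c j * Q j k‖) ^ 2) ?_ fun s => ?_
    · have := fun j : Fin n => continuous_ph (n := n) j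
      apply Continuous.measurable
      fun_prop
    · rw [abs_of_nonneg (by positivity)]
      gcongr
      refine (norm_sum_le _ _).trans (Finset.sum_le_sum fun j _ => ?_)
      rw [norm_mul, ph_norm, one_mul]

lemma hq_le {Q : Matrix (Fin n) (Fin n) ℂ} (h1 : Qᴴ = Q) (h2 : Q * Q = Q) (u : Fin n → ℂ) :
    hq Q u ≤ nsq u := by
  have := hq_compl h1 h2 u
  linarith [hq_nonneg (1 - Q) u]

lemma nsq_le4 (s t : ℝ) : nsq (ph n t - ph n s) ≤ 4 * n :=
  (nsq_le s t).trans (by rw [mul_comm]; gcongr; exact min_le_left _ _)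

lemma continuous_hq (Q : Matrix (Fin n) (Fin n) ℂ) : Continuous (hq Q) := by
  unfold hq vecMul dotProduct
  fun_prop

lemma continuous_nsq : Continuous (nsq : (Fin n → ℂ) → ℝ) := by
  unfold nsq
  fun_prop

lemma continuous_ph' : Continuous (ph n) := continuous_pi continuous_ph

/-- error integrand -/
noncomputable def errf (Q : Matrix (Fin n) (Fin n) ℂ) (s t : ℝ) : ℝ :=
  2 * (n * hq Q (ph n t - ph n s) + nsq (ph n t - ph n s) * hq Q (ph n s))

lemma errf_nonneg (Q : Matrix (Fin n) (Fin n) ℂ) (s t : ℝ) : 0 ≤ errf Q s t := by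
  unfold errf
  have := hq_nonneg Q (ph n t - ph n s)
  have := hq_nonneg Q (ph n s)
  have := nsq_nonneg (ph n t - ph n s)
  positivity

lemma errf_le {Q : Matrix (Fin n) (Fin n) ℂ} (h1 : Qᴴ = Q) (h2 : Q * Q = Q) (s t : ℝ) :
    errf Q s t ≤ 16 * n ^ 2 := by
  unfold errf
  have a1 := (hq_le h1 h2 (ph n t - ph n s)).trans (nsq_le4 s t)
  have a2 := hq_le h1 h2 (ph n s)
  rw [nsq_ph] at a2
  have a3 := mul_le_mul (nsq_le4 (n := n) s t) a2 (hq_nonneg _ _) (by positivity)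
  have a4 := mul_le_mul_of_nonneg_left a1 (Nat.cast_nonneg (α := ℝ) n)
  nlinarith

lemma continuous_errf (Q : Matrix (Fin n) (Fin n) ℂ) : Continuous (Function.uncurry (errf Q)) := by
  have h1 := continuous_hq Q
  have h2 := continuous_nsq (n := n)
  have h3 := continuous_ph' (n := n)
  unfold errf Function.uncurry
  fun_prop

lemma errf_int {Q : Matrix (Fin n) (Fin n) ℂ} (h1 : Qᴴ = Q) (h2 : Q * Q = Q)
    {K : ℝ} (h3 : Q.trace.re ≤ K) (hK : 0 ≤ K) {γ : ℝ} (hγ : 0 ≤ γ) (E : Set (ℝ × ℝ))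
    (hE : MeasurableSet E) (hEγ : ∀ s t, γ ≤ |s - t| → (s, t) ∉ E) :
    ∫ w, E.indicator (Function.uncurry (errf Q)) (w 0, w 1) ∂(pim (Fin 2)) ≤
      4 * K * (n * γ) ^ 3 / π := by
  have hb : ∀ s t, |E.indicator (Function.uncurry (errf Q)) (s, t)| ≤ 16 * n ^ 2 := by
    intro s t
    by_cases hst : (s, t) ∈ E
    · rw [Set.indicator_of_mem hst, Function.uncurry, abs_of_nonneg (errf_nonneg _ _ _)]
      exact errf_le h1 h2 _ _
    · rw [Set.indicator_of_notMem hst]; simp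
  have hm : Measurable (Function.uncurry fun s t => E.indicator (Function.uncurry (errf Q)) (s, t)) :=
    (continuous_errf Q).measurable.indicator hE
  rw [int_two (f := fun s t => E.indicator (Function.uncurry (errf Q)) (s, t)) hm _ hb]
  refine (shear_le hm _ hb hγ (fun s t h => Set.indicator_of_notMem (hEγ s t h) _)
    (K := 4 * n * (n * γ) ^ 2 * K) fun h hh => ?_).trans (le_of_eq (by ring))
  have hph : Continuous fun s => ph n (s + h) - ph n s := by
    have h3 := continuous_ph' (n := n)
    fun_prop
  have i1 : Integrable (fun s => hq Q (ph n (s + h) - ph n s)) lam0 := by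
    refine bdd_integrable (M := 4 * n) ((continuous_hq Q).comp hph).measurable fun s => ?_
    rw [abs_of_nonneg (hq_nonneg _ _)]
    exact (hq_le h1 h2 _).trans (nsq_le4 _ _)
  have i2 : Integrable (fun s => hq Q (ph n s)) lam0 := by
    refine bdd_integrable (M := n) ((continuous_hq Q).comp continuous_ph').measurable fun s => ?_
    rw [abs_of_nonneg (hq_nonneg _ _)]
    exact (hq_le h1 h2 _).trans (nsq_ph _).le
  have hsq : h ^ 2 ≤ γ ^ 2 := sq_le_sq' (by linarith [(abs_lt.1 hh).1]) (abs_lt.1 hh).2.le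
  have hsq2 : (n * h) ^ 2 ≤ (n * γ) ^ 2 := by
    rw [mul_pow, mul_pow]; gcongr
  have j1 : ∫ s, hq Q (ph n (s + h) - ph n s) ∂lam0 ≤ (n * γ) ^ 2 * K := by
    have := hq_parseval h1 h2 h3
      (fun k : Fin n => Complex.exp ((((k : ℕ) : ℝ) * h : ℝ) * Complex.I) - 1)
      (M := (n * γ) ^ 2) (by positivity) fun k => by
        refine (norm_exp_sub_one_le _).trans (le_trans ?_ hsq2)
        rw [mul_pow, mul_pow]
        have hk : ((k : ℕ) : ℝ) ≤ n := by exact_mod_cast k.2.le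
        gcongr
    refine le_trans (le_of_eq ?_) this
    congr 1
    ext s
    congr 1
    ext k
    rw [ph_sub, add_sub_cancel_left]
  have j2 : ∫ s, hq Q (ph n s) ∂lam0 ≤ K := by
    have := hq_parseval h1 h2 h3 (fun k : Fin n => 1) (M := 1) (by positivity) fun k => by simp
    simpa using this
  calc _ ≤ ∫ s, (2 * n * hq Q (ph n (s + h) - ph n s) + 2 * n * (n * γ) ^ 2 * hq Q (ph n s)) ∂lam0 := by
        refine integral_mono ?_ ((i1.const_mul _).add (i2.const_mul _)) fun s => ?_
        · exact bdd_integrable ((meas_shf hm).comp (measurable_prodMk_left)) _ fun s => shf_bdd _ hb h s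
        · have p1 := hq_nonneg Q (ph n (s + h) - ph n s)
          have p2 := hq_nonneg Q (ph n s)
          have p3 : E.indicator (Function.uncurry (errf Q)) (s, s + h) ≤ errf Q s (s + h) :=
            Set.indicator_le_self' (fun _ _ => errf_nonneg _ _ _) _
          have p4 : shf (fun s t => E.indicator (Function.uncurry (errf Q)) (s, t)) h s ≤
              errf Q s (s + h) := by
            rw [shf, Set.indicator_apply]
            split_ifs
            · exact p3
            · exact errf_nonneg _ _ _
          refine p4.trans ?_
          rw [errf]
          have p5 : nsq (ph n (s + h) - ph n s) ≤ n * (n * γ) ^ 2 := by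
            refine (nsq_le _ _).trans ?_
            rw [add_sub_cancel_left]
            exact mul_le_mul_of_nonneg_left ((min_le_right _ _).trans hsq2) (by positivity)
          nlinarith [mul_le_mul_of_nonneg_right p5 p2]
    _ ≤ _ := by
        rw [integral_add (i1.const_mul _) (i2.const_mul _), integral_const_mul, integral_const_mul]
        have q1 := mul_le_mul_of_nonneg_left j1 (show (0:ℝ) ≤ 2 * n by positivity)
        have q2 := mul_le_mul_of_nonneg_left j2 (show (0:ℝ) ≤ 2 * n * (n * γ) ^ 2 by positivity)
        linarith

end CUE

namespace CUE
set_option linter.unusedSectionVars false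
variable {n : ℕ}

/-- good pairs -/
def gd (γ a b : ℝ) : Set (ℝ × ℝ) := {p | |p.1 - p.2| < γ ∧ (p.1 + p.2) / 2 ∈ Set.Ico a b}

lemma mem_gd {γ a b s t : ℝ} : (s, t) ∈ gd γ a b ↔ |s - t| < γ ∧ (s + t) / 2 ∈ Set.Ico a b := Iff.rfl

lemma gd_symm {γ a b s t : ℝ} : (s, t) ∈ gd γ a b ↔ (t, s) ∈ gd γ a b := by
  rw [mem_gd, mem_gd, abs_sub_comm, add_comm]

lemma meas_gd (γ a b : ℝ) : MeasurableSet (gd γ a b) := by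
  apply MeasurableSet.inter
  · exact measurableSet_lt (f := fun p : ℝ × ℝ => |p.1 - p.2|) (by fun_prop) measurable_const
  · exact measurableSet_Ico.preimage (f := fun p : ℝ × ℝ => (p.1 + p.2) / 2) (by fun_prop)

lemma gd_far {γ a b : ℝ} (s t : ℝ) (h : γ ≤ |s - t|) : (s, t) ∉ gd γ a b := fun h2 =>
  absurd h2.1 (not_lt.2 h)

lemma lam0_apply {S : Set ℝ} (hS : MeasurableSet S) :
    lam0.real S = (2 * π)⁻¹ * volume.real (S ∩ Set.Ico 0 (2 * π)) := by
  rw [measureReal_def, lam0, Measure.smul_apply, Measure.restrict_apply hS, smul_eq_mul,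
    ENNReal.toReal_mul, ENNReal.toReal_ofReal (by positivity)]
  rfl

lemma lam0_le {S : Set ℝ} (hS : MeasurableSet S) {p q : ℝ} (hpq : p ≤ q) (h : S ⊆ Set.Icc p q) :
    lam0.real S ≤ (q - p) / (2 * π) := by
  rw [lam0_apply hS, div_eq_inv_mul]
  refine mul_le_mul_of_nonneg_left ?_ (by positivity)
  rw [← Real.volume_real_Icc_of_le hpq]
  exact measureReal_mono (Set.inter_subset_left.trans h) (by simp)

lemma lam0_ge {S : Set ℝ} (hS : MeasurableSet S) {p q : ℝ} (hp : 0 ≤ p)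
    (hq : q ≤ 2 * π) (h : Set.Ico p q ⊆ S) : (q - p) / (2 * π) ≤ lam0.real S := by
  rw [lam0_apply hS, div_eq_inv_mul]
  refine mul_le_mul_of_nonneg_left ?_ (by positivity)
  rcases le_total p q with hpq | hpq
  · rw [← Real.volume_real_Ico_of_le hpq]
    refine measureReal_mono (Set.subset_inter h fun x hx => ⟨hp.trans hx.1, hx.2.trans_le hq⟩) ?_
    exact ((measure_mono Set.inter_subset_right).trans_lt (by rw [Real.volume_Ico]; exact ENNReal.ofReal_lt_top)).ne
  · exact (sub_nonpos.2 hpq).trans measureReal_nonneg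

lemma window_le {γ a b : ℝ} (hγ : 0 ≤ γ) (hab : a ≤ b) (x : ℝ) :
    lam0.real {t | (x, t) ∈ gd γ a b} ≤ min γ (b - a) / π := by
  have hm : MeasurableSet {t | (x, t) ∈ gd γ a b} := measurable_prodMk_left (meas_gd γ a b)
  rw [← min_div_div_right Real.pi_pos.le]
  refine le_min ?_ ?_
  · refine (lam0_le hm (p := x - γ) (q := x + γ) (by linarith) fun t ht => ?_).trans
      (le_of_eq ?_)
    · have := abs_lt.1 (mem_gd.1 ht).1
      exact ⟨by linarith, by linarith⟩
    · rw [show x + γ - (x - γ) = 2 * γ by ring, mul_div_mul_left _ _ two_ne_zero]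
  · refine (lam0_le hm (p := 2 * a - x) (q := 2 * b - x) (by linarith) fun t ht => ?_).trans
      (le_of_eq ?_)
    · have := (mem_gd.1 ht).2
      exact ⟨by linarith [this.1], by linarith [this.2]⟩
    · rw [show 2 * b - x - (2 * a - x) = 2 * (b - a) by ring, mul_div_mul_left _ _ two_ne_zero]

/-- slice -/
def slice (γ a b h : ℝ) : Set ℝ := {s | s + h ∈ Set.Ico 0 (2 * π) ∧ (s, s + h) ∈ gd γ a b}

lemma meas_slice (γ a b h : ℝ) : MeasurableSet (slice γ a b h) := by
  apply MeasurableSet.inter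
  · exact measurableSet_Ico.preimage (by fun_prop)
  · exact (meas_gd γ a b).preimage (f := fun s => (s, s + h)) (by fun_prop)

lemma slice_le {γ a b : ℝ} (hab : a ≤ b) (h : ℝ) :
    lam0.real (slice γ a b h) ≤ (b - a) / (2 * π) := by
  refine (lam0_le (meas_slice _ _ _ _) (p := a - h / 2) (q := b - h / 2) (by linarith)
    fun t ht => ?_).trans (le_of_eq (by ring))
  have := (mem_gd.1 ht.2).2
  exact ⟨by linarith [this.1], by linarith [this.2]⟩

lemma slice_ge {γ a b : ℝ} (ha : 0 ≤ a) (hb : b ≤ 2 * π) {h : ℝ} (hh : |h| < γ) :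
    (b - a - |h|) / (2 * π) ≤ lam0.real (slice γ a b h) := by
  have h1 := le_abs_self h
  have h2 := neg_abs_le h
  refine (le_of_eq ?_).trans (lam0_ge (meas_slice γ a b h) (p := a + (|h| - h) / 2)
    (q := b - (|h| + h) / 2) (by linarith) (by linarith) fun t ht => ?_)
  · ring
  · have := ht.1
    have := ht.2
    refine ⟨⟨by linarith, by linarith⟩, mem_gd.2 ⟨?_, ?_, ?_⟩⟩
    · simpa using hh
    · linarith
    · linarith

lemma shf_gd (f : ℝ → ℝ → ℝ) (g : ℝ → ℝ) (hfg : ∀ s t, f s t = g (t - s)) (γ a b h : ℝ) :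
    ∫ s, shf (fun s t => (gd γ a b).indicator (Function.uncurry f) (s, t)) h s ∂lam0 =
      lam0.real (slice γ a b h) * g h := by
  have : shf (fun s t => (gd γ a b).indicator (Function.uncurry f) (s, t)) h =
      (slice γ a b h).indicator fun _ => g h := by
    ext s
    classical
    simp only [shf, Set.indicator_apply, slice, Set.mem_ofPred_eq, Function.uncurry]
    rw [← ite_and, hfg, add_sub_cancel_left]
  rw [this, integral_indicator (meas_slice γ a b h), setIntegral_const, smul_eq_mul]

lemma area_le {γ a b : ℝ} (hγ : 0 ≤ γ) (hab : a ≤ b) :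
    ∫ w, (gd γ a b).indicator 1 (w 0, w 1) ∂(pim (Fin 2)) ≤ (b - a) * γ / (2 * π ^ 2) := by
  have hb : ∀ s t : ℝ, |(gd γ a b).indicator (1 : ℝ × ℝ → ℝ) (s, t)| ≤ 1 := by
    intro s t
    by_cases hst : (s, t) ∈ gd γ a b
    · simp [Set.indicator_of_mem hst]
    · simp [Set.indicator_of_notMem hst]
  have hm : Measurable (Function.uncurry fun s t : ℝ =>
      (gd γ a b).indicator (1 : ℝ × ℝ → ℝ) (s, t)) :=
    measurable_one.indicator (meas_gd γ a b)
  rw [int_two (f := fun s t => (gd γ a b).indicator 1 (s, t)) hm 1 hb]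
  refine (shear_le hm 1 hb hγ (fun s t h => Set.indicator_of_notMem (gd_far s t h) _)
    (K := (b - a) / (2 * π)) fun h _ => ?_).trans (le_of_eq (by ring))
  have := shf_gd (fun _ _ => 1) (fun _ => 1) (fun _ _ => rfl) γ a b h
  have h2 := slice_le (γ := γ) hab h
  rw [mul_one] at this
  rw [← this] at h2
  exact h2

/-- two point function -/
noncomputable def rr (n : ℕ) (h : ℝ) : ℝ :=
  ∑ k : Fin n, ∑ l : Fin n, (1 - Real.cos ((((k : ℕ) : ℝ) - ((l : ℕ) : ℝ)) * h))

lemma corr_rr (w : Fin 2 → ℝ) : corr n w = rr n (w 1 - w 0) := by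
  rw [corr, Matrix.det_fin_two]
  simp only [Rm_apply]
  rw [Finset.sum_mul_sum, Finset.sum_mul_sum, ← Finset.sum_sub_distrib, Complex.re_sum, rr]
  refine Finset.sum_congr rfl fun k _ => ?_
  rw [← Finset.sum_sub_distrib, Complex.re_sum]
  refine Finset.sum_congr rfl fun l _ => ?_
  have : Complex.exp (((k : ℕ) : ℂ) * ((w 0 : ℂ) - w 1) * Complex.I) *
      Complex.exp (((l : ℕ) : ℂ) * ((w 1 : ℂ) - w 0) * Complex.I) =
      Complex.exp ((-((((k : ℕ) : ℝ) - ((l : ℕ) : ℝ)) * (w 1 - w 0)) : ℝ) * Complex.I) := by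
    rw [← Complex.exp_add]
    congr 1
    push_cast; ring
  rw [this, Complex.sub_re, Complex.exp_ofReal_mul_I_re, Real.cos_neg]
  simp

lemma sum_sq_diff (n : ℕ) : ∑ k : Fin n, ∑ l : Fin n, (((k : ℕ) : ℝ) - ((l : ℕ) : ℝ)) ^ 2 =
    (n : ℝ) ^ 2 * ((n : ℝ) ^ 2 - 1) / 6 := by
  have s1 : ∀ n : ℕ, ∑ k ∈ Finset.range n, (k : ℝ) = n * (n - 1) / 2 := by
    intro n
    induction n with
    | zero => simp
    | succ m ih => rw [Finset.sum_range_succ, ih]; push_cast; ring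
  have s2 : ∀ n : ℕ, ∑ k ∈ Finset.range n, (k : ℝ) ^ 2 = n * (n - 1) * (2 * n - 1) / 6 := by
    intro n
    induction n with
    | zero => simp
    | succ m ih => rw [Finset.sum_range_succ, ih]; push_cast; ring
  rw [Finset.sum_fin_eq_sum_range]
  have : ∀ k : ℕ, ∑ l : Fin n, ((k : ℝ) - ((l : ℕ) : ℝ)) ^ 2 =
      n * (k : ℝ) ^ 2 - 2 * k * (n * (n - 1) / 2) + n * (n - 1) * (2 * n - 1) / 6 := by
    intro k
    rw [← s1, ← s2, ← Fin.sum_univ_eq_sum_range (fun l => (l : ℝ)),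
      ← Fin.sum_univ_eq_sum_range (fun l => (l : ℝ) ^ 2), Finset.mul_sum]
    simp only [sub_sq, Finset.sum_add_distrib, Finset.sum_sub_distrib]
    simp
  simp only [this]
  rw [Finset.sum_congr rfl fun k hk => dif_pos (Finset.mem_range.1 hk)]
  rw [Finset.sum_add_distrib, Finset.sum_sub_distrib, ← Finset.mul_sum, s2, ← Finset.sum_mul,
    ← Finset.mul_sum, s1]
  simp
  ring

lemma cos_lower (y : ℝ) : y ^ 2 / 2 - y ^ 4 / 2 ≤ 1 - Real.cos y := by
  rcases le_total |y| 1 with h | h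
  · have := (abs_le.1 (Real.cos_bound h)).2
    have e : |y| ^ 4 = y ^ 4 := by rw [← abs_pow]; exact abs_of_nonneg (by positivity)
    rw [e] at this
    nlinarith [show 0 ≤ y ^ 4 by positivity]
  · have : 1 ≤ y ^ 2 := (one_le_sq_iff_one_le_abs _).2 h
    nlinarith [Real.cos_le_one y]

lemma rr_nonneg (h : ℝ) : 0 ≤ rr n h :=
  Finset.sum_nonneg fun _ _ => Finset.sum_nonneg fun _ _ => sub_nonneg.2 (Real.cos_le_one _)

lemma rr_le' (h : ℝ) : rr n h ≤ (n : ℝ) ^ 2 * ((n : ℝ) ^ 2 - 1) / 12 * h ^ 2 := by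
  have e : (n : ℝ) ^ 2 * ((n : ℝ) ^ 2 - 1) / 12 * h ^ 2 =
    ∑ k : Fin n, ∑ l : Fin n, ((((k : ℕ) : ℝ) - ((l : ℕ) : ℝ)) * h) ^ 2 / 2 := by
    rw [show (n : ℝ) ^ 2 * ((n : ℝ) ^ 2 - 1) / 12 * h ^ 2 =
      (n : ℝ) ^ 2 * ((n : ℝ) ^ 2 - 1) / 6 * (h ^ 2 / 2) by ring, ← sum_sq_diff, Finset.sum_mul]
    refine Finset.sum_congr rfl fun k _ => ?_
    rw [Finset.sum_mul]
    refine Finset.sum_congr rfl fun l _ => ?_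
    ring
  rw [e, rr]
  refine Finset.sum_le_sum fun k _ => Finset.sum_le_sum fun l _ => ?_
  linarith [Real.one_sub_sq_div_two_le_cos (x := (((k : ℕ) : ℝ) - ((l : ℕ) : ℝ)) * h)]

lemma rr_le (h : ℝ) : rr n h ≤ (n : ℝ) ^ 4 / 12 * h ^ 2 := by
  refine (rr_le' h).trans ?_
  refine mul_le_mul_of_nonneg_right ?_ (sq_nonneg _)
  nlinarith [sq_nonneg (n : ℝ)]

lemma rr_ge (h : ℝ) : (n : ℝ) ^ 2 * ((n : ℝ) ^ 2 - 1) / 12 * h ^ 2 - (n : ℝ) ^ 6 / 2 * h ^ 4 ≤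
    rr n h := by
  have e : (n : ℝ) ^ 2 * ((n : ℝ) ^ 2 - 1) / 12 * h ^ 2 =
    ∑ k : Fin n, ∑ l : Fin n, ((((k : ℕ) : ℝ) - ((l : ℕ) : ℝ)) * h) ^ 2 / 2 := by
    rw [show (n : ℝ) ^ 2 * ((n : ℝ) ^ 2 - 1) / 12 * h ^ 2 =
      (n : ℝ) ^ 2 * ((n : ℝ) ^ 2 - 1) / 6 * (h ^ 2 / 2) by ring, ← sum_sq_diff, Finset.sum_mul]
    refine Finset.sum_congr rfl fun k _ => ?_
    rw [Finset.sum_mul]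
    refine Finset.sum_congr rfl fun l _ => ?_
    ring
  have e2 : (n : ℝ) ^ 6 / 2 * h ^ 4 = ∑ k : Fin n, ∑ l : Fin n, (n : ℝ) ^ 4 / 2 * h ^ 4 := by
    simp; ring
  rw [e, e2, ← Finset.sum_sub_distrib, rr]
  refine Finset.sum_le_sum fun k _ => ?_
  rw [← Finset.sum_sub_distrib]
  refine Finset.sum_le_sum fun l _ => ?_
  refine le_trans ?_ (cos_lower ((((k : ℕ) : ℝ) - ((l : ℕ) : ℝ)) * h))
  have hk : ((k : ℕ) : ℝ) ≤ n := by exact_mod_cast k.2.le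
  have hl : ((l : ℕ) : ℝ) ≤ n := by exact_mod_cast l.2.le
  have hd : (((k : ℕ) : ℝ) - ((l : ℕ) : ℝ)) ^ 4 ≤ (n : ℝ) ^ 4 := by
    have : |((k : ℕ) : ℝ) - ((l : ℕ) : ℝ)| ≤ n := by
      rw [abs_le]
      constructor <;> linarith [Nat.cast_nonneg (α := ℝ) (k : ℕ), Nat.cast_nonneg (α := ℝ) (l : ℕ)]
    rw [← Even.pow_abs (by decide : Even 4)]
    gcongr
  have := mul_le_mul_of_nonneg_right hd (show 0 ≤ h ^ 4 by positivity)
  rw [mul_pow _ h 4]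
  linarith

lemma continuous_rr : Continuous (rr n) := by
  unfold rr
  fun_prop

lemma int_pow_Ioo {γ : ℝ} (hγ : 0 ≤ γ) (m : ℕ) :
    ∫ h in Set.Ioo (-γ) γ, h ^ (2 * m) = 2 * γ ^ (2 * m + 1) / (2 * m + 1) := by
  rw [← integral_Ioc_eq_integral_Ioo, ← intervalIntegral.integral_of_le (by linarith),
    integral_pow, Odd.neg_pow ⟨m, rfl⟩]
  push_cast; ring

/-- the expected number of ordered good pairs -/
noncomputable def E1 (n : ℕ) (γ a b : ℝ) : ℝ :=
  ∫ w, (gd γ a b).indicator (fun p => rr n (p.2 - p.1)) (w 0, w 1) ∂(pim (Fin 2))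

lemma E1_eq {γ a b : ℝ} : E1 n γ a b =
    (2 * π)⁻¹ * ∫ h in Set.Ioo (-γ) γ, lam0.real (slice γ a b h) * rr n h := by
  have hb : ∀ s t : ℝ, |(gd γ a b).indicator (fun p => rr n (p.2 - p.1)) (s, t)| ≤ 2 * n ^ 2 := by
    intro s t
    rw [abs_of_nonneg (Set.indicator_nonneg (fun _ _ => rr_nonneg _) _)]
    refine (Set.indicator_le_self' (fun _ _ => rr_nonneg _) _).trans ?_
    rw [rr]
    have : (2 * (n : ℝ) ^ 2) = ∑ k : Fin n, ∑ l : Fin n, 2 := by simp; ring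
    rw [this]
    exact Finset.sum_le_sum fun k _ => Finset.sum_le_sum fun l _ => by
      linarith [Real.neg_one_le_cos ((((k : ℕ) : ℝ) - ((l : ℕ) : ℝ)) * (t - s))]
  have hm : Measurable (Function.uncurry fun s t : ℝ =>
      (gd γ a b).indicator (fun p => rr n (p.2 - p.1)) (s, t)) := by
    have := continuous_rr (n := n)
    exact Measurable.indicator (f := fun p : ℝ × ℝ => rr n (p.2 - p.1)) (by fun_prop) (meas_gd γ a b)
  rw [E1, int_two (f := fun s t => (gd γ a b).indicator (fun p => rr n (p.2 - p.1)) (s, t)) hm _ hb,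
    shear hm _ hb (fun s t h => Set.indicator_of_notMem (gd_far s t h) _)]
  congr 2
  ext h
  exact shf_gd (fun s t => rr n (t - s)) (rr n) (fun _ _ => rfl) γ a b h

lemma E1_nonneg {γ a b : ℝ} : 0 ≤ E1 n γ a b :=
  integral_nonneg fun _ => Set.indicator_nonneg (fun _ _ => rr_nonneg _) _

lemma lint {f : ℝ → ℝ} (hf : Continuous f) (γ : ℝ) : IntegrableOn f (Set.Ioo (-γ) γ) :=
  (hf.continuousOn.integrableOn_Icc).mono_set Set.Ioo_subset_Icc_self

lemma E1_int {γ a b : ℝ} (hab : a ≤ b) :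
    IntegrableOn (fun h => lam0.real (slice γ a b h) * rr n h) (Set.Ioo (-γ) γ) := by
  have hS : MeasurableSet {p : ℝ × ℝ | p.2 ∈ slice γ a b p.1} := by
    apply MeasurableSet.inter
    · exact measurableSet_Ico.preimage (f := fun p : ℝ × ℝ => p.2 + p.1) (by fun_prop)
    · exact (meas_gd γ a b).preimage (f := fun p : ℝ × ℝ => (p.2, p.2 + p.1)) (by fun_prop)
  have hm : Measurable fun h => lam0.real (slice γ a b h) :=
    (measurable_measure_prodMk_left hS).ennreal_toReal
  refine Integrable.mono' (g := fun h => (b - a) / (2 * π) * rr n h)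
    (lint (by have := continuous_rr (n := n); fun_prop) γ)
    (hm.mul continuous_rr.measurable).aestronglyMeasurable (Eventually.of_forall fun h => ?_)
  rw [Real.norm_of_nonneg (mul_nonneg measureReal_nonneg (rr_nonneg _))]
  exact mul_le_mul_of_nonneg_right (slice_le hab h) (rr_nonneg _)

/-- the mean -/
noncomputable def muP (n : ℕ) (γ a b : ℝ) : ℝ := (b - a) * γ ^ 3 * (n : ℝ) ^ 4 / (144 * π ^ 2)

lemma E1_le {γ a b : ℝ} (hγ : 0 ≤ γ) (hab : a ≤ b) : E1 n γ a b ≤ 2 * muP n γ a b := by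
  rw [E1_eq]
  have : ∫ h in Set.Ioo (-γ) γ, lam0.real (slice γ a b h) * rr n h ≤
      ∫ h in Set.Ioo (-γ) γ, (b - a) / (2 * π) * (n : ℝ) ^ 4 / 12 * h ^ 2 := by
    refine setIntegral_mono_on (E1_int hab) (lint (by fun_prop) γ) measurableSet_Ioo fun h _ => ?_
    have hp : 0 ≤ (b - a) / (2 * π) := div_nonneg (by linarith) (by positivity)
    refine (mul_le_mul (slice_le hab h) (rr_le h) (rr_nonneg _) hp).trans (le_of_eq (by ring))
  rw [integral_const_mul] at this
  have h2 := int_pow_Ioo hγ 1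
  rw [show 2 * 1 = 2 by norm_num] at h2
  rw [h2] at this
  refine (mul_le_mul_of_nonneg_left this (by positivity)).trans (le_of_eq ?_)
  rw [muP]
  have := Real.pi_pos
  push_cast
  field_simp
  ring

lemma E1_ge {γ a b : ℝ} (hγ : 0 < γ) (ha : 0 ≤ a) (hab : a < b) (hb : b ≤ 2 * π) (hn : 1 ≤ n) :
    2 * muP n γ a b * (1 - γ / (b - a) - (n : ℝ)⁻¹ - 4 * (n * γ) ^ 2) ≤ E1 n γ a b := by
  have hn' : (1:ℝ) ≤ n := by exact_mod_cast hn
  have hL : 0 < b - a := by linarith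
  have hmu : 0 ≤ muP n γ a b := by rw [muP]; positivity
  have hpi := Real.pi_pos
  set D := (n : ℝ) ^ 2 * ((n : ℝ) ^ 2 - 1) / 12 with hD
  have hD0 : 0 ≤ D := by rw [hD]; have : 1 ≤ (n:ℝ)^2 := one_le_pow₀ hn'
                         have : 0 ≤ (n:ℝ)^2 - 1 := by linarith
                         positivity
  rcases le_total 1 (γ / (b - a)) with hc | hc
  · refine le_trans ?_ E1_nonneg
    refine mul_nonpos_of_nonneg_of_nonpos (by positivity) ?_
    have : 0 ≤ (n : ℝ)⁻¹ := by positivity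
    have : 0 ≤ 4 * (n * γ) ^ 2 := by positivity
    linarith
  rw [div_le_one hL] at hc
  have key : ∫ h in Set.Ioo (-γ) γ, (b - a - γ) / (2 * π) * (D * h ^ 2 - (n : ℝ) ^ 6 / 2 * h ^ 4) ≤
      ∫ h in Set.Ioo (-γ) γ, lam0.real (slice γ a b h) * rr n h := by
    refine setIntegral_mono_on (lint (by fun_prop) γ) (E1_int hab.le) measurableSet_Ioo fun h hh => ?_
    have hh' : |h| < γ := abs_lt.2 hh
    have p1 : (b - a - γ) / (2 * π) * (D * h ^ 2 - (n : ℝ) ^ 6 / 2 * h ^ 4) ≤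
      (b - a - γ) / (2 * π) * rr n h :=
      mul_le_mul_of_nonneg_left (rr_ge h) (div_nonneg (by linarith) (by positivity))
    refine p1.trans (mul_le_mul_of_nonneg_right (le_trans ?_ (slice_ge ha hb hh')) (rr_nonneg _))
    gcongr
  rw [integral_const_mul, integral_sub (lint (by fun_prop) γ) (lint (by fun_prop) γ),
    integral_const_mul, integral_const_mul] at key
  have h2 := int_pow_Ioo hγ.le 1
  have h4 := int_pow_Ioo hγ.le 2
  rw [show 2 * 1 = 2 by norm_num] at h2
  rw [show 2 * 2 = 4 by norm_num] at h4
  rw [h2, h4] at key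
  rw [E1_eq]
  refine le_trans ?_ (mul_le_mul_of_nonneg_left key (by positivity))
  have e : (2 * π)⁻¹ * ((b - a - γ) / (2 * π) * (D * (2 * γ ^ (2 + 1) / (2 * (1:ℕ) + 1)) -
      (n : ℝ) ^ 6 / 2 * (2 * γ ^ (4 + 1) / (2 * (2:ℕ) + 1)))) =
      2 * muP n γ a b * ((1 - γ / (b - a)) * (1 - (n : ℝ)⁻¹ ^ 2 - 18 / 5 * (n * γ) ^ 2)) := by
    rw [muP, hD]
    push_cast
    field_simp
    ring
  rw [e]
  refine mul_le_mul_of_nonneg_left ?_ (by positivity)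
  set u := γ / (b - a) with hu
  have hu0 : 0 ≤ u := by positivity
  have hu1 : u ≤ 1 := (div_le_one hL).2 hc
  have hi0 : 0 ≤ (n : ℝ)⁻¹ := by positivity
  have hi1 : (n : ℝ)⁻¹ ≤ 1 := inv_le_one_of_one_le₀ hn'
  have hi2 : (n : ℝ)⁻¹ ^ 2 ≤ (n : ℝ)⁻¹ := by nlinarith
  have hx : 0 ≤ (n * γ) ^ 2 := by positivity
  nlinarith [mul_nonneg hu0 hx, mul_nonneg hu0 (sq_nonneg (n : ℝ)⁻¹)]

end CUE

namespace CUE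
set_option linter.unusedSectionVars false
variable {n : ℕ}

variable {κ : Type} [Fintype κ] [DecidableEq κ]

/-- add a free pair -/
def pairS (γ a b : ℝ) (B : Set (κ → ℝ)) : Set (κ ⊕ Fin 2 → ℝ) :=
  {z | (fun i => z (Sum.inl i)) ∈ B ∧ (z (Sum.inr 0), z (Sum.inr 1)) ∈ gd γ a b}

/-- add a pendant point -/
def pendS (γ a b : ℝ) (B : Set (κ → ℝ)) (u : κ) : Set (κ ⊕ Unit → ℝ) :=
  {z | (fun i => z (Sum.inl i)) ∈ B ∧ (z (Sum.inl u), z (Sum.inr ())) ∈ gd γ a b}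

lemma meas_pairS (γ a b : ℝ) {B : Set (κ → ℝ)} (hB : MeasurableSet B) :
    MeasurableSet (pairS γ a b B) := by
  apply MeasurableSet.inter
  · exact hB.preimage (f := fun z : κ ⊕ Fin 2 → ℝ => fun i => z (Sum.inl i)) (by fun_prop)
  · exact (meas_gd γ a b).preimage
      (f := fun z : κ ⊕ Fin 2 → ℝ => (z (Sum.inr 0), z (Sum.inr 1))) (by fun_prop)

lemma meas_pendS (γ a b : ℝ) {B : Set (κ → ℝ)} (hB : MeasurableSet B) (u : κ) :
    MeasurableSet (pendS γ a b B u) := by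
  apply MeasurableSet.inter
  · exact hB.preimage (f := fun z : κ ⊕ Unit → ℝ => fun i => z (Sum.inl i)) (by fun_prop)
  · exact (meas_gd γ a b).preimage
      (f := fun z : κ ⊕ Unit → ℝ => (z (Sum.inl u), z (Sum.inr ()))) (by fun_prop)

/-- expected count -/
noncomputable def IS (n : ℕ) (B : Set (κ → ℝ)) : ℝ := ∫ z, B.indicator (corr n) z ∂(pim κ)

lemma indc_nonneg (B : Set (κ → ℝ)) (z : κ → ℝ) : 0 ≤ B.indicator (corr n) z :=
  Set.indicator_nonneg (fun _ _ => corr_nonneg _) _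

lemma IS_nonneg (B : Set (κ → ℝ)) : 0 ≤ IS n B := integral_nonneg fun z => indc_nonneg B z

lemma indc_meas {B : Set (κ → ℝ)} (hB : MeasurableSet B) : Measurable (B.indicator (corr n)) :=
  measurable_corr.indicator hB

lemma indc_bdd (B : Set (κ → ℝ)) (z : κ → ℝ) :
    |B.indicator (corr n) z| ≤ (Fintype.card κ).factorial * n ^ (Fintype.card κ) := by
  rw [abs_of_nonneg (indc_nonneg B z)]
  exact (Set.indicator_le_self' (fun _ _ => corr_nonneg _) _).trans (corr_le z)

lemma indc_int {B : Set (κ → ℝ)} (hB : MeasurableSet B) :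
    Integrable (B.indicator (corr n)) (pim κ) :=
  bdd_integrable (indc_meas hB) _ (indc_bdd B)

lemma IS_emp : IS n (Set.univ : Set (Empty → ℝ)) = 1 := by
  rw [IS]
  have : ∀ z : Empty → ℝ, (Set.univ : Set (Empty → ℝ)).indicator (corr n) z = 1 := by
    intro z
    rw [Set.indicator_of_mem (Set.mem_univ z), corr, Matrix.det_isEmpty]; rfl
  simp only [this]
  simp

lemma min_step {γ s t : ℝ} (h : |s - t| < γ) :
    nsq (ph n t - ph n s) ≤ n * min 4 ((n * γ) ^ 2) := by
  refine (nsq_le s t).trans ?_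
  have : (t - s) ^ 2 ≤ γ ^ 2 := by
    rw [abs_sub_comm] at h
    exact sq_le_sq' (by linarith [(abs_lt.1 h).1]) (abs_lt.1 h).2.le
  gcongr _ * min _ ?_
  rw [mul_pow, mul_pow]
  gcongr

lemma indicator_one_nonneg {α : Type*} (S : Set α) (x : α) : 0 ≤ S.indicator (1 : α → ℝ) x :=
  Set.indicator_nonneg (fun _ _ => zero_le_one) _

lemma indicator_one_le {α : Type*} (S : Set α) (x : α) : S.indicator (1 : α → ℝ) x ≤ 1 :=
  Set.indicator_le_self' (fun _ _ => zero_le_one) _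

lemma IS_pend {γ a b : ℝ} (hγ : 0 ≤ γ) (hab : a ≤ b) {B : Set (κ → ℝ)} (hB : MeasurableSet B) (u : κ) :
    IS n (pendS γ a b B u) ≤ IS n B * (n * min 4 ((n * γ) ^ 2) * (min γ (b - a) / π)) := by
  set K := n * min 4 ((n * γ) ^ 2) with hK
  have hK0 : 0 ≤ K := by positivity
  have := fub_le (F := (pendS γ a b B u).indicator (corr n)) (κ := κ) (τ := Unit)
    (indc_meas (meas_pendS γ a b hB u)) _ (indc_bdd (pendS γ a b B u))
    (g := fun x => B.indicator (corr n) x * (K * (min γ (b - a) / π)))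
    ((indc_int hB).mul_const _) fun x => by
      have hm : MeasurableSet {w : Unit → ℝ | (x u, w ()) ∈ gd γ a b} :=
        (meas_gd γ a b).preimage (f := fun w : Unit → ℝ => (x u, w ())) (by fun_prop)
      have h1 : ∀ w : Unit → ℝ, |(pendS γ a b B u).indicator (corr n) (Sum.elim x w)| ≤
          B.indicator (corr n) x * K * {w : Unit → ℝ | (x u, w ()) ∈ gd γ a b}.indicator 1 w := by
        intro w
        rw [abs_of_nonneg (indc_nonneg _ _)]
        by_cases hz : Sum.elim x w ∈ (pendS γ a b B u)
        · rw [Set.indicator_of_mem hz]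
          obtain ⟨hz1, hz2⟩ := hz
          rw [Set.indicator_of_mem (show x ∈ B from hz1),
            Set.indicator_of_mem (show w ∈ {w : Unit → ℝ | (x u, w ()) ∈ gd γ a b} from hz2)]
          refine (pend_step x u w).trans ?_
          rw [Pi.one_apply, mul_one]
          exact mul_le_mul_of_nonneg_left (min_step hz2.1) (corr_nonneg _)
        · rw [Set.indicator_of_notMem hz]
          exact mul_nonneg (mul_nonneg (indc_nonneg B x) hK0) (indicator_one_nonneg _ _)
      rw [← Real.norm_eq_abs]
      refine (norm_integral_le_of_norm_le (g := fun w => B.indicator (corr n) x * K *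
        {w : Unit → ℝ | (x u, w ()) ∈ gd γ a b}.indicator 1 w)
        ((integrable_const (1:ℝ)).indicator hm |>.const_mul _)
        (Eventually.of_forall h1)).trans ?_
      rw [integral_const_mul, mul_assoc]
      refine mul_le_mul_of_nonneg_left (mul_le_mul_of_nonneg_left ?_ hK0) (indc_nonneg B x)
      rw [integral_indicator_one hm]
      refine le_trans (le_of_eq ?_) (window_le hγ hab (x u))
      exact (measurePreserving_eval (fun _ : Unit => lam0) ()).measureReal_preimage
        (measurable_prodMk_left (meas_gd γ a b) : MeasurableSet {t | (x u, t) ∈ gd γ a b}).nullMeasurableSet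
  rw [integral_mul_const] at this
  exact (le_abs_self _).trans this

lemma IS_pair {γ a b : ℝ} (hγ : 0 ≤ γ) (hab : a ≤ b) {B : Set (κ → ℝ)} (hB : MeasurableSet B) :
    IS n (pairS γ a b B) ≤
      IS n B * (n * (n * min 4 ((n * γ) ^ 2)) * ((b - a) * γ / (2 * π ^ 2))) := by
  set K := n * (n * min 4 ((n * γ) ^ 2)) with hK
  have hK0 : 0 ≤ K := by positivity
  have := fub_le (F := (pairS γ a b B).indicator (corr n)) (κ := κ) (τ := Fin 2)
    (indc_meas (meas_pairS γ a b hB)) _ (indc_bdd (pairS γ a b B))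
    (g := fun x => B.indicator (corr n) x * (K * ((b - a) * γ / (2 * π ^ 2))))
    ((indc_int hB).mul_const _) fun x => by
      have hm : Measurable fun w : Fin 2 → ℝ => (gd γ a b).indicator (1 : ℝ × ℝ → ℝ) (w 0, w 1) :=
        (measurable_one.indicator (meas_gd γ a b)).comp (by fun_prop)
      have h1 : ∀ w : Fin 2 → ℝ, |(pairS γ a b B).indicator (corr n) (Sum.elim x w)| ≤
          B.indicator (corr n) x * K * (gd γ a b).indicator 1 (w 0, w 1) := by
        intro w
        rw [abs_of_nonneg (indc_nonneg _ _)]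
        by_cases hz : Sum.elim x w ∈ (pairS γ a b B)
        · rw [Set.indicator_of_mem hz]
          obtain ⟨hz1, hz2⟩ := hz
          rw [Set.indicator_of_mem (show x ∈ B from hz1),
            Set.indicator_of_mem (show (w 0, w 1) ∈ gd γ a b from hz2)]
          obtain ⟨Q, -, -, -, hQ⟩ := pair_step (n := n) x
          refine (hQ w).2.trans ?_
          rw [Pi.one_apply, mul_one]
          exact mul_le_mul_of_nonneg_left (mul_le_mul_of_nonneg_left (min_step hz2.1)
            (by positivity)) (corr_nonneg _)
        · rw [Set.indicator_of_notMem hz]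
          exact mul_nonneg (mul_nonneg (indc_nonneg B x) hK0) (indicator_one_nonneg _ _)
      rw [← Real.norm_eq_abs]
      refine (norm_integral_le_of_norm_le (g := fun w : Fin 2 → ℝ => B.indicator (corr n) x * K *
        (gd γ a b).indicator 1 (w 0, w 1))
        ((bdd_integrable hm 1 fun w => by
          rw [abs_of_nonneg (indicator_one_nonneg _ _)]; exact indicator_one_le _ _).const_mul _)
        (Eventually.of_forall h1)).trans ?_
      rw [integral_const_mul, mul_assoc]
      exact mul_le_mul_of_nonneg_left (mul_le_mul_of_nonneg_left (area_le hγ hab) hK0)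
        (indc_nonneg B x)
  rw [integral_mul_const] at this
  exact (le_abs_self _).trans this

lemma IS_pair_diff {γ a b : ℝ} (hγ : 0 ≤ γ) {B : Set (κ → ℝ)} (hB : MeasurableSet B) :
    |IS n (pairS γ a b B) - IS n B * E1 n γ a b| ≤ IS n B * (4 * (Fintype.card κ) * (n * γ) ^ 3 / π) := by
  set F2 : (κ ⊕ Fin 2 → ℝ) → ℝ := fun z => B.indicator (corr n) (fun i => z (Sum.inl i)) *
    (gd γ a b).indicator (fun p => rr n (p.2 - p.1)) (z (Sum.inr 0), z (Sum.inr 1)) with hF2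
  have hrm : Measurable ((gd γ a b).indicator fun p : ℝ × ℝ => rr n (p.2 - p.1)) := by
    have := continuous_rr (n := n)
    exact Measurable.indicator (f := fun p : ℝ × ℝ => rr n (p.2 - p.1)) (by fun_prop) (meas_gd γ a b)
  have hrb : ∀ p : ℝ × ℝ, |(gd γ a b).indicator (fun p => rr n (p.2 - p.1)) p| ≤
      (Fintype.card (Fin 2)).factorial * n ^ (Fintype.card (Fin 2)) := by
    intro p
    rw [abs_of_nonneg (Set.indicator_nonneg (fun _ _ => rr_nonneg _) _)]
    refine (Set.indicator_le_self' (fun _ _ => rr_nonneg _) _).trans ?_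
    have := corr_rr (n := n) ![p.1, p.2]
    simp only [Matrix.cons_val_zero, Matrix.cons_val_one] at this
    rw [← this]
    exact corr_le _
  have hF2m : Measurable F2 := by
    refine Measurable.mul ((indc_meas hB).comp (by fun_prop)) (hrm.comp (by fun_prop))
  obtain ⟨M2, hF2b⟩ : ∃ M2, ∀ z, |F2 z| ≤ M2 := ⟨_, fun z => by
    rw [hF2, abs_mul]
    exact mul_le_mul (indc_bdd B _) (hrb _) (abs_nonneg _) (by positivity)⟩
  have e2 : ∫ z, F2 z ∂(pim (κ ⊕ Fin 2)) = IS n B * E1 n γ a b := by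
    rw [fub hF2m M2 hF2b, IS, ← integral_mul_const]
    congr 1
    ext x
    simp only [hF2, Sum.elim_inl, Sum.elim_inr]
    rw [integral_const_mul]
    rfl
  set F1 : (κ ⊕ Fin 2 → ℝ) → ℝ := (pairS γ a b B).indicator (corr n) with hF1
  have hF1m : Measurable F1 := indc_meas (meas_pairS γ a b hB)
  have i1 : Integrable F1 (pim (κ ⊕ Fin 2)) := indc_int (meas_pairS γ a b hB)
  have i2 : Integrable F2 (pim (κ ⊕ Fin 2)) := bdd_integrable hF2m M2 hF2b
  have e3 : IS n (pairS γ a b B) - IS n B * E1 n γ a b = ∫ z, (F1 z - F2 z) ∂(pim (κ ⊕ Fin 2)) := by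
    rw [integral_sub i1 i2, e2]
    rfl
  rw [e3]
  obtain ⟨M1, hM1⟩ : ∃ M1, ∀ z, |F1 z| ≤ M1 := ⟨_, indc_bdd (pairS γ a b B)⟩
  have := fub_le (F := fun z => F1 z - F2 z) (κ := κ) (τ := Fin 2)
    (hF1m.sub hF2m) (M1 + M2) (fun z => (abs_sub _ _).trans (add_le_add (hM1 z) (hF2b z)))
    (g := fun x => B.indicator (corr n) x * (4 * (Fintype.card κ) * (n * γ) ^ 3 / π))
    ((indc_int hB).mul_const _) fun x => by
      obtain ⟨Q, h1, h2, h3, hQ⟩ := pair_step (n := n) x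
      have hm : Measurable fun w : Fin 2 → ℝ =>
          (gd γ a b).indicator (Function.uncurry (errf Q)) (w 0, w 1) :=
        ((continuous_errf Q).measurable.indicator (meas_gd γ a b)).comp (by fun_prop)
      have hpt : ∀ w : Fin 2 → ℝ, |F1 (Sum.elim x w) - F2 (Sum.elim x w)| ≤
          B.indicator (corr n) x * (gd γ a b).indicator (Function.uncurry (errf Q)) (w 0, w 1) := by
        intro w
        have em : Sum.elim x w ∈ (pairS γ a b B) ↔ x ∈ B ∧ (w 0, w 1) ∈ gd γ a b := Iff.rfl
        simp only [hF1, hF2, Sum.elim_inl, Sum.elim_inr]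
        by_cases hx : x ∈ B
        · by_cases hw : (w 0, w 1) ∈ gd γ a b
          · rw [Set.indicator_of_mem (em.2 ⟨hx, hw⟩), Set.indicator_of_mem hx,
              Set.indicator_of_mem hw, Set.indicator_of_mem hw]
            have := (hQ w).1
            rw [corr_rr w] at this
            exact this
          · rw [Set.indicator_of_notMem (fun h => hw (em.1 h).2), Set.indicator_of_notMem hw,
              Set.indicator_of_notMem hw]
            simp
        · rw [Set.indicator_of_notMem (fun h => hx (em.1 h).1), Set.indicator_of_notMem hx]
          simp
      rw [← Real.norm_eq_abs]
      refine (norm_integral_le_of_norm_le (g := fun w : Fin 2 → ℝ => B.indicator (corr n) x *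
        (gd γ a b).indicator (Function.uncurry (errf Q)) (w 0, w 1))
        ((bdd_integrable hm (16 * n ^ 2) fun w => by
          rw [abs_of_nonneg (Set.indicator_nonneg (f := Function.uncurry (errf Q))
            (fun _ _ => errf_nonneg _ _ _) _)]
          exact (Set.indicator_le_self' (fun _ _ => errf_nonneg _ _ _) _).trans
            (errf_le h1 h2 _ _)).const_mul _)
        (Eventually.of_forall hpt)).trans ?_
      rw [integral_const_mul]
      exact mul_le_mul_of_nonneg_left (errf_int h1 h2 h3 (by positivity) hγ _ (meas_gd γ a b)
        gd_far) (indc_nonneg B x)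
  rw [integral_mul_const] at this
  exact this

end CUE

namespace CUE
set_option linter.unusedSectionVars false
variable {κ : Type} [Fintype κ] [DecidableEq κ]
variable {V : Type} [Fintype V]

open Classical in
/-- indicator of a proposition -/
noncomputable def ind (p : Prop) : ℝ := if p then 1 else 0

lemma ind_true {p : Prop} (h : p) : ind p = 1 := if_pos h
lemma ind_false {p : Prop} (h : ¬ p) : ind p = 0 := if_neg h
lemma ind_nonneg (p : Prop) : 0 ≤ ind p := by unfold ind; split_ifs <;> norm_num
lemma ind_le_one (p : Prop) : ind p ≤ 1 := by unfold ind; split_ifs <;> norm_num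
lemma ind_and (p q : Prop) : ind (p ∧ q) = ind p * ind q := by
  by_cases hp : p <;> by_cases hq : q <;> simp [ind, hp, hq]
lemma ind_congr {p q : Prop} (h : p ↔ q) : ind p = ind q := by rw [propext h]

/-- count of injective configurations -/
noncomputable def NS (t : V → ℝ) (B : Set (κ → ℝ)) : ℝ :=
  ∑ f : κ → V, ind (Function.Injective f ∧ (fun i => t (f i)) ∈ B)

/-- related pairs -/
def Rl (γ a b : ℝ) (t : V → ℝ) (p q : V) : Prop := p ≠ q ∧ (t p, t q) ∈ gd γ a b

/-- ordered pairs -/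
noncomputable def NP (γ a b : ℝ) (t : V → ℝ) : ℝ := ∑ p, ∑ q, ind (Rl γ a b t p q)

lemma Rl_symm {γ a b : ℝ} {t : V → ℝ} {p q : V} (h : Rl γ a b t p q) : Rl γ a b t q p :=
  ⟨h.1.symm, gd_symm.1 h.2⟩

lemma NS_nonneg (t : V → ℝ) (B : Set (κ → ℝ)) : 0 ≤ NS t B :=
  Finset.sum_nonneg fun _ _ => ind_nonneg _

lemma NP_nonneg (γ a b : ℝ) (t : V → ℝ) : 0 ≤ NP γ a b t :=
  Finset.sum_nonneg fun _ _ => Finset.sum_nonneg fun _ _ => ind_nonneg _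

lemma sum_split {τ : Type} [Fintype τ] [DecidableEq τ] (F : (κ ⊕ τ → V) → ℝ) :
    ∑ z, F z = ∑ f : κ → V, ∑ g : τ → V, F (Sum.elim f g) := by
  rw [← Fintype.sum_prod_type', ← Equiv.sum_comp (Equiv.sumArrowEquivProdArrow κ τ V).symm]
  rfl

lemma sum_two (F : (Fin 2 → V) → ℝ) : ∑ g, F g = ∑ p, ∑ q, F ![p, q] := by
  rw [← Fintype.sum_prod_type', ← Equiv.sum_comp (finTwoArrowEquiv V).symm]
  rfl

lemma sum_unit (F : (Unit → V) → ℝ) : ∑ g, F g = ∑ r, F fun _ => r := by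
  rw [← Equiv.sum_comp (Equiv.funUnique Unit V).symm]
  rfl

/-- membership in the range -/
def inr (f : κ → V) (p : V) : Prop := ∃ i, f i = p

lemma inj_elim_two (f : κ → V) (p q : V) : Function.Injective (Sum.elim f ![p, q]) ↔
    Function.Injective f ∧ p ≠ q ∧ ¬ inr f p ∧ ¬ inr f q := by
  have h1 : Function.Injective ![p, q] ↔ p ≠ q := by
    constructor
    · intro h e
      exact zero_ne_one (α := Fin 2) (h (a₁ := 0) (a₂ := 1) (by simpa using e))
    · intro h i j
      fin_cases i <;> fin_cases j <;> simp [h, Ne.symm h]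
  rw [Sum.elim_injective, h1]
  simp only [Fin.forall_fin_two, inr, not_exists, Matrix.cons_val_zero, Matrix.cons_val_one]
  refine and_congr_right fun _ => and_congr_right fun _ => ?_
  exact ⟨fun h => ⟨fun i => (h i).1, fun i => (h i).2⟩, fun h i => ⟨h.1 i, h.2 i⟩⟩

lemma NS_pair (γ a b : ℝ) (t : V → ℝ) (B : Set (κ → ℝ)) : NS t (pairS γ a b B) =
    ∑ f : κ → V, ind (Function.Injective f ∧ (fun i => t (f i)) ∈ B) *
      ∑ p, ∑ q, ind (Rl γ a b t p q ∧ ¬ inr f p ∧ ¬ inr f q) := by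
  rw [NS, sum_split]
  refine Finset.sum_congr rfl fun f _ => ?_
  rw [sum_two, Finset.mul_sum]
  refine Finset.sum_congr rfl fun p _ => ?_
  rw [Finset.mul_sum]
  refine Finset.sum_congr rfl fun q _ => ?_
  rw [← ind_and, inj_elim_two]
  refine ind_congr ?_
  have : (fun i => t (Sum.elim f ![p, q] i)) ∈ pairS γ a b B ↔
    (fun i => t (f i)) ∈ B ∧ (t p, t q) ∈ gd γ a b := Iff.rfl
  rw [this, Rl]
  tauto

lemma inj_elim_one (f : κ → V) (r : V) : Function.Injective (Sum.elim f fun _ : Unit => r) ↔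
    Function.Injective f ∧ ¬ inr f r := by
  rw [Sum.elim_injective]
  simp only [inr, not_exists]
  exact ⟨fun h => ⟨h.1, fun i => h.2.2 i ()⟩,
    fun h => ⟨h.1, fun _ _ _ => rfl, fun i _ => h.2 i⟩⟩

lemma NS_pend (γ a b : ℝ) (t : V → ℝ) (B : Set (κ → ℝ)) (u : κ) : NS t (pendS γ a b B u) =
    ∑ f : κ → V, ind (Function.Injective f ∧ (fun i => t (f i)) ∈ B) *
      ∑ r, ind (Rl γ a b t (f u) r ∧ ¬ inr f r) := by
  rw [NS, sum_split]
  refine Finset.sum_congr rfl fun f _ => ?_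
  rw [sum_unit, Finset.mul_sum]
  refine Finset.sum_congr rfl fun r _ => ?_
  rw [← ind_and, inj_elim_one]
  refine ind_congr ?_
  have : (fun i => t (Sum.elim f (fun _ : Unit => r) i)) ∈ pendS γ a b B u ↔
    (fun i => t (f i)) ∈ B ∧ (t (f u), t r) ∈ gd γ a b := Iff.rfl
  rw [this, Rl]
  constructor
  · rintro ⟨⟨h1, h2⟩, h3, h4⟩
    exact ⟨⟨h1, h3⟩, ⟨fun h => h2 ⟨u, h⟩, h4⟩, h2⟩
  · rintro ⟨⟨h1, h3⟩, ⟨h, h4⟩, h2⟩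
    exact ⟨⟨h1, h2⟩, h3, h4⟩

lemma ind_le_of {p : Prop} {x : ℝ} (h0 : 0 ≤ x) (h : p → 1 ≤ x) : ind p ≤ x := by
  by_cases hp : p
  · rw [ind_true hp]; exact h hp
  · rw [ind_false hp]; exact h0

lemma split_ind (γ a b : ℝ) (t : V → ℝ) (f : κ → V) (p q : V) : ind (Rl γ a b t p q) ≤
    ind (Rl γ a b t p q ∧ ¬ inr f p ∧ ¬ inr f q) +
    ∑ u, ind (f u = p) * ind (Rl γ a b t (f u) q ∧ ¬ inr f q) +
    ∑ u, ind (f u = q) * ind (Rl γ a b t (f u) p ∧ ¬ inr f p) +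
    (∑ u, ind (f u = p)) * ∑ v, ind (f v = q) := by
  have n1 : 0 ≤ ∑ u, ind (f u = p) * ind (Rl γ a b t (f u) q ∧ ¬ inr f q) :=
    Finset.sum_nonneg fun _ _ => mul_nonneg (ind_nonneg _) (ind_nonneg _)
  have n2 : 0 ≤ ∑ u, ind (f u = q) * ind (Rl γ a b t (f u) p ∧ ¬ inr f p) :=
    Finset.sum_nonneg fun _ _ => mul_nonneg (ind_nonneg _) (ind_nonneg _)
  have n3 : 0 ≤ ∑ u, ind (f u = p) := Finset.sum_nonneg fun _ _ => ind_nonneg _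
  have n4 : 0 ≤ ∑ u, ind (f u = q) := Finset.sum_nonneg fun _ _ => ind_nonneg _
  have n5 := ind_nonneg (Rl γ a b t p q ∧ ¬ inr f p ∧ ¬ inr f q)
  have n6 := mul_nonneg n3 n4
  refine ind_le_of (by linarith) fun h => ?_
  by_cases hp : inr f p
  · by_cases hq : inr f q
    · obtain ⟨u, hu⟩ := hp
      obtain ⟨v, hv⟩ := hq
      have a1 : 1 ≤ ∑ u, ind (f u = p) := (ind_true hu).symm.le.trans
        (Finset.single_le_sum (f := fun u => ind (f u = p)) (fun _ _ => ind_nonneg _)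
          (Finset.mem_univ u))
      have a2 : 1 ≤ ∑ u, ind (f u = q) := (ind_true hv).symm.le.trans
        (Finset.single_le_sum (f := fun u => ind (f u = q)) (fun _ _ => ind_nonneg _)
          (Finset.mem_univ v))
      have := one_le_mul_of_one_le_of_one_le a1 a2
      linarith
    · obtain ⟨u, hu⟩ := hp
      have := Finset.single_le_sum (f := fun u => ind (f u = p) *
        ind (Rl γ a b t (f u) q ∧ ¬ inr f q)) (fun _ _ => mul_nonneg (ind_nonneg _) (ind_nonneg _))
        (Finset.mem_univ u)
      rw [ind_true hu, ind_true ⟨hu ▸ h, hq⟩] at this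
      linarith
  · by_cases hq : inr f q
    · obtain ⟨u, hu⟩ := hq
      have := Finset.single_le_sum (f := fun u => ind (f u = q) *
        ind (Rl γ a b t (f u) p ∧ ¬ inr f p)) (fun _ _ => mul_nonneg (ind_nonneg _) (ind_nonneg _))
        (Finset.mem_univ u)
      rw [ind_true hu, ind_true ⟨hu ▸ Rl_symm h, hp⟩] at this
      linarith
    · rw [ind_true (p := Rl γ a b t p q ∧ ¬ inr f p ∧ ¬ inr f q) ⟨h, hp, hq⟩]
      linarith

lemma sum_ind_eq (x : V) : ∑ p, ind (x = p) = 1 := by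
  classical
  rw [Finset.sum_eq_single x]
  · exact ind_true rfl
  · intro p _ hp; exact ind_false fun h => hp h.symm
  · simp

lemma sum_ind_eq' (x : V) (c : ℝ) : ∑ p, ind (x = p) * c = c := by
  rw [← Finset.sum_mul, sum_ind_eq, one_mul]

lemma NP_split (γ a b : ℝ) (t : V → ℝ) (f : κ → V) : NP γ a b t ≤
    (∑ p, ∑ q, ind (Rl γ a b t p q ∧ ¬ inr f p ∧ ¬ inr f q)) +
    2 * (∑ u, ∑ r, ind (Rl γ a b t (f u) r ∧ ¬ inr f r)) + (Fintype.card κ) ^ 2 := by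
  refine (Finset.sum_le_sum fun p _ => Finset.sum_le_sum fun q _ =>
    split_ind γ a b t f p q).trans (le_of_eq ?_)
  simp only [Finset.sum_add_distrib]
  have e1 : ∑ p, ∑ q, ∑ u, ind (f u = p) * ind (Rl γ a b t (f u) q ∧ ¬ inr f q) =
      ∑ u, ∑ r, ind (Rl γ a b t (f u) r ∧ ¬ inr f r) := by
    rw [Finset.sum_comm]
    simp_rw [Finset.sum_comm (s := (Finset.univ : Finset V)) (t := (Finset.univ : Finset κ))]
    refine Finset.sum_congr rfl fun u _ => ?_
    refine Finset.sum_congr rfl fun q _ => sum_ind_eq' _ _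
  have e2 : ∑ p, ∑ q, ∑ u, ind (f u = q) * ind (Rl γ a b t (f u) p ∧ ¬ inr f p) =
      ∑ u, ∑ r, ind (Rl γ a b t (f u) r ∧ ¬ inr f r) := by
    rw [Finset.sum_comm]; exact e1
  have e3 : ∑ p : V, ∑ q : V, (∑ u, ind (f u = p)) * ∑ v, ind (f v = q) = (Fintype.card κ : ℝ) ^ 2 := by
    rw [← Finset.sum_mul_sum, Finset.sum_comm]
    simp [sum_ind_eq, sq]
  rw [e1, e2, e3]
  ring

lemma NS_step (γ a b : ℝ) (t : V → ℝ) (B : Set (κ → ℝ)) : NS t B * NP γ a b t ≤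
    NS t (pairS γ a b B) + 2 * (∑ u, NS t (pendS γ a b B u)) + (Fintype.card κ) ^ 2 * NS t B := by
  have : ∑ u, NS t (pendS γ a b B u) =
      ∑ f : κ → V, ind (Function.Injective f ∧ (fun i => t (f i)) ∈ B) *
      ∑ u, ∑ r, ind (Rl γ a b t (f u) r ∧ ¬ inr f r) := by
    simp only [NS_pend]
    rw [Finset.sum_comm]
    simp only [Finset.mul_sum]
  rw [this, NS_pair, NS, Finset.sum_mul, Finset.mul_sum, Finset.mul_sum, ← Finset.sum_add_distrib,
    ← Finset.sum_add_distrib]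
  refine Finset.sum_le_sum fun f _ => ?_
  refine (mul_le_mul_of_nonneg_left (NP_split γ a b t f) (ind_nonneg _)).trans (le_of_eq (by ring))

end CUE

namespace CUE
set_option linter.unusedSectionVars false
variable {κ : Type} [Fintype κ] [DecidableEq κ]
variable {V : Type} [Fintype V]

/-- Stirling combination -/
noncomputable def St (k : ℕ) (T : ℕ → ℝ) : ℝ :=
  ∑ j ∈ Finset.range (k + 1), (Nat.stirlingSecond k j : ℝ) * T j

lemma St_succ (k : ℕ) (T : ℕ → ℝ) : St (k + 1) T =
    ∑ j ∈ Finset.range (k + 1), (Nat.stirlingSecond k j : ℝ) * (T (j + 1) + j * T j) := by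
  rw [St, Finset.sum_range_succ']
  simp only [Nat.stirlingSecond_succ_succ, Nat.stirlingSecond_succ_zero]
  have h : ∑ j ∈ Finset.range (k + 1), ((Nat.stirlingSecond k j : ℝ) * (j * T j)) =
      ∑ j ∈ Finset.range (k + 1), ((Nat.stirlingSecond k (j + 1) : ℝ) * ((j + 1 : ℕ) * T (j + 1))) := by
    have h1 : ∑ j ∈ Finset.range (k + 1), ((Nat.stirlingSecond k j : ℝ) * (j * T j)) =
        ∑ j ∈ Finset.range (k + 1 + 1), ((Nat.stirlingSecond k j : ℝ) * (j * T j)) := by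
      rw [Finset.sum_range_succ _ (k + 1), Nat.stirlingSecond_eq_zero_of_lt (Nat.lt_succ_self k)]
      simp
    rw [h1, Finset.sum_range_succ' _ (k + 1)]
    simp
  simp only [mul_add]
  rw [Finset.sum_add_distrib, h, ← Finset.sum_add_distrib, Nat.cast_zero, zero_mul, add_zero]
  refine Finset.sum_congr rfl fun j _ => ?_
  push_cast
  ring

lemma St_zero (T : ℕ → ℝ) : St 0 T = T 0 := by simp [St]

lemma St_mono (k : ℕ) {T T' : ℕ → ℝ} (h : ∀ j, T j ≤ T' j) : St k T ≤ St k T' :=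
  Finset.sum_le_sum fun j _ => mul_le_mul_of_nonneg_left (h j) (Nat.cast_nonneg _)

/-- the constants -/
noncomputable def cst : ℕ → ℝ
  | 0 => 0
  | k + 1 => cst k + ∑ j ∈ Finset.range (k + 1 + 1), (Nat.stirlingSecond (k + 1) j : ℝ) * j

lemma cst_nonneg (k : ℕ) : 0 ≤ cst k := by
  induction k with
  | zero => exact le_rfl
  | succ k ih => rw [cst]; positivity

lemma St_pow {G : ℝ} {T : ℕ → ℝ} {E : ℝ} (hG : 0 ≤ G) (hE : 0 ≤ E) (h0 : T 0 = 1)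
    (hl : ∀ j, T (j + 1) + j * T j ≤ G * T j)
    (hu : ∀ j, G * T j ≤ T (j + 1) + j * T j + j * (1 + G) ^ (j - 1) * E) (k : ℕ) :
    St (k + 1) T ≤ G ^ (k + 1) ∧ G ^ (k + 1) ≤ St (k + 1) T + cst k * (E * (1 + G) ^ k) := by
  induction k with
  | zero =>
    have a1 := hl 0
    have a2 := hu 0
    rw [St_succ]
    simp [cst, h0] at a1 a2 ⊢
    exact ⟨a1, a2⟩
  | succ k ih =>
    rw [St_succ]
    have e : G * St (k + 1) T = ∑ j ∈ Finset.range (k + 1 + 1),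
        (Nat.stirlingSecond (k + 1) j : ℝ) * (G * T j) := by
      rw [St, Finset.mul_sum]; refine Finset.sum_congr rfl fun j _ => by ring
    constructor
    · calc _ ≤ G * St (k + 1) T := by
            rw [e]
            exact Finset.sum_le_sum fun j _ => mul_le_mul_of_nonneg_left (hl j) (Nat.cast_nonneg _)
        _ ≤ G * G ^ (k + 1) := mul_le_mul_of_nonneg_left ih.1 hG
        _ = _ := by ring
    · have h1 : G * St (k + 1) T ≤ ∑ j ∈ Finset.range (k + 1 + 1),
          ((Nat.stirlingSecond (k + 1) j : ℝ) * (T (j + 1) + j * T j) +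
            (Nat.stirlingSecond (k + 1) j : ℝ) * j * (E * (1 + G) ^ (k + 1))) := by
        rw [e]
        refine Finset.sum_le_sum fun j hj => ?_
        rw [mul_assoc _ (j : ℝ), ← mul_add]
        refine mul_le_mul_of_nonneg_left ((hu j).trans ?_) (Nat.cast_nonneg _)
        have : (1 + G) ^ (j - 1) ≤ (1 + G) ^ (k + 1) :=
          pow_le_pow_right₀ (by linarith) (by have := Finset.mem_range.1 hj; omega)
        have : (j : ℝ) * (1 + G) ^ (j - 1) * E ≤ j * (1 + G) ^ (k + 1) * E := by gcongr
        linarith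
      rw [Finset.sum_add_distrib, ← Finset.sum_mul] at h1
      have h2 : G * (E * (1 + G) ^ k) ≤ E * (1 + G) ^ (k + 1) := by
        rw [pow_succ]
        have : 0 ≤ E * (1 + G) ^ k := by positivity
        nlinarith
      have h3 := mul_le_mul_of_nonneg_left h2 (cst_nonneg k)
      calc G ^ (k + 1 + 1) = G * G ^ (k + 1) := by ring
        _ ≤ G * (St (k + 1) T + cst k * (E * (1 + G) ^ k)) := mul_le_mul_of_nonneg_left ih.2 hG
        _ ≤ _ := by rw [cst]; nlinarith
end CUE

namespace CUE
set_option linter.unusedSectionVars false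
variable {κ : Type} [Fintype κ] [DecidableEq κ]
variable {V : Type} [Fintype V]

/-- number of related pairs meeting the range of `f` -/
noncomputable def mm (γ a b : ℝ) (t : V → ℝ) (f : κ → V) : ℝ :=
  ∑ p, ∑ q, ind (Rl γ a b t p q ∧ (inr f p ∨ inr f q))

lemma NP_mm (γ a b : ℝ) (t : V → ℝ) (f : κ → V) :
    ∑ p, ∑ q, ind (Rl γ a b t p q ∧ ¬ inr f p ∧ ¬ inr f q) = NP γ a b t - mm γ a b t f := by
  rw [NP, mm, ← Finset.sum_sub_distrib]
  refine Finset.sum_congr rfl fun p _ => ?_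
  rw [← Finset.sum_sub_distrib]
  refine Finset.sum_congr rfl fun q _ => ?_
  by_cases h : Rl γ a b t p q <;> by_cases h1 : inr f p <;> by_cases h2 : inr f q <;>
    simp [ind, h, h1, h2]

/-- number of cherries at a pair -/
noncomputable def ecc (γ a b : ℝ) (t : V → ℝ) (p q : V) : ℝ :=
  2 * (∑ r, ind (Rl γ a b t p r ∧ r ≠ q)) + 2 * ∑ r, ind (Rl γ a b t q r ∧ r ≠ p)

/-- total number of cherries -/
noncomputable def EE (γ a b : ℝ) (t : V → ℝ) : ℝ :=
  ∑ p, ∑ q, ind (Rl γ a b t p q) * ecc γ a b t p q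

lemma ecc_nonneg (γ a b : ℝ) (t : V → ℝ) (p q : V) : 0 ≤ ecc γ a b t p q := by
  have := Finset.sum_nonneg (s := Finset.univ) fun r _ => ind_nonneg (Rl γ a b t p r ∧ r ≠ q)
  have := Finset.sum_nonneg (s := Finset.univ) fun r _ => ind_nonneg (Rl γ a b t q r ∧ r ≠ p)
  unfold ecc; positivity

lemma EE_nonneg (γ a b : ℝ) (t : V → ℝ) : 0 ≤ EE γ a b t :=
  Finset.sum_nonneg fun _ _ => Finset.sum_nonneg fun _ _ => mul_nonneg (ind_nonneg _)
    (ecc_nonneg _ _ _ _ _ _)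

lemma inr_elim_two (f : κ → V) (p q r : V) :
    inr (Sum.elim f ![p, q]) r ↔ inr f r ∨ p = r ∨ q = r := by
  constructor
  · rintro ⟨i | i, h⟩
    · exact Or.inl ⟨i, h⟩
    · right
      fin_cases i
      · left; simpa using h
      · right; simpa using h
  · rintro (⟨i, h⟩ | h | h)
    · exact ⟨Sum.inl i, h⟩
    · exact ⟨Sum.inr 0, by simpa using h⟩
    · exact ⟨Sum.inr 1, by simpa using h⟩

lemma ss_eq (x y : V) : ∑ p, ∑ q, ind (x = p) * ind (y = q) = 1 := by
  rw [← Finset.sum_mul_sum, sum_ind_eq, sum_ind_eq, one_mul]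

lemma ss_left (x : V) (g : V → ℝ) : ∑ p, ∑ q, ind (x = p) * g q = ∑ r, g r := by
  rw [← Finset.sum_mul_sum, sum_ind_eq, one_mul]

lemma ss_right (x : V) (g : V → ℝ) : ∑ p, ∑ q, ind (x = q) * g p = ∑ r, g r := by
  rw [Finset.sum_comm, ss_left]

lemma mm_lower {γ a b : ℝ} {t : V → ℝ} {f : κ → V} {p q : V} (hR : Rl γ a b t p q)
    (hp : ¬ inr f p) (hq : ¬ inr f q) :
    mm γ a b t f + 2 ≤ mm γ a b t (Sum.elim f ![p, q]) := by
  have : mm γ a b t f + 2 = ∑ p', ∑ q', (ind (Rl γ a b t p' q' ∧ (inr f p' ∨ inr f q')) +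
      ind (p = p') * ind (q = q') + ind (q = p') * ind (p = q')) := by
    simp only [Finset.sum_add_distrib, ss_eq]
    rw [mm]; ring
  rw [this]
  refine Finset.sum_le_sum fun p' _ => Finset.sum_le_sum fun q' _ => ?_
  simp only [inr_elim_two]
  have hne := hR.1
  by_cases h1 : p = p' ∧ q = q'
  · obtain ⟨rfl, rfl⟩ := h1
    simp [ind, hR, hp, hq, hne.symm]
  by_cases h2 : q = p' ∧ p = q'
  · obtain ⟨rfl, rfl⟩ := h2
    simp [ind, Rl_symm hR, hp, hq, hne]
  rw [← ind_and, ← ind_and, ind_false h1, ind_false h2, add_zero, add_zero]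
  refine ind_le_of (ind_nonneg _) fun h => ?_
  rw [ind_true]
  tauto

lemma ind_mono {p q : Prop} (h : p → q) : ind p ≤ ind q :=
  ind_le_of (ind_nonneg _) fun hp => (ind_true (h hp)).ge

lemma ind_or (p q : Prop) : ind (p ∨ q) ≤ ind p + ind q := by
  by_cases hp : p <;> by_cases hq : q <;> simp [ind, hp, hq]

lemma ind_seven (p1 p2 p3 p4 p5 p6 p7 : Prop) : ind (p1 ∨ p2 ∨ p3 ∨ p4 ∨ p5 ∨ p6 ∨ p7) ≤
    ind p1 + ind p2 + ind p3 + ind p4 + ind p5 + ind p6 + ind p7 := by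
  have h1 := ind_or p1 (p2 ∨ p3 ∨ p4 ∨ p5 ∨ p6 ∨ p7)
  have h2 := ind_or p2 (p3 ∨ p4 ∨ p5 ∨ p6 ∨ p7)
  have h3 := ind_or p3 (p4 ∨ p5 ∨ p6 ∨ p7)
  have h4 := ind_or p4 (p5 ∨ p6 ∨ p7)
  have h5 := ind_or p5 (p6 ∨ p7)
  have h6 := ind_or p6 p7
  linarith

lemma mm_upper {γ a b : ℝ} {t : V → ℝ} {f : κ → V} {p q : V} :
    mm γ a b t (Sum.elim f ![p, q]) ≤ mm γ a b t f + 2 + ecc γ a b t p q := by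
  have : mm γ a b t f + 2 + ecc γ a b t p q =
      ∑ p', ∑ q', (ind (Rl γ a b t p' q' ∧ (inr f p' ∨ inr f q')) +
      ind (p = p') * ind (q = q') + ind (q = p') * ind (p = q') +
      ind (p = p') * ind (Rl γ a b t p q' ∧ q' ≠ q) + ind (p = q') * ind (Rl γ a b t p p' ∧ p' ≠ q) +
      ind (q = p') * ind (Rl γ a b t q q' ∧ q' ≠ p) +
      ind (q = q') * ind (Rl γ a b t q p' ∧ p' ≠ p)) := by
    simp only [Finset.sum_add_distrib, ss_eq]
    rw [ss_left p fun q' => ind (Rl γ a b t p q' ∧ q' ≠ q),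
      ss_right p fun q' => ind (Rl γ a b t p q' ∧ q' ≠ q),
      ss_left q fun q' => ind (Rl γ a b t q q' ∧ q' ≠ p),
      ss_right q fun q' => ind (Rl γ a b t q q' ∧ q' ≠ p), mm, ecc]
    ring
  rw [this, mm]
  refine Finset.sum_le_sum fun p' _ => Finset.sum_le_sum fun q' _ => ?_
  simp only [inr_elim_two, ← ind_and]
  refine le_trans (ind_mono ?_) (ind_seven _ _ _ _ _ _ _)
  rintro ⟨hR, (h | rfl | rfl) | h | rfl | rfl⟩
  · exact Or.inl ⟨hR, Or.inl h⟩
  · by_cases hq : q' = q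
    · exact Or.inr (Or.inl ⟨rfl, hq.symm⟩)
    · exact Or.inr (Or.inr (Or.inr (Or.inl ⟨rfl, hR, hq⟩)))
  · by_cases hq : q' = p
    · exact Or.inr (Or.inr (Or.inl ⟨rfl, hq.symm⟩))
    · exact Or.inr (Or.inr (Or.inr (Or.inr (Or.inr (Or.inl ⟨rfl, hR, hq⟩)))))
  · exact Or.inl ⟨hR, Or.inr h⟩
  · by_cases hq : p' = q
    · exact Or.inr (Or.inr (Or.inl ⟨hq.symm, rfl⟩))
    · exact Or.inr (Or.inr (Or.inr (Or.inr (Or.inl ⟨rfl, Rl_symm hR, hq⟩))))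
  · by_cases hq : p' = p
    · exact Or.inr (Or.inl ⟨hq.symm, rfl⟩)
    · exact Or.inr (Or.inr (Or.inr (Or.inr (Or.inr (Or.inr ⟨rfl, Rl_symm hR, hq⟩)))))

/-- defect -/
noncomputable def DD (γ a b : ℝ) (t : V → ℝ) (B : Set (κ → ℝ)) (c : ℝ) : ℝ :=
  NS t B * NP γ a b t - NS t (pairS γ a b B) - c * NS t B

/-- all configurations in `B` are met by at least `c` pairs -/
def Lb (γ a b : ℝ) (t : V → ℝ) (B : Set (κ → ℝ)) (c : ℝ) : Prop :=
  ∀ f : κ → V, Function.Injective f → (fun i => t (f i)) ∈ B → c ≤ mm γ a b t f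

lemma DD_eq (γ a b : ℝ) (t : V → ℝ) (B : Set (κ → ℝ)) (c : ℝ) : DD γ a b t B c =
    ∑ f : κ → V, ind (Function.Injective f ∧ (fun i => t (f i)) ∈ B) * (mm γ a b t f - c) := by
  rw [DD, NS_pair, NS, Finset.sum_mul, Finset.mul_sum, ← Finset.sum_sub_distrib,
    ← Finset.sum_sub_distrib]
  refine Finset.sum_congr rfl fun f _ => ?_
  rw [NP_mm]; ring

lemma DD_nonneg {γ a b : ℝ} {t : V → ℝ} {B : Set (κ → ℝ)} {c : ℝ} (h : Lb γ a b t B c) :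
    0 ≤ DD γ a b t B c := by
  rw [DD_eq]
  refine Finset.sum_nonneg fun f _ => ?_
  by_cases hf : Function.Injective f ∧ (fun i => t (f i)) ∈ B
  · exact mul_nonneg (ind_nonneg _) (by linarith [h f hf.1 hf.2])
  · rw [ind_false hf, zero_mul]

lemma Lb_pair {γ a b : ℝ} {t : V → ℝ} {B : Set (κ → ℝ)} {c : ℝ} (h : Lb γ a b t B c) :
    Lb γ a b t (pairS γ a b B) (c + 2) := by
  intro f hf hB
  have e : f = Sum.elim (fun i => f (Sum.inl i)) ![f (Sum.inr 0), f (Sum.inr 1)] := by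
    ext i
    rcases i with i | i
    · rfl
    · fin_cases i <;> rfl
  have h1 := h (fun i => f (Sum.inl i)) (hf.comp Sum.inl_injective) hB.1
  rw [e] at hf ⊢
  rw [inj_elim_two] at hf
  have := mm_lower (γ := γ) (a := a) (b := b) (t := t) ⟨hf.2.1, hB.2⟩ hf.2.2.1 hf.2.2.2
  linarith

lemma DD_pair {γ a b : ℝ} {t : V → ℝ} {B : Set (κ → ℝ)} {c : ℝ} (h : Lb γ a b t B c) :
    DD γ a b t (pairS γ a b B) (c + 2) ≤ DD γ a b t B c * NP γ a b t + NS t B * EE γ a b t := by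
  rw [DD_eq, DD_eq, sum_split, NS, Finset.sum_mul, Finset.sum_mul, ← Finset.sum_add_distrib]
  refine Finset.sum_le_sum fun f _ => ?_
  rw [sum_two]
  by_cases hf : Function.Injective f ∧ (fun i => t (f i)) ∈ B
  · have hm := h f hf.1 hf.2
    rw [ind_true hf, one_mul, one_mul, NP, EE, Finset.mul_sum, ← Finset.sum_add_distrib]
    refine Finset.sum_le_sum fun p _ => ?_
    rw [Finset.mul_sum, ← Finset.sum_add_distrib]
    refine Finset.sum_le_sum fun q _ => ?_
    have hu := mm_upper (γ := γ) (a := a) (b := b) (t := t) (f := f) (p := p) (q := q)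
    have hecc := ecc_nonneg γ a b t p q
    by_cases hz : Function.Injective (Sum.elim f ![p, q]) ∧
        (fun i => t (Sum.elim f ![p, q] i)) ∈ pairS γ a b B
    · have hR : Rl γ a b t p q := ⟨((inj_elim_two f p q).1 hz.1).2.1, hz.2.2⟩
      rw [ind_true hz, ind_true hR]
      linarith
    · rw [ind_false hz, zero_mul]
      have := ind_nonneg (Rl γ a b t p q)
      have h2 : 0 ≤ mm γ a b t f - c := by linarith
      exact add_nonneg (mul_nonneg h2 this) (mul_nonneg this hecc)
  · have : ∀ p q, ¬ (Function.Injective (Sum.elim f ![p, q]) ∧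
        (fun i => t (Sum.elim f ![p, q] i)) ∈ pairS γ a b B) := fun p q hz =>
      hf ⟨((inj_elim_two f p q).1 hz.1).1, hz.2.1⟩
    simp only [ind_false (this _ _), ind_false hf, zero_mul, Finset.sum_const_zero, add_zero, le_refl]

lemma sum_emp (F : (Empty → V) → ℝ) : ∑ f, F f = F default := Fintype.sum_unique F

lemma EE_eq (γ a b : ℝ) (t : V → ℝ) : EE γ a b t =
    2 * NS t (pendS γ a b (pairS γ a b (Set.univ : Set (Empty → ℝ))) (Sum.inr 0)) +
    2 * NS t (pendS γ a b (pairS γ a b (Set.univ : Set (Empty → ℝ))) (Sum.inr 1)) := by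
  rw [NS_pend, NS_pend, sum_split, sum_split, sum_emp, sum_emp, sum_two, sum_two,
    EE, Finset.mul_sum, Finset.mul_sum, ← Finset.sum_add_distrib]
  refine Finset.sum_congr rfl fun p _ => ?_
  rw [Finset.mul_sum, Finset.mul_sum, ← Finset.sum_add_distrib]
  refine Finset.sum_congr rfl fun q _ => ?_
  have h0 : ∀ r, ¬ inr (default : Empty → V) r := fun r ⟨i, _⟩ => i.elim
  have h1 : (Function.Injective (Sum.elim (default : Empty → V) ![p, q]) ∧
      (fun i => t (Sum.elim (default : Empty → V) ![p, q] i)) ∈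
        pairS γ a b (Set.univ : Set (Empty → ℝ))) ↔ Rl γ a b t p q := by
    rw [inj_elim_two]
    constructor
    · intro h; exact ⟨h.1.2.1, h.2.2⟩
    · intro h; exact ⟨⟨fun i => i.elim, h.1, h0 _, h0 _⟩, trivial, h.2⟩
  rw [ind_congr h1, ecc]
  simp only [inr_elim_two, h0, false_or]
  have e1 : ∀ r, ind (Rl γ a b t (Sum.elim (default : Empty → V) ![p, q] (Sum.inr 0)) r ∧
      ¬ (p = r ∨ q = r)) = ind (Rl γ a b t p r ∧ r ≠ q) := fun r => ind_congr
    ⟨fun h => ⟨h.1, fun e => h.2 (Or.inr e.symm)⟩, fun h => ⟨h.1, fun e => e.elim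
      (fun e => h.1.1 e) (fun e => h.2 e.symm)⟩⟩
  have e2 : ∀ r, ind (Rl γ a b t (Sum.elim (default : Empty → V) ![p, q] (Sum.inr 1)) r ∧
      ¬ (p = r ∨ q = r)) = ind (Rl γ a b t q r ∧ r ≠ p) := fun r => ind_congr
    ⟨fun h => ⟨h.1, fun e => h.2 (Or.inl e.symm)⟩, fun h => ⟨h.1, fun e => e.elim
      (fun e => h.2 e.symm) (fun e => h.1.1 e)⟩⟩
  simp only [e1, e2]
  ring

end CUE

namespace CUE
set_option linter.unusedSectionVars false
variable {V : Type} [Fintype V]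

/-- index types for iterated pairs -/
def KK : ℕ → Type
  | 0 => Empty
  | j + 1 => KK j ⊕ Fin 2

noncomputable instance KKft : ∀ j, Fintype (KK j)
  | 0 => inferInstanceAs (Fintype Empty)
  | j + 1 => @instFintypeSum (KK j) (Fin 2) (KKft j) _

noncomputable instance KKde : ∀ j, DecidableEq (KK j)
  | 0 => inferInstanceAs (DecidableEq Empty)
  | j + 1 => @instDecidableEqSum (KK j) (Fin 2) (KKde j) _

/-- iterated pairs -/
def AA (γ a b : ℝ) : ∀ j, Set (KK j → ℝ)
  | 0 => Set.univ
  | j + 1 => pairS γ a b (AA γ a b j)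

lemma card_KK (j : ℕ) : Fintype.card (KK j) = 2 * j := by
  induction j with
  | zero => rfl
  | succ j ih =>
    have : Fintype.card (KK (j + 1)) = Fintype.card (KK j ⊕ Fin 2) := rfl
    rw [this, Fintype.card_sum, ih, Fintype.card_fin]; ring

lemma meas_AA (γ a b : ℝ) (j : ℕ) : MeasurableSet (AA γ a b j) := by
  induction j with
  | zero => exact MeasurableSet.univ
  | succ j ih => exact meas_pairS γ a b ih

/-- counts of disjoint pairs -/
noncomputable def NA (γ a b : ℝ) (t : V → ℝ) (j : ℕ) : ℝ := NS t (AA γ a b j)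

lemma NA_succ (γ a b : ℝ) (t : V → ℝ) (j : ℕ) :
    NA γ a b t (j + 1) = NS t (pairS γ a b (AA γ a b j)) := rfl

lemma NA_zero (γ a b : ℝ) (t : V → ℝ) : NA γ a b t 0 = 1 := by
  have : NA γ a b t 0 = NS t (Set.univ : Set (Empty → ℝ)) := rfl
  rw [this, NS, sum_emp, ind_true]
  exact ⟨fun i => i.elim, trivial⟩

lemma NA_nonneg (γ a b : ℝ) (t : V → ℝ) (j : ℕ) : 0 ≤ NA γ a b t j := NS_nonneg _ _

lemma Lb_AA (γ a b : ℝ) (t : V → ℝ) (j : ℕ) : Lb γ a b t (AA γ a b j) (2 * j) := by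
  induction j with
  | zero =>
    intro f _ _
    rw [Nat.cast_zero, mul_zero]
    exact Finset.sum_nonneg fun _ _ => Finset.sum_nonneg fun _ _ => ind_nonneg _
  | succ j ih =>
    have := Lb_pair ih
    push_cast
    rw [mul_add, mul_one]
    exact this

/-- the defects -/
noncomputable def DA (γ a b : ℝ) (t : V → ℝ) (j : ℕ) : ℝ := DD γ a b t (AA γ a b j) (2 * j)

lemma DA_eq (γ a b : ℝ) (t : V → ℝ) (j : ℕ) :
    DA γ a b t j = NA γ a b t j * NP γ a b t - NA γ a b t (j + 1) - 2 * j * NA γ a b t j := rfl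

lemma DA_nonneg (γ a b : ℝ) (t : V → ℝ) (j : ℕ) : 0 ≤ DA γ a b t j := DD_nonneg (Lb_AA γ a b t j)

lemma DA_zero (γ a b : ℝ) (t : V → ℝ) : DA γ a b t 0 = 0 := by
  have : DA γ a b t 0 = DD γ a b t (Set.univ : Set (Empty → ℝ)) (2 * (0 : ℕ)) := rfl
  rw [this, DD_eq, sum_emp]
  have : mm γ a b t (default : Empty → V) = 0 := by
    refine Finset.sum_eq_zero fun p _ => Finset.sum_eq_zero fun q _ => ind_false ?_
    rintro ⟨_, ⟨i, _⟩ | ⟨i, _⟩⟩ <;> exact i.elim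
  rw [this]; simp

lemma DA_succ (γ a b : ℝ) (t : V → ℝ) (j : ℕ) :
    DA γ a b t (j + 1) ≤ DA γ a b t j * NP γ a b t + NA γ a b t j * EE γ a b t := by
  have := DD_pair (Lb_AA γ a b t j)
  have e : (2 * (j : ℝ) + 2) = 2 * ((j + 1 : ℕ) : ℝ) := by push_cast; ring
  rw [e] at this
  exact this

lemma NA_le (γ a b : ℝ) (t : V → ℝ) (j : ℕ) : NA γ a b t j ≤ NP γ a b t ^ j := by
  induction j with
  | zero => rw [NA_zero, pow_zero]
  | succ j ih =>
    have h1 := DA_nonneg γ a b t j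
    rw [DA_eq] at h1
    have h2 := NA_nonneg γ a b t j
    have h3 : (0:ℝ) ≤ 2 * j * NA γ a b t j := by positivity
    calc NA γ a b t (j + 1) ≤ NA γ a b t j * NP γ a b t := by linarith
      _ ≤ NP γ a b t ^ j * NP γ a b t := mul_le_mul_of_nonneg_right ih (NP_nonneg _ _ _ _)
      _ = _ := (pow_succ _ _).symm

lemma DA_le (γ a b : ℝ) (t : V → ℝ) (j : ℕ) :
    DA γ a b t j ≤ j * NP γ a b t ^ (j - 1) * EE γ a b t := by
  induction j with
  | zero => rw [DA_zero]; simp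
  | succ j ih =>
    have hE := EE_nonneg γ a b t
    have hN := NP_nonneg γ a b t
    have h1 := mul_le_mul_of_nonneg_right ih hN
    have h2 := mul_le_mul_of_nonneg_right (NA_le γ a b t j) hE
    have h3 : (j : ℝ) * NP γ a b t ^ (j - 1) * EE γ a b t * NP γ a b t =
        j * NP γ a b t ^ j * EE γ a b t := by
      rcases j with _ | j
      · simp
      · rw [Nat.add_sub_cancel, pow_succ]; ring
    have := DA_succ γ a b t j
    rw [Nat.add_sub_cancel]
    push_cast
    linarith

/-- number of unordered pairs -/
noncomputable def GG (γ a b : ℝ) (t : V → ℝ) : ℝ := NP γ a b t / 2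

lemma GG_nonneg (γ a b : ℝ) (t : V → ℝ) : 0 ≤ GG γ a b t := div_nonneg (NP_nonneg _ _ _ _) (by norm_num)

lemma GG_pow (γ a b : ℝ) (t : V → ℝ) (k : ℕ) :
    St (k + 1) (fun j => NA γ a b t j / 2 ^ j) ≤ GG γ a b t ^ (k + 1) ∧
    GG γ a b t ^ (k + 1) ≤ St (k + 1) (fun j => NA γ a b t j / 2 ^ j) +
      cst k * (EE γ a b t * (1 + GG γ a b t) ^ k) := by
  have hG := GG_nonneg γ a b t
  have hE := EE_nonneg γ a b t
  have key : ∀ j, GG γ a b t * (NA γ a b t j / 2 ^ j) =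
      NA γ a b t (j + 1) / 2 ^ (j + 1) + j * (NA γ a b t j / 2 ^ j) + DA γ a b t j / 2 ^ (j + 1) := by
    intro j
    rw [DA_eq, GG]
    field_simp
    ring
  refine St_pow hG hE (by rw [NA_zero]; simp) (fun j => ?_) (fun j => ?_) k
  · rw [key]
    have := DA_nonneg γ a b t j
    have : 0 ≤ DA γ a b t j / 2 ^ (j + 1) := by positivity
    linarith
  · rw [key]
    have h1 := DA_le γ a b t j
    have e : NP γ a b t = 2 * GG γ a b t := by rw [GG]; ring
    have h2 : DA γ a b t j / 2 ^ (j + 1) ≤ j * (1 + GG γ a b t) ^ (j - 1) * EE γ a b t := by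
      rw [div_le_iff₀ (by positivity)]
      refine h1.trans ?_
      rw [e, mul_pow]
      have a1 : GG γ a b t ^ (j - 1) ≤ (1 + GG γ a b t) ^ (j - 1) := by gcongr; linarith
      have a2 : (2:ℝ) ^ (j - 1) ≤ 2 ^ (j + 1) := pow_le_pow_right₀ (by norm_num) (by omega)
      calc (j:ℝ) * (2 ^ (j - 1) * GG γ a b t ^ (j - 1)) * EE γ a b t
          ≤ j * (2 ^ (j + 1) * (1 + GG γ a b t) ^ (j - 1)) * EE γ a b t := by gcongr
        _ = _ := by ring
    linarith

/-- link with the count in the statement -/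
lemma GG_card {n : ℕ} (γ a b : ℝ) (t : Fin n → ℝ) :
    ((Nat.card {p : Fin n × Fin n // p.1 < p.2 ∧ |t p.1 - t p.2| < γ ∧
      (t p.1 + t p.2) / 2 ∈ Set.Ico a b} : ℕ) : ℝ) = GG γ a b t := by
  classical
  have h1 : ((Nat.card {p : Fin n × Fin n // p.1 < p.2 ∧ |t p.1 - t p.2| < γ ∧
      (t p.1 + t p.2) / 2 ∈ Set.Ico a b} : ℕ) : ℝ) =
      ∑ p, ∑ q, ind (p < q ∧ (t p, t q) ∈ gd γ a b) := by
    rw [Nat.card_eq_fintype_card, Fintype.card_subtype, Finset.card_filter]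
    push_cast
    rw [Fintype.sum_prod_type]
    refine Finset.sum_congr rfl fun p _ => Finset.sum_congr rfl fun q _ => ?_
    by_cases h : p < q ∧ |t p - t q| < γ ∧ (t p + t q) / 2 ∈ Set.Ico a b
    · rw [if_pos h]
      exact (ind_true h).symm
    · rw [if_neg h]
      exact (ind_false h).symm
  have h2 : NP γ a b t = ∑ p, ∑ q, ind (p < q ∧ (t p, t q) ∈ gd γ a b) +
      ∑ p, ∑ q, ind (q < p ∧ (t q, t p) ∈ gd γ a b) := by
    rw [NP, ← Finset.sum_add_distrib]
    refine Finset.sum_congr rfl fun p _ => ?_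
    rw [← Finset.sum_add_distrib]
    refine Finset.sum_congr rfl fun q _ => ?_
    rw [Rl, ← gd_symm (γ := γ) (a := a) (b := b)]
    rcases lt_trichotomy p q with h | h | h
    · simp [ind, h.ne, h, h.not_gt]
    · simp [ind, h]
    · simp [ind, h.ne', h, h.not_gt]
  rw [h1, GG, h2, Finset.sum_comm (f := fun p q => ind (q < p ∧ (t q, t p) ∈ gd γ a b))]
  ring
end CUE

namespace CUE
set_option linter.unusedSectionVars false
variable {n : ℕ}
variable {κ : Type} [Fintype κ] [DecidableEq κ]

lemma NS_card (t : Fin n → ℝ) (B : Set (κ → ℝ)) :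
    NS t B = (Nat.card {ι : κ ↪ Fin n // t ∘ ι ∈ B} : ℝ) := by
  classical
  have e : {f : κ → Fin n // Function.Injective f ∧ (fun i => t (f i)) ∈ B} ≃
      {ι : κ ↪ Fin n // t ∘ ι ∈ B} :=
    { toFun := fun f => ⟨⟨f.1, f.2.1⟩, f.2.2⟩
      invFun := fun f => ⟨f.1, f.1.injective, f.2⟩
      left_inv := fun _ => rfl
      right_inv := fun _ => rfl }
  rw [← Nat.card_congr e, Nat.card_eq_fintype_card, Fintype.card_subtype, Finset.card_filter, NS]
  push_cast
  refine Finset.sum_congr rfl fun f _ => ?_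
  by_cases h : Function.Injective f ∧ (fun i => t (f i)) ∈ B
  · rw [if_pos h, ind_true h]
  · rw [if_neg h, ind_false h]

lemma NS_le (t : Fin n → ℝ) (B : Set (κ → ℝ)) : NS t B ≤ n ^ Fintype.card κ := by
  refine (Finset.sum_le_sum fun f _ => ind_le_one _).trans ?_
  simp

lemma meas_NS {θ : UG n → Fin n → ℝ} (hθ : IsAng θ)
    (hθm : ∀ U j, θ U j ∈ Set.Ico (0:ℝ) (2 * π))
    (μ : Measure (UG n)) [IsProbabilityMeasure μ] [μ.IsMulLeftInvariant]
    {B : Set (κ → ℝ)} (hB : MeasurableSet B) : Measurable fun U => NS (θ U) B := by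
  have := (corr_identity hθ hθm μ hB).1.ennreal_toReal
  simpa [NS_card] using this

lemma int_NS {θ : UG n → Fin n → ℝ} (hθ : IsAng θ)
    (hθm : ∀ U j, θ U j ∈ Set.Ico (0:ℝ) (2 * π))
    (μ : Measure (UG n)) [IsProbabilityMeasure μ] [μ.IsMulLeftInvariant]
    {B : Set (κ → ℝ)} (hB : MeasurableSet B) : ∫ U, NS (θ U) B ∂μ = IS n B := by
  have h := (corr_identity hθ hθm μ hB).2
  rw [integral_eq_lintegral_of_nonneg_ae (ae_of_all _ fun U => NS_nonneg _ _)
    (meas_NS hθ hθm μ hB).aestronglyMeasurable, IS,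
    integral_eq_lintegral_of_nonneg_ae (ae_of_all _ fun z => indc_nonneg B z)
    (indc_meas hB).aestronglyMeasurable]
  congr 1
  have e1 : ∀ U, ENNReal.ofReal (NS (θ U) B) =
      (Nat.card {ι : κ ↪ Fin n // θ U ∘ ι ∈ B} : ENNReal) := fun U => by
    rw [NS_card, ENNReal.ofReal_natCast]
  simp only [e1]
  rw [h, ← lintegral_indicator hB]
  refine lintegral_congr fun z => ?_
  by_cases hz : z ∈ B
  · rw [Set.indicator_of_mem hz, Set.indicator_of_mem hz]
  · rw [Set.indicator_of_notMem hz, Set.indicator_of_notMem hz, ENNReal.ofReal_zero]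

lemma NP_eq (γ a b : ℝ) {V : Type} [Fintype V] (t : V → ℝ) :
    NP γ a b t = NS t (pairS γ a b (Set.univ : Set (Empty → ℝ))) := by
  rw [NS_pair, sum_emp, NP_mm, ind_true ⟨fun i => i.elim, trivial⟩, one_mul]
  have : mm γ a b t (default : Empty → V) = 0 := by
    refine Finset.sum_eq_zero fun p _ => Finset.sum_eq_zero fun q _ => ind_false ?_
    rintro ⟨_, ⟨i, _⟩ | ⟨i, _⟩⟩ <;> exact i.elim
  rw [this, sub_zero]

lemma NP_le (γ a b : ℝ) (t : Fin n → ℝ) : NP γ a b t ≤ n ^ 2 := by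
  rw [NP_eq]
  exact NS_le _ _

lemma meas_NP {θ : UG n → Fin n → ℝ} (hθ : IsAng θ)
    (hθm : ∀ U j, θ U j ∈ Set.Ico (0:ℝ) (2 * π))
    (μ : Measure (UG n)) [IsProbabilityMeasure μ] [μ.IsMulLeftInvariant]
    (γ a b : ℝ) : Measurable fun U => NP γ a b (θ U) := by
  simp only [NP_eq]
  exact meas_NS hθ hθm μ (meas_pairS γ a b MeasurableSet.univ)

lemma integrable_NSNP {θ : UG n → Fin n → ℝ} (hθ : IsAng θ)
    (hθm : ∀ U j, θ U j ∈ Set.Ico (0:ℝ) (2 * π))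
    (μ : Measure (UG n)) [IsProbabilityMeasure μ] [μ.IsMulLeftInvariant]
    (γ a b : ℝ) (q : ℕ) {B : Set (κ → ℝ)} (hB : MeasurableSet B) :
    Integrable (fun U => NS (θ U) B * NP γ a b (θ U) ^ q) μ := by
  refine bdd_integrable ((meas_NS hθ hθm μ hB).mul ((meas_NP hθ hθm μ γ a b).pow_const q))
    (n ^ Fintype.card κ * ((n:ℝ) ^ 2) ^ q) fun U => ?_
  have h1 := NS_nonneg (θ U) B
  have h2 := NP_nonneg γ a b (θ U)
  rw [abs_of_nonneg (by positivity)]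
  have h3 := NS_le (θ U) B
  have h4 := NP_le γ a b (θ U)
  gcongr

lemma step_NSNP {θ : UG n → Fin n → ℝ} (hθ : IsAng θ)
    (hθm : ∀ U j, θ U j ∈ Set.Ico (0:ℝ) (2 * π))
    (μ : Measure (UG n)) [IsProbabilityMeasure μ] [μ.IsMulLeftInvariant]
    (γ a b : ℝ) (q : ℕ) {B : Set (κ → ℝ)} (hB : MeasurableSet B) :
    ∫ U, NS (θ U) B * NP γ a b (θ U) ^ (q + 1) ∂μ ≤
      (∫ U, NS (θ U) (pairS γ a b B) * NP γ a b (θ U) ^ q ∂μ) +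
      2 * (∑ u, ∫ U, NS (θ U) (pendS γ a b B u) * NP γ a b (θ U) ^ q ∂μ) +
      (Fintype.card κ) ^ 2 * ∫ U, NS (θ U) B * NP γ a b (θ U) ^ q ∂μ := by
  have i1 := integrable_NSNP hθ hθm μ γ a b q (meas_pairS γ a b hB)
  have i2 := fun u => integrable_NSNP hθ hθm μ γ a b q (meas_pendS γ a b hB u)
  have i3 := integrable_NSNP hθ hθm μ γ a b q hB
  have i4 : Integrable (fun U => ∑ u, NS (θ U) (pendS γ a b B u) * NP γ a b (θ U) ^ q) μ :=
    integrable_finsetSum _ fun u _ => i2 u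
  have i5 : Integrable (fun U => NS (θ U) (pairS γ a b B) * NP γ a b (θ U) ^ q +
      2 * ∑ u, NS (θ U) (pendS γ a b B u) * NP γ a b (θ U) ^ q) μ := i1.add (i4.const_mul 2)
  have i6 : Integrable (fun U => ((Fintype.card κ : ℕ) : ℝ) ^ 2 *
      (NS (θ U) B * NP γ a b (θ U) ^ q)) μ := i3.const_mul _
  rw [← integral_finsetSum _ fun u _ => i2 u, ← integral_const_mul, ← integral_const_mul,
    ← integral_add i1 (i4.const_mul 2), ← integral_add i5 i6]
  refine integral_mono (integrable_NSNP hθ hθm μ γ a b (q + 1) hB) (i5.add i6) fun U => ?_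
  have h := mul_le_mul_of_nonneg_right (NS_step γ a b (θ U) B)
    (pow_nonneg (NP_nonneg γ a b (θ U)) q)
  simp only [← Finset.sum_mul]
  calc _ = NS (θ U) B * NP γ a b (θ U) * NP γ a b (θ U) ^ q := by rw [pow_succ]; ring
    _ ≤ _ := h
    _ = _ := by ring

/-- pair factor -/
noncomputable def K1 (n : ℕ) (γ a b : ℝ) : ℝ := n * (n * min 4 ((n * γ) ^ 2)) * ((b - a) * γ / (2 * π ^ 2))
/-- pendant factor -/
noncomputable def K2 (n : ℕ) (γ a b : ℝ) : ℝ := n * min 4 ((n * γ) ^ 2) * (min γ (b - a) / π)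

lemma K1_le {γ a b : ℝ} (hγ : 0 ≤ γ) (hab : a ≤ b) : K1 n γ a b ≤ 72 * muP n γ a b := by
  have h : 0 ≤ b - a := by linarith
  calc K1 n γ a b ≤ n * (n * ((n * γ) ^ 2)) * ((b - a) * γ / (2 * π ^ 2)) := by
        unfold K1; gcongr; exact min_le_right _ _
    _ = _ := by unfold muP; field_simp; ring

lemma muP_nonneg {γ a b : ℝ} (hγ : 0 ≤ γ) (hab : a ≤ b) : 0 ≤ muP n γ a b := by
  have h : 0 ≤ b - a := by linarith
  unfold muP; positivity

lemma K2_nonneg {γ a b : ℝ} (hγ : 0 ≤ γ) (hab : a ≤ b) : 0 ≤ K2 n γ a b := by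
  have h : 0 ≤ b - a := by linarith
  unfold K2; positivity

lemma K2_le_cube {γ a b : ℝ} (hγ : 0 ≤ γ) (hab : a ≤ b) : K2 n γ a b ≤ (n * γ) ^ 3 := by
  have h : 0 ≤ b - a := by linarith
  calc K2 n γ a b ≤ n * ((n * γ) ^ 2) * (γ / 1) := by
        unfold K2; gcongr
        · exact min_le_right _ _
        · exact min_le_left _ _
        · linarith [Real.pi_gt_three]
    _ = _ := by ring

lemma K2_le {γ a b : ℝ} (hγ : 0 ≤ γ) (hab : a ≤ b) : K2 n γ a b ≤ 2000 * (1 + muP n γ a b) := by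
  have h : 0 ≤ b - a := by linarith
  have hM := muP_nonneg (n := n) hγ hab
  by_cases hx : n * γ ≤ 1
  · have := K2_le_cube (n := n) hγ hab
    have h3 : (n * γ) ^ 3 ≤ 1 := pow_le_one₀ (by positivity) hx
    linarith
  · push Not at hx
    have h3 : 1 ≤ (n * γ) ^ 3 := one_le_pow₀ hx.le
    have h1 : K2 n γ a b ≤ n * 4 * ((b - a) / π) := by
      unfold K2; gcongr
      · exact min_le_left _ _
      · exact min_le_right _ _
    have h2 : n * 4 * ((b - a) / π) * 1 ≤ n * 4 * ((b - a) / π) * (n * γ) ^ 3 := by gcongr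
    have h4 : n * 4 * ((b - a) / π) * (n * γ) ^ 3 = 576 * π * muP n γ a b := by
      unfold muP; field_simp; ring
    have : π ≤ 3.15 := Real.pi_lt_d2.le
    nlinarith

lemma EN (q : ℕ) : ∀ d : ℕ, ∃ C : ℝ, 0 ≤ C ∧ ∀ (n : ℕ) (θ : UG n → Fin n → ℝ) (_ : IsAng θ)
    (_ : ∀ U j, θ U j ∈ Set.Ico (0:ℝ) (2 * π))
    (μ : Measure (UG n)) [IsProbabilityMeasure μ] [μ.IsMulLeftInvariant] (γ a b : ℝ) (_ : 0 ≤ γ)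
    (_ : a ≤ b) (κ : Type) [Fintype κ] [DecidableEq κ] (_ : Fintype.card κ = d) (B : Set (κ → ℝ))
    (_ : MeasurableSet B),
    ∫ U, NS (θ U) B * NP γ a b (θ U) ^ q ∂μ ≤ C * (1 + muP n γ a b) ^ q * IS n B := by
  induction q with
  | zero =>
    intro d
    refine ⟨1, zero_le_one, ?_⟩
    intro n θ hθ hθm μ _ _ γ a b hγ hab κ _ _ hd B hB
    simp only [pow_zero, mul_one, one_mul]
    exact (int_NS hθ hθm μ hB).le
  | succ q ih =>
    intro d
    obtain ⟨C2, h20, h2⟩ := ih (d + 2)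
    obtain ⟨C1, h10, h1⟩ := ih (d + 1)
    obtain ⟨C0, h00, h0⟩ := ih d
    refine ⟨72 * C2 + 4000 * d * C1 + d ^ 2 * C0, by positivity, ?_⟩
    intro n θ hθ hθm μ _ _ γ a b hγ hab κ _ _ hd B hB
    have hM := muP_nonneg (n := n) hγ hab
    set M := muP n γ a b with hMd
    have hI := IS_nonneg (n := n) B
    have s := step_NSNP hθ hθm μ γ a b q hB
    have s2 := h2 n θ hθ hθm μ γ a b hγ hab (κ ⊕ Fin 2) (by simp [hd]) _ (meas_pairS γ a b hB)
    have s1 := fun u => h1 n θ hθ hθm μ γ a b hγ hab (κ ⊕ Unit) (by simp [hd]) _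
      (meas_pendS γ a b hB u)
    have s0 := h0 n θ hθ hθm μ γ a b hγ hab κ hd B hB
    have p2 : IS n (pairS γ a b B) ≤ IS n B * (72 * (1 + M)) :=
      (IS_pair hγ hab hB).trans (mul_le_mul_of_nonneg_left
        ((K1_le hγ hab).trans (by linarith)) hI)
    have p1 : ∀ u, IS n (pendS γ a b B u) ≤ IS n B * (2000 * (1 + M)) := fun u =>
      (IS_pend hγ hab hB u).trans (mul_le_mul_of_nonneg_left (K2_le hγ hab) hI)
    have P : 0 ≤ (1 + M) ^ q := by positivity
    have t2 : ∫ U, NS (θ U) (pairS γ a b B) * NP γ a b (θ U) ^ q ∂μ ≤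
        C2 * (1 + M) ^ q * (IS n B * (72 * (1 + M))) := s2.trans (by gcongr)
    have t1 : ∑ u, ∫ U, NS (θ U) (pendS γ a b B u) * NP γ a b (θ U) ^ q ∂μ ≤
        d * (C1 * (1 + M) ^ q * (IS n B * (2000 * (1 + M)))) := by
      refine (Finset.sum_le_sum fun u _ => (s1 u).trans
        (mul_le_mul_of_nonneg_left (p1 u) (mul_nonneg h10 P))).trans (le_of_eq ?_)
      rw [Finset.sum_const, Finset.card_univ, hd, nsmul_eq_mul]
    have t0 : ((Fintype.card κ : ℕ) : ℝ) ^ 2 * ∫ U, NS (θ U) B * NP γ a b (θ U) ^ q ∂μ ≤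
        d ^ 2 * (C0 * (1 + M) ^ q * IS n B * (1 + M)) := by
      rw [hd]
      refine mul_le_mul_of_nonneg_left (s0.trans ?_) (by positivity)
      have : 0 ≤ C0 * (1 + M) ^ q * IS n B := by positivity
      nlinarith
    calc _ ≤ _ := s
      _ ≤ C2 * (1 + M) ^ q * (IS n B * (72 * (1 + M))) +
        2 * (d * (C1 * (1 + M) ^ q * (IS n B * (2000 * (1 + M))))) +
        d ^ 2 * (C0 * (1 + M) ^ q * IS n B * (1 + M)) := by linarith
      _ = _ := by rw [pow_succ]; ring

end CUE

namespace CUE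
set_option linter.unusedSectionVars false

lemma pow_St (m k : ℕ) : (m : ℝ) ^ k = St k (fun j => (m.descFactorial j : ℝ)) := by
  have hj : ∀ j, (m : ℝ) * (m.descFactorial j : ℝ) =
      (m.descFactorial (j + 1) : ℝ) + j * (m.descFactorial j : ℝ) := by
    intro j
    rw [Nat.descFactorial_succ]
    rcases le_or_gt j m with h | h
    · push_cast [Nat.cast_sub h]; ring
    · rw [Nat.descFactorial_eq_zero_iff_lt.2 h]; simp
  induction k with
  | zero => rw [St_zero]; simp
  | succ k ih =>
    rw [St_succ, pow_succ, ih, St, Finset.sum_mul]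
    refine Finset.sum_congr rfl fun j _ => ?_
    rw [← hj]; ring

lemma hasSum_fact (l : ℝ) (j : ℕ) :
    HasSum (fun m : ℕ => (m.descFactorial j : ℝ) * Real.exp (-l) * l ^ m / (m.factorial : ℝ)) (l ^ j) := by
  rw [← hasSum_nat_add_iff' j]
  have h0 : ∑ i ∈ Finset.range j, (i.descFactorial j : ℝ) * Real.exp (-l) * l ^ i / (i.factorial : ℝ) = 0 := by
    refine Finset.sum_eq_zero fun i hi => ?_
    rw [Nat.descFactorial_eq_zero_iff_lt.2 (Finset.mem_range.1 hi)]; simp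
  rw [h0, sub_zero]
  have h1 : HasSum (fun m : ℕ => l ^ m / (m.factorial : ℝ)) (Real.exp l) := by
    rw [Real.exp_eq_exp_ℝ]; exact NormedSpace.expSeries_div_hasSum_exp l
  have h2 := h1.mul_left (Real.exp (-l) * l ^ j)
  have e : Real.exp (-l) * l ^ j * Real.exp l = l ^ j := by
    rw [Real.exp_neg]; field_simp
  rw [e] at h2
  have key : (fun m : ℕ => ((m + j).descFactorial j : ℝ) * Real.exp (-l) * l ^ (m + j) /
      ((m + j).factorial : ℝ)) = fun m : ℕ => Real.exp (-l) * l ^ j * (l ^ m / (m.factorial : ℝ)) := by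
    funext m
    have h3 := Nat.factorial_mul_descFactorial (n := m + j) (k := j) (by omega)
    rw [Nat.add_sub_cancel] at h3
    rw [← h3, pow_add]
    have h4 : ((m + j).descFactorial j : ℝ) ≠ 0 := by
      rw [Nat.cast_ne_zero, Ne, Nat.descFactorial_eq_zero_iff_lt]; omega
    have h5 : (m.factorial : ℝ) ≠ 0 := by positivity
    push_cast
    field_simp
  rw [key]
  exact h2

lemma poisson_moment (l : ℝ) (k : ℕ) :
    ∑' m : ℕ, (m : ℝ) ^ k * Real.exp (-l) * l ^ m / (m.factorial : ℝ) = St k (fun j => l ^ j) := by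
  refine HasSum.tsum_eq ?_
  have := hasSum_sum (s := Finset.range (k + 1)) fun j _ =>
    (hasSum_fact l j).mul_left (Nat.stirlingSecond k j : ℝ)
  rw [St]
  have key : (fun m : ℕ => (m : ℝ) ^ k * Real.exp (-l) * l ^ m / (m.factorial : ℝ)) =
      fun m : ℕ => ∑ j ∈ Finset.range (k + 1), (Nat.stirlingSecond k j : ℝ) *
        ((m.descFactorial j : ℝ) * Real.exp (-l) * l ^ m / (m.factorial : ℝ)) := by
    funext m
    rw [pow_St, St, Finset.sum_mul, Finset.sum_mul, Finset.sum_div]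
    refine Finset.sum_congr rfl fun j _ => by ring
  rw [key]
  exact this

lemma stir_pos (k j : ℕ) (h1 : 1 ≤ j) (h2 : j ≤ k) : 1 ≤ Nat.stirlingSecond k j := by
  induction k generalizing j with
  | zero => omega
  | succ k ih =>
    obtain ⟨j, rfl⟩ : ∃ i, j = i + 1 := ⟨j - 1, by omega⟩
    rw [Nat.stirlingSecond_succ_succ]
    rcases Nat.lt_or_ge k (j + 1) with h | h
    · have : j = k := by omega
      rw [this, Nat.stirlingSecond_self]; omega
    · have := ih (j + 1) (by omega) h
      nlinarith

lemma pow_le_St {l : ℝ} (hl : 0 ≤ l) {k i : ℕ} (h1 : 1 ≤ i) (h2 : i ≤ k) : l ^ i ≤ St k (fun j => l ^ j) := by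
  have : (Nat.stirlingSecond k i : ℝ) * l ^ i ≤ St k (fun j => l ^ j) :=
    Finset.single_le_sum (f := fun j => (Nat.stirlingSecond k j : ℝ) * l ^ j)
      (fun j _ => by positivity) (Finset.mem_range.2 (by omega))
  have h3 : (1 : ℝ) ≤ Nat.stirlingSecond k i := by exact_mod_cast stir_pos k i h1 h2
  have h4 : 0 ≤ l ^ i := by positivity
  nlinarith

lemma mu_pow_le {l : ℝ} (hl : 0 ≤ l) (k : ℕ) :
    l * (1 + l) ^ k ≤ 2 ^ (k + 1) * St (k + 1) (fun j => l ^ j) := by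
  have h1 : (1 + l) ^ k ≤ 2 ^ k * (1 + l ^ k) := by
    have := add_pow_le (zero_le_one' ℝ) hl k
    rw [one_pow] at this
    refine this.trans ?_
    gcongr
    · norm_num
    · omega
  have h2 := pow_le_St hl (k := k + 1) (i := 1) le_rfl (by omega)
  have h3 := pow_le_St hl (k := k + 1) (i := k + 1) (by omega) le_rfl
  calc l * (1 + l) ^ k ≤ l * (2 ^ k * (1 + l ^ k)) := by gcongr
    _ = 2 ^ k * (l ^ 1 + l ^ (k + 1)) := by ring
    _ ≤ 2 ^ k * (St (k + 1) (fun j => l ^ j) + St (k + 1) (fun j => l ^ j)) := by gcongr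
    _ = _ := by ring

end CUE

namespace CUE
set_option linter.unusedSectionVars false
variable {n : ℕ}

/-- IS for iterated pairs -/
noncomputable def IA (n : ℕ) (γ a b : ℝ) (j : ℕ) : ℝ := IS n (AA γ a b j)

lemma IA_zero (γ a b : ℝ) : IA n γ a b 0 = 1 := IS_emp

lemma IA_nonneg (γ a b : ℝ) (j : ℕ) : 0 ≤ IA n γ a b j := IS_nonneg _

lemma IA_diff {γ : ℝ} (hγ : 0 ≤ γ) (a b : ℝ) (j : ℕ) :
    |IA n γ a b (j + 1) - IA n γ a b j * E1 n γ a b| ≤ IA n γ a b j * (8 * j * (n * γ) ^ 3 / π) := by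
  have := IS_pair_diff (n := n) (a := a) (b := b) hγ (meas_AA γ a b j)
  rw [card_KK] at this
  refine this.trans (le_of_eq ?_)
  push_cast
  rw [IA]
  ring

/-- the error term -/
noncomputable def err (n : ℕ) (γ a b : ℝ) : ℝ := (n : ℝ)⁻¹ + γ ^ 2 * (n : ℝ) ^ 2 +
  (γ ^ 2 * (n : ℝ) ^ 2) ^ 3 + ((n : ℝ) * (b - a)) ^ (-(2 : ℝ) / 3)

lemma err_nonneg {γ a b : ℝ} (hab : a ≤ b) : 0 ≤ err n γ a b := by
  have : 0 ≤ (n : ℝ) * (b - a) := mul_nonneg (Nat.cast_nonneg _) (by linarith)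
  unfold err; positivity

lemma one_le_err {γ a b : ℝ} (hn : 1 ≤ n) (hγ : 0 < γ) (hab : a < b)
    (h : 1 ≤ n * γ ∨ n * (b - a) ≤ 1) : 1 ≤ err n γ a b := by
  have hn' : (0:ℝ) < n := by exact_mod_cast hn
  have hL : 0 < b - a := by linarith
  have h1 : 0 ≤ (n : ℝ)⁻¹ := by positivity
  have h2 : 0 ≤ γ ^ 2 * (n : ℝ) ^ 2 := by positivity
  have h3 : 0 ≤ (γ ^ 2 * (n : ℝ) ^ 2) ^ 3 := by positivity
  have h4 : 0 ≤ ((n : ℝ) * (b - a)) ^ (-(2 : ℝ) / 3) := by positivity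
  unfold err
  rcases h with h | h
  · have : 1 ≤ γ ^ 2 * (n : ℝ) ^ 2 := by nlinarith
    linarith
  · have : 1 ≤ ((n : ℝ) * (b - a)) ^ (-(2 : ℝ) / 3) :=
      Real.one_le_rpow_of_pos_of_le_one_of_nonpos (by positivity) h (by norm_num)
    linarith

lemma err_facts {γ a b : ℝ} (hn : 1 ≤ n) (hγ : 0 < γ) (hab : a < b)
    (hx : n * γ ≤ 1) (hy : 1 ≤ n * (b - a)) :
    err n γ a b ≤ 4 ∧ (n : ℝ)⁻¹ ≤ err n γ a b ∧ (n * γ) ^ 2 ≤ err n γ a b ∧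
    (n * (b - a))⁻¹ ≤ err n γ a b ∧ γ / (b - a) + (n : ℝ)⁻¹ + 4 * (n * γ) ^ 2 ≤ 4 * err n γ a b := by
  have hn' : (1:ℝ) ≤ n := by exact_mod_cast hn
  have hL : 0 < b - a := by linarith
  have h1 : 0 ≤ (n : ℝ)⁻¹ := by positivity
  have h2 : 0 ≤ γ ^ 2 * (n : ℝ) ^ 2 := by positivity
  have h3 : 0 ≤ (γ ^ 2 * (n : ℝ) ^ 2) ^ 3 := by positivity
  have h4 : 0 ≤ ((n : ℝ) * (b - a)) ^ (-(2 : ℝ) / 3) := by positivity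
  have e2 : (n * γ) ^ 2 = γ ^ 2 * (n : ℝ) ^ 2 := by ring
  have u1 : (n : ℝ)⁻¹ ≤ 1 := inv_le_one_of_one_le₀ hn'
  have u2 : γ ^ 2 * (n : ℝ) ^ 2 ≤ 1 := by rw [← e2]; exact pow_le_one₀ (by positivity) hx
  have u3 : (γ ^ 2 * (n : ℝ) ^ 2) ^ 3 ≤ 1 := pow_le_one₀ h2 u2
  have u4 : ((n : ℝ) * (b - a)) ^ (-(2 : ℝ) / 3) ≤ 1 :=
    Real.rpow_le_one_of_one_le_of_nonpos hy (by norm_num)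
  have u5 : ((n : ℝ) * (b - a))⁻¹ ≤ ((n : ℝ) * (b - a)) ^ (-(2 : ℝ) / 3) := by
    rw [← Real.rpow_neg_one]
    exact Real.rpow_le_rpow_of_exponent_le hy (by norm_num)
  have u6 : γ / (b - a) ≤ ((n : ℝ) * (b - a))⁻¹ := by
    rw [div_le_iff₀ hL, mul_inv, mul_assoc, inv_mul_cancel₀ hL.ne', mul_one]
    rw [le_inv_comm₀ hγ (by linarith), le_inv_comm₀ (by linarith) hγ, inv_eq_one_div,
      le_div_iff₀ (by linarith)]
    linarith
  rw [e2]
  unfold err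
  refine ⟨by linarith, by linarith, by linarith, by linarith, by linarith⟩

lemma IA_step {γ a b : ℝ} (hn : 1 ≤ n) (hγ : 0 < γ) (ha : 0 ≤ a) (hab : a < b) (hb : b ≤ 2 * π)
    (hx : n * γ ≤ 1) (hy : 1 ≤ n * (b - a)) (j : ℕ) :
    |IA n γ a b (j + 1) - 2 * muP n γ a b * IA n γ a b j| ≤
      2 * muP n γ a b * IA n γ a b j * ((4 + 2000 * j) * err n γ a b) := by
  obtain ⟨-, -, -, f4, f5⟩ := err_facts hn hγ hab hx hy
  have hM := muP_nonneg (n := n) hγ.le hab.le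
  have hI := IA_nonneg (n := n) γ a b j
  have hn' : (0:ℝ) < n := by exact_mod_cast hn
  have hL : 0 < b - a := by linarith
  have d1 := IA_diff (n := n) hγ.le a b j
  have e1 : |E1 n γ a b - 2 * muP n γ a b| ≤ 2 * muP n γ a b * (4 * err n γ a b) := by
    have l := E1_ge hγ ha hab hb hn
    have u := E1_le (n := n) hγ.le hab.le
    have : 2 * muP n γ a b * (γ / (b - a) + (n : ℝ)⁻¹ + 4 * (n * γ) ^ 2) ≤
      2 * muP n γ a b * (4 * err n γ a b) := by gcongr
    rw [abs_le]
    constructor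
    · nlinarith
    · have : 0 ≤ 2 * muP n γ a b * (4 * err n γ a b) := by
        have := err_nonneg (n := n) (γ := γ) hab.le
        positivity
      linarith
  have e2 : 8 * j * (n * γ) ^ 3 / π ≤ 2 * muP n γ a b * (2000 * j * err n γ a b) := by
    have : 8 * j * (n * γ) ^ 3 / π = 2 * muP n γ a b * (576 * π * j * (n * (b - a))⁻¹) := by
      unfold muP; field_simp; ring
    rw [this]
    have : π ≤ 3.15 := Real.pi_lt_d2.le
    have hp : 576 * π ≤ 2000 := by linarith
    gcongr
  have e3 : |IA n γ a b (j + 1) - 2 * muP n γ a b * IA n γ a b j| ≤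
      |IA n γ a b (j + 1) - IA n γ a b j * E1 n γ a b| +
      IA n γ a b j * |E1 n γ a b - 2 * muP n γ a b| := by
    have : IA n γ a b (j + 1) - 2 * muP n γ a b * IA n γ a b j =
      (IA n γ a b (j + 1) - IA n γ a b j * E1 n γ a b) +
      IA n γ a b j * (E1 n γ a b - 2 * muP n γ a b) := by ring
    rw [this]
    refine (abs_add_le _ _).trans (le_of_eq ?_)
    rw [abs_mul, abs_of_nonneg hI]
  have a1 := mul_le_mul_of_nonneg_left e1 hI
  have a2 := mul_le_mul_of_nonneg_left e2 hI
  linarith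

/-- constants for the comparison -/
noncomputable def cc : ℕ → ℝ
  | 0 => 0
  | j + 1 => cc j + (1 + 4 * cc j) * (4 + 2000 * j)

lemma cc_nonneg (j : ℕ) : 0 ≤ cc j := by
  induction j with
  | zero => exact le_rfl
  | succ j ih => rw [cc]; positivity

lemma cc_mono : Monotone cc := monotone_nat_of_le_succ fun j => by
  have := cc_nonneg j
  rw [cc]
  have : 0 ≤ (1 + 4 * cc j) * (4 + 2000 * j) := by positivity
  linarith

lemma IA_cmp {γ a b : ℝ} (hn : 1 ≤ n) (hγ : 0 < γ) (ha : 0 ≤ a) (hab : a < b) (hb : b ≤ 2 * π)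
    (hx : n * γ ≤ 1) (hy : 1 ≤ n * (b - a)) (j : ℕ) :
    |IA n γ a b j - (2 * muP n γ a b) ^ j| ≤ cc j * (2 * muP n γ a b) ^ j * err n γ a b := by
  have hM := muP_nonneg (n := n) hγ.le hab.le
  have hE := err_nonneg (n := n) (γ := γ) hab.le
  obtain ⟨f1, -⟩ := err_facts hn hγ hab hx hy
  induction j with
  | zero => rw [IA_zero]; simp [cc]
  | succ j ih =>
    have s := IA_step hn hγ ha hab hb hx hy j
    have hc := cc_nonneg j
    set X := 2 * muP n γ a b with hX
    have hX0 : 0 ≤ X := by positivity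
    set e := err n γ a b
    have hP : 0 ≤ X ^ j := by positivity
    have b1 : IA n γ a b j ≤ X ^ j * (1 + 4 * cc j) := by
      have h1 := (abs_le.1 ih).2
      have h2 : cc j * X ^ j * e ≤ cc j * X ^ j * 4 := by gcongr
      linarith
    have b2 : |X * (IA n γ a b j - X ^ j)| ≤ X * (cc j * X ^ j * e) := by
      rw [abs_mul, abs_of_nonneg hX0]; gcongr
    have b3 : X * IA n γ a b j * ((4 + 2000 * j) * e) ≤
        X * (X ^ j * (1 + 4 * cc j)) * ((4 + 2000 * j) * e) := by gcongr
    have e3 : IA n γ a b (j + 1) - X ^ (j + 1) =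
      (IA n γ a b (j + 1) - X * IA n γ a b j) + X * (IA n γ a b j - X ^ j) := by ring
    rw [e3]
    refine (abs_add_le _ _).trans ?_
    calc _ ≤ X * (X ^ j * (1 + 4 * cc j)) * ((4 + 2000 * j) * e) + X * (cc j * X ^ j * e) := by
          linarith
      _ = _ := by rw [cc, pow_succ]; ring

lemma St_cmp {γ a b : ℝ} (hn : 1 ≤ n) (hγ : 0 < γ) (ha : 0 ≤ a) (hab : a < b) (hb : b ≤ 2 * π)
    (hx : n * γ ≤ 1) (hy : 1 ≤ n * (b - a)) (k : ℕ) :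
    |St k (fun j => IA n γ a b j / 2 ^ j) - St k (fun j => muP n γ a b ^ j)| ≤
      cc k * St k (fun j => muP n γ a b ^ j) * err n γ a b := by
  have hM := muP_nonneg (n := n) hγ.le hab.le
  have hE := err_nonneg (n := n) (γ := γ) hab.le
  rw [St, St, ← Finset.sum_sub_distrib, Finset.mul_sum, Finset.sum_mul]
  refine (Finset.abs_sum_le_sum_abs _ _).trans (Finset.sum_le_sum fun j hj => ?_)
  rw [← mul_sub, abs_mul, abs_of_nonneg (Nat.cast_nonneg _)]
  have h1 := IA_cmp hn hγ ha hab hb hx hy j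
  have hc : cc j ≤ cc k := cc_mono (by have := Finset.mem_range.1 hj; omega)
  have h2 : |IA n γ a b j / 2 ^ j - muP n γ a b ^ j| ≤ cc k * muP n γ a b ^ j * err n γ a b := by
    have : IA n γ a b j / 2 ^ j - muP n γ a b ^ j = (IA n γ a b j - (2 * muP n γ a b) ^ j) / 2 ^ j := by
      rw [mul_pow]; field_simp
    rw [this, abs_div, abs_of_pos (by positivity : (0:ℝ) < 2 ^ j), div_le_iff₀ (by positivity)]
    refine h1.trans ?_
    rw [mul_pow]
    calc cc j * (2 ^ j * muP n γ a b ^ j) * err n γ a b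
        ≤ cc k * (2 ^ j * muP n γ a b ^ j) * err n γ a b := by gcongr
      _ = _ := by ring
  calc _ ≤ (Nat.stirlingSecond k j : ℝ) * (cc k * muP n γ a b ^ j * err n γ a b) := by gcongr
    _ = _ := by ring

end CUE

namespace CUE
set_option linter.unusedSectionVars false
variable {n : ℕ}

lemma IS_one {γ a b : ℝ} (hγ : 0 ≤ γ) (hab : a ≤ b) :
    IS n (pairS γ a b (Set.univ : Set (Empty → ℝ))) ≤ 72 * muP n γ a b := by
  have := IS_pair (n := n) hγ hab (MeasurableSet.univ : MeasurableSet (Set.univ : Set (Empty → ℝ)))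
  rw [IS_emp, one_mul] at this
  exact this.trans (K1_le hγ hab)

lemma IS_cherry {γ a b : ℝ} (hγ : 0 ≤ γ) (hab : a ≤ b) (u : Empty ⊕ Fin 2) :
    IS n (pendS γ a b (pairS γ a b (Set.univ : Set (Empty → ℝ))) u) ≤
      72 * muP n γ a b * (n * γ) ^ 3 := by
  have h1 := IS_pend (n := n) hγ hab (meas_pairS γ a b
    (MeasurableSet.univ : MeasurableSet (Set.univ : Set (Empty → ℝ)))) u
  refine h1.trans ?_
  have hM := muP_nonneg (n := n) hγ hab
  exact mul_le_mul (IS_one hγ hab) (K2_le_cube hγ hab) (K2_nonneg hγ hab) (by positivity)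

lemma upperG (k : ℕ) : ∃ C : ℝ, 0 ≤ C ∧ ∀ (n : ℕ) (θ : UG n → Fin n → ℝ) (_ : IsAng θ)
    (_ : ∀ U j, θ U j ∈ Set.Ico (0:ℝ) (2 * π))
    (μ : Measure (UG n)) [IsProbabilityMeasure μ] [μ.IsMulLeftInvariant] (γ a b : ℝ) (_ : 0 ≤ γ)
    (_ : a ≤ b), ∫ U, GG γ a b (θ U) ^ (k + 1) ∂μ ≤ C * St (k + 1) fun j => muP n γ a b ^ j := by
  obtain ⟨C, hC, h⟩ := EN k 2
  refine ⟨C * 72 * 2 ^ (k + 1), by positivity, ?_⟩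
  intro n θ hθ hθm μ _ _ γ a b hγ hab
  have hM := muP_nonneg (n := n) hγ hab
  have hm := meas_pairS γ a b (MeasurableSet.univ : MeasurableSet (Set.univ : Set (Empty → ℝ)))
  have h1 := h n θ hθ hθm μ γ a b hγ hab (Empty ⊕ Fin 2) rfl _ hm
  have h2 : ∫ U, GG γ a b (θ U) ^ (k + 1) ∂μ ≤
      ∫ U, NS (θ U) (pairS γ a b (Set.univ : Set (Empty → ℝ))) * NP γ a b (θ U) ^ k ∂μ := by
    refine integral_mono_of_nonneg (ae_of_all _ fun U => pow_nonneg (GG_nonneg _ _ _ _) _)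
      (integrable_NSNP hθ hθm μ γ a b k hm) (ae_of_all _ fun U => ?_)
    have h0 := NP_nonneg γ a b (θ U)
    simp only
    rw [← NP_eq, ← pow_succ']
    refine pow_le_pow_left₀ (GG_nonneg _ _ _ _) ?_ _
    rw [GG]; linarith
  have h3 := mu_pow_le hM k
  calc _ ≤ _ := h2
    _ ≤ _ := h1
    _ ≤ C * (1 + muP n γ a b) ^ k * (72 * muP n γ a b) := by gcongr; exact IS_one hγ hab
    _ = C * 72 * (muP n γ a b * (1 + muP n γ a b) ^ k) := by ring
    _ ≤ C * 72 * (2 ^ (k + 1) * St (k + 1) fun j => muP n γ a b ^ j) := by gcongr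
    _ = _ := by ring

lemma upperE (k : ℕ) : ∃ C : ℝ, 0 ≤ C ∧ ∀ (n : ℕ) (θ : UG n → Fin n → ℝ) (_ : IsAng θ)
    (_ : ∀ U j, θ U j ∈ Set.Ico (0:ℝ) (2 * π))
    (μ : Measure (UG n)) [IsProbabilityMeasure μ] [μ.IsMulLeftInvariant] (γ a b : ℝ) (_ : 0 ≤ γ)
    (_ : a ≤ b), Integrable (fun U => EE γ a b (θ U) * (1 + GG γ a b (θ U)) ^ k) μ ∧
      ∫ U, EE γ a b (θ U) * (1 + GG γ a b (θ U)) ^ k ∂μ ≤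
      C * (St (k + 1) fun j => muP n γ a b ^ j) * (n * γ) ^ 3 := by
  obtain ⟨C, hC, h⟩ := EN k 3
  obtain ⟨C0, hC0, h0⟩ := EN 0 3
  refine ⟨2 ^ k * (4 * (C0 + C)) * 72 * 2 ^ (k + 1), by positivity, ?_⟩
  intro n θ hθ hθm μ _ _ γ a b hγ hab
  have hM := muP_nonneg (n := n) hγ hab
  have hm := fun u => meas_pendS γ a b (meas_pairS γ a b
    (MeasurableSet.univ : MeasurableSet (Set.univ : Set (Empty → ℝ)))) u
  set BB := fun u => pendS γ a b (pairS γ a b (Set.univ : Set (Empty → ℝ))) u with hBB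
  have iq := fun q u => integrable_NSNP hθ hθm μ γ a b q (hm u)
  have h3 := mu_pow_le hM k
  have P1 : (1:ℝ) ≤ (1 + muP n γ a b) ^ k := one_le_pow₀ (by linarith)
  have hq : ∀ u, ∫ U, NS (θ U) (BB u) * NP γ a b (θ U) ^ k ∂μ ≤
      C * (1 + muP n γ a b) ^ k * (72 * muP n γ a b * (n * γ) ^ 3) := fun u =>
    (h n θ hθ hθm μ γ a b hγ hab _ rfl _ (hm u)).trans
      (mul_le_mul_of_nonneg_left (IS_cherry hγ hab u) (by positivity))
  have hz : ∀ u, ∫ U, NS (θ U) (BB u) * NP γ a b (θ U) ^ 0 ∂μ ≤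
      C0 * (1 + muP n γ a b) ^ k * (72 * muP n γ a b * (n * γ) ^ 3) := fun u => by
    refine (h0 n θ hθ hθm μ γ a b hγ hab _ rfl _ (hm u)).trans ?_
    rw [pow_zero]
    exact mul_le_mul (mul_le_mul_of_nonneg_left P1 hC0) (IS_cherry hγ hab u) (IS_nonneg _)
      (by positivity)
  set W : UG n → ℝ := fun U => 2 ^ k * (2 * (NS (θ U) (BB (Sum.inr 0)) * NP γ a b (θ U) ^ 0 +
      NS (θ U) (BB (Sum.inr 1)) * NP γ a b (θ U) ^ 0 +
      (NS (θ U) (BB (Sum.inr 0)) * NP γ a b (θ U) ^ k +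
      NS (θ U) (BB (Sum.inr 1)) * NP γ a b (θ U) ^ k))) with hW
  have j1 := (iq 0 (Sum.inr 0)).add (iq 0 (Sum.inr 1))
  have j2 := (iq k (Sum.inr 0)).add (iq k (Sum.inr 1))
  have iW : Integrable W μ := ((j1.add j2).const_mul 2).const_mul (2 ^ k)
  have eW : ∫ U, W U ∂μ = 2 ^ k * (2 * ((∫ U, NS (θ U) (BB (Sum.inr 0)) * NP γ a b (θ U) ^ 0 ∂μ) +
      (∫ U, NS (θ U) (BB (Sum.inr 1)) * NP γ a b (θ U) ^ 0 ∂μ) +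
      ((∫ U, NS (θ U) (BB (Sum.inr 0)) * NP γ a b (θ U) ^ k ∂μ) +
      (∫ U, NS (θ U) (BB (Sum.inr 1)) * NP γ a b (θ U) ^ k ∂μ)))) := by
    rw [hW, integral_const_mul, integral_const_mul]
    congr 2
    rw [← integral_add (iq 0 (Sum.inr 0)) (iq 0 (Sum.inr 1)),
      ← integral_add (iq k (Sum.inr 0)) (iq k (Sum.inr 1))]
    exact integral_add j1 j2
  have key : ∀ U, EE γ a b (θ U) * (1 + GG γ a b (θ U)) ^ k ≤ W U := by
    intro U
    have hN := NP_nonneg γ a b (θ U)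
    have hE := EE_nonneg γ a b (θ U)
    have hG := GG_nonneg γ a b (θ U)
    have h1 : (1 + GG γ a b (θ U)) ^ k ≤ 2 ^ k * (1 + NP γ a b (θ U) ^ k) := by
      have a1 : (1 + GG γ a b (θ U)) ^ k ≤ (1 + NP γ a b (θ U)) ^ k := by
        gcongr; rw [GG]; linarith
      have a2 := add_pow_le (zero_le_one' ℝ) hN k
      rw [one_pow] at a2
      refine a1.trans (a2.trans ?_)
      gcongr
      · norm_num
      · omega
    refine (mul_le_mul_of_nonneg_left h1 hE).trans (le_of_eq ?_)
    rw [EE_eq, hW]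
    simp only [pow_zero, hBB]
    ring
  have mE : Measurable fun U => EE γ a b (θ U) := by
    simp only [EE_eq]
    exact ((meas_NS hθ hθm μ (hm _)).const_mul 2).add ((meas_NS hθ hθm μ (hm _)).const_mul 2)
  have mG : Measurable fun U => GG γ a b (θ U) := (meas_NP hθ hθm μ γ a b).div_const 2
  have nn : ∀ U, 0 ≤ EE γ a b (θ U) * (1 + GG γ a b (θ U)) ^ k := fun U =>
    mul_nonneg (EE_nonneg _ _ _ _) (pow_nonneg (by linarith [GG_nonneg γ a b (θ U)]) _)
  have iE : Integrable (fun U => EE γ a b (θ U) * (1 + GG γ a b (θ U)) ^ k) μ :=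
    iW.mono' (mE.mul ((mG.const_add 1).pow_const k)).aestronglyMeasurable
      (ae_of_all _ fun U => by rw [Real.norm_eq_abs, abs_of_nonneg (nn U)]; exact key U)
  refine ⟨iE, ?_⟩
  calc _ ≤ ∫ U, W U ∂μ := integral_mono iE iW key
    _ = _ := eW
    _ ≤ 2 ^ k * (2 * (C0 * (1 + muP n γ a b) ^ k * (72 * muP n γ a b * (n * γ) ^ 3) +
        C0 * (1 + muP n γ a b) ^ k * (72 * muP n γ a b * (n * γ) ^ 3) +
        (C * (1 + muP n γ a b) ^ k * (72 * muP n γ a b * (n * γ) ^ 3) +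
        C * (1 + muP n γ a b) ^ k * (72 * muP n γ a b * (n * γ) ^ 3)))) := by
      gcongr
      · exact hz _
      · exact hz _
      · exact hq _
      · exact hq _
    _ = 2 ^ k * (4 * (C0 + C)) * 72 * (muP n γ a b * (1 + muP n γ a b) ^ k) * (n * γ) ^ 3 := by ring
    _ ≤ 2 ^ k * (4 * (C0 + C)) * 72 * (2 ^ (k + 1) * St (k + 1) fun j => muP n γ a b ^ j) *
        (n * γ) ^ 3 := by gcongr
    _ = _ := by ring

lemma int_St {θ : UG n → Fin n → ℝ} (hθ : IsAng θ)
    (hθm : ∀ U j, θ U j ∈ Set.Ico (0:ℝ) (2 * π))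
    (μ : Measure (UG n)) [IsProbabilityMeasure μ] [μ.IsMulLeftInvariant] (γ a b : ℝ) (k : ℕ) :
    Integrable (fun U => St k (fun j => NA γ a b (θ U) j / 2 ^ j)) μ ∧
    ∫ U, St k (fun j => NA γ a b (θ U) j / 2 ^ j) ∂μ = St k (fun j => IA n γ a b j / 2 ^ j) := by
  have i1 : ∀ j, Integrable (fun U => NA γ a b (θ U) j) μ := fun j => by
    have := integrable_NSNP hθ hθm μ γ a b 0 (meas_AA γ a b j)
    simp only [pow_zero, mul_one] at this; exact this
  have i2 : ∀ j, Integrable (fun U => (Nat.stirlingSecond k j : ℝ) * (NA γ a b (θ U) j / 2 ^ j)) μ :=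
    fun j => ((i1 j).div_const _).const_mul _
  constructor
  · exact integrable_finsetSum _ fun j _ => i2 j
  · unfold St
    rw [integral_finsetSum _ fun j _ => i2 j]
    refine Finset.sum_congr rfl fun j _ => ?_
    rw [integral_const_mul, integral_div]
    congr 2
    exact int_NS hθ hθm μ (meas_AA γ a b j)

theorem main_bound (k : ℕ) : ∃ C : ℝ, ∀ (n : ℕ) (_ : 1 ≤ n) (θ : UG n → Fin n → ℝ) (_ : IsAng θ)
    (_ : ∀ U j, θ U j ∈ Set.Ico (0:ℝ) (2 * π))
    (μ : Measure (UG n)) [IsProbabilityMeasure μ] [μ.IsMulLeftInvariant] (γ a b : ℝ) (_ : 0 < γ)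
    (_ : 0 ≤ a) (_ : a < b) (_ : b ≤ 2 * π),
    |(∫ U, GG γ a b (θ U) ^ (k + 1) ∂μ) - St (k + 1) fun j => muP n γ a b ^ j| ≤
      C * (St (k + 1) fun j => muP n γ a b ^ j) * err n γ a b := by
  obtain ⟨C1, hC1, h1⟩ := upperG k
  obtain ⟨C2, hC2, h2⟩ := upperE k
  refine ⟨(C1 + 1) + (cc (k + 1) + cst k * C2), ?_⟩
  intro n hn θ hθ hθm μ _ _ γ a b hγ ha hab hb
  have hM := muP_nonneg (n := n) hγ.le hab.le
  have hE := err_nonneg (n := n) (γ := γ) hab.le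
  have hcc := cc_nonneg (k + 1)
  have hcs := cst_nonneg k
  have hS : 0 ≤ St (k + 1) fun j => muP n γ a b ^ j :=
    Finset.sum_nonneg fun j _ => by positivity
  have g1 := h1 n θ hθ hθm μ γ a b hγ.le hab.le
  have g0 : 0 ≤ ∫ U, GG γ a b (θ U) ^ (k + 1) ∂μ :=
    integral_nonneg fun U => pow_nonneg (GG_nonneg _ _ _ _) _
  set S := St (k + 1) fun j => muP n γ a b ^ j with hSd
  set e := err n γ a b with he
  by_cases hc : 1 ≤ n * γ ∨ n * (b - a) ≤ 1
  · have h1e : 1 ≤ e := one_le_err hn hγ hab hc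
    have a1 : |(∫ U, GG γ a b (θ U) ^ (k + 1) ∂μ) - S| ≤ (C1 + 1) * S := by
      rw [abs_le]
      constructor
      · nlinarith
      · nlinarith
    have a2 : (C1 + 1) * S * 1 ≤ (C1 + 1) * S * e := by gcongr
    have a3 : 0 ≤ (cc (k + 1) + cst k * C2) * S * e := by positivity
    linarith
  · push Not at hc
    obtain ⟨hx, hy⟩ := hc
    obtain ⟨i1, e1⟩ := int_St hθ hθm μ γ a b (k + 1)
    obtain ⟨i2, e2⟩ := h2 n θ hθ hθm μ γ a b hγ.le hab.le
    obtain ⟨-, -, f3, -, -⟩ := err_facts hn hγ hab hx.le hy.le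
    have hx0 : 0 ≤ n * γ := by positivity
    have hcube : (n * γ) ^ 3 ≤ e := by
      refine le_trans ?_ f3
      have : 0 ≤ (n * γ) ^ 2 := by positivity
      nlinarith
    have iG : Integrable (fun U => GG γ a b (θ U) ^ (k + 1)) μ := by
      refine bdd_integrable (((meas_NP hθ hθm μ γ a b).div_const 2).pow_const _)
        (((n:ℝ) ^ 2) ^ (k + 1)) fun U => ?_
      rw [abs_of_nonneg (pow_nonneg (GG_nonneg _ _ _ _) _)]
      refine pow_le_pow_left₀ (GG_nonneg _ _ _ _) ?_ _
      have := NP_le γ a b (θ U)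
      have := NP_nonneg γ a b (θ U)
      rw [GG]; linarith
    have lo : St (k + 1) (fun j => IA n γ a b j / 2 ^ j) ≤ ∫ U, GG γ a b (θ U) ^ (k + 1) ∂μ := by
      rw [← e1]
      exact integral_mono i1 iG fun U => (GG_pow γ a b (θ U) k).1
    have up : ∫ U, GG γ a b (θ U) ^ (k + 1) ∂μ ≤ St (k + 1) (fun j => IA n γ a b j / 2 ^ j) +
        cst k * (C2 * S * (n * γ) ^ 3) := by
      have : ∫ U, GG γ a b (θ U) ^ (k + 1) ∂μ ≤ ∫ U, (St (k + 1) (fun j => NA γ a b (θ U) j / 2 ^ j) +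
          cst k * (EE γ a b (θ U) * (1 + GG γ a b (θ U)) ^ k)) ∂μ :=
        integral_mono iG (i1.add (i2.const_mul _)) fun U => (GG_pow γ a b (θ U) k).2
      rw [integral_add i1 (i2.const_mul _), integral_const_mul, e1] at this
      exact this.trans (by gcongr)
    have cmp := St_cmp hn hγ ha hab hb hx.le hy.le (k + 1)
    rw [← hSd, ← he] at cmp
    obtain ⟨c1, c2⟩ := abs_le.1 cmp
    have r1 : cst k * (C2 * S * (n * γ) ^ 3) ≤ cst k * (C2 * S * e) := by gcongr
    have r2 : 0 ≤ cst k * (C2 * S * e) := by positivity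
    have r3 : 0 ≤ (C1 + 1) * S * e := by positivity
    rw [abs_le]
    constructor <;> linarith

end CUE

/-- **Moment Estimation Theorem, CUE version.**  For an interval `I = [a, b) ⊆ [0, 2π)`
and `γ > 0`, let `G U` count unordered pairs `{j,k}`, `j ≠ k`, of eigenvalue angles of
`U ∈ U(n)` with `|θ j - θ k| < γ` and `(θ j + θ k)/2 ∈ I`.  With
`μpois = |I| γ³ n⁴ / (144 π²)` and `M k` the `k`-th moment of a Poisson variable with
mean `μpois`, for every `k ≥ 1` there is `C` (depending only on `k`) with
`|E (G^k) - M k| ≤ C * M k * (n⁻¹ + γ²n² + (γ²n²)³ + (n |I|)^{-2/3})`. -/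
theorem moment_estimation_CUE
    (μ : ∀ n : ℕ, Measure (Matrix.unitaryGroup (Fin n) ℂ))
    (hμ : ∀ n, (μ n).IsHaarMeasure)
    (hμprob : ∀ n, IsProbabilityMeasure (μ n))
    -- `θ n U` lists the eigenvalue angles of `U` in `[0, 2π)`, with multiplicity:
    (θ : ∀ n : ℕ, Matrix.unitaryGroup (Fin n) ℂ → Fin n → ℝ)
    (hθmem : ∀ n U j, θ n U j ∈ Set.Ico (0 : ℝ) (2 * π))
    (hθeig : ∀ n (U : Matrix.unitaryGroup (Fin n) ℂ),
      (Matrix.charpoly (U : Matrix (Fin n) (Fin n) ℂ)).roots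
        = Multiset.map (fun j => Complex.exp ((θ n U j : ℂ) * Complex.I))
            (Finset.univ : Finset (Fin n)).val)
    (k : ℕ) (hk : 1 ≤ k) :
    ∃ C : ℝ, ∀ n : ℕ, 1 ≤ n → ∀ γ : ℝ, 0 < γ → ∀ a b : ℝ,
      0 ≤ a → a ≤ b → b ≤ 2 * π →
      -- the number of close pairs with midpoint in `I = [a, b)`:
      ∀ G : Matrix.unitaryGroup (Fin n) ℂ → ℕ,
      (∀ U, G U = Nat.card {p : Fin n × Fin n // p.1 < p.2 ∧
          |θ n U p.1 - θ n U p.2| < γ ∧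
          (θ n U p.1 + θ n U p.2) / 2 ∈ Set.Ico a b}) →
      -- the Poisson mean and `k`-th Poisson moment:
      ∀ μpois Mk : ℝ,
      μpois = (b - a) * γ ^ 3 * (n : ℝ) ^ 4 / (144 * π ^ 2) →
      Mk = ∑' m : ℕ, (m : ℝ) ^ k * Real.exp (-μpois) * μpois ^ m / (m.factorial : ℝ) →
      |(∫ U, ((G U : ℝ)) ^ k ∂(μ n)) - Mk| ≤
        C * Mk * ((n : ℝ)⁻¹ + γ ^ 2 * (n : ℝ) ^ 2 + (γ ^ 2 * (n : ℝ) ^ 2) ^ 3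
          + ((n : ℝ) * (b - a)) ^ (-(2 : ℝ) / 3)) := by
  obtain ⟨k, rfl⟩ : ∃ i, k = i + 1 := ⟨k - 1, by omega⟩
  obtain ⟨C, h⟩ := CUE.main_bound k
  refine ⟨C, ?_⟩
  intro n hn γ hγ a b ha hab hb G hG μpois Mk hmu hMk
  rw [CUE.poisson_moment] at hMk
  rcases hab.lt_or_eq with hlt | heq
  · haveI := hμ n
    haveI := hμprob n
    have h1 := h n hn (θ n) (hθeig n) (hθmem n) (μ n) γ a b hγ ha hlt hb
    have e1 : CUE.muP n γ a b = μpois := by rw [hmu]; rfl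
    have e2 : ∀ U, (G U : ℝ) = CUE.GG γ a b (θ n U) := fun U => by
      rw [hG U]; exact CUE.GG_card γ a b (θ n U)
    simp only [e2]
    rw [e1, ← hMk] at h1
    exact h1
  · have g0 : ∀ U, G U = 0 := by
      intro U
      rw [hG U, ← heq, Set.Ico_self]
      simp
    have m0 : μpois = 0 := by rw [hmu, heq]; simp
    have M0 : Mk = 0 := by
      rw [hMk, m0, CUE.St]
      refine Finset.sum_eq_zero fun j _ => ?_
      rcases j with _ | j
      · simp
      · simp
    rw [M0]
    simp [g0]
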